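/- Let ε > 0 be fixed. For N large and any parameter A with A ≫ N^{−1/4}, one has ∑_{N ≤ k ≤ 2√2 N} d(k) k^{−1/6} e^{3πi(Ak)^{2/3}} = √3 · A^{−4/3} ∑_{A^{4/3}N^{1/3} ≤ k ≤ √2 A^{4/3}N^{1/3}} d(k) k^{1/2} e^{−πi(k/A)²} + O(A^{−1/3} N^{1/2+ε}) + O(A^{1/3} N^{1/6} log N) + O(A^{−1/9} N^{2/9+ε}); in particular the left-hand side is ≪ A^{2/3} N^{1/2} log N. -/

import Mathlib

open Complex Filter Real MeasureTheory Finset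

noncomputable def chi (s : ℂ) : ℂ :=
  2 ^ s * (π : ℂ) ^ (s - 1) * Complex.sin (π * s / 2) * Complex.Gamma (1 - s)

noncomputable def Z (t : ℝ) : ℂ :=
  chi (1 / 2 + I * t) ^ (-(1 / 2 : ℂ)) * riemannZeta (1 / 2 + I * t)

/-- number of positive divisors -/
noncomputable def d (k : ℕ) : ℕ := k.divisors.card

/-- number of ordered triples of positive integers with product `n` -/
noncomputable def d3 (n : ℕ) : ℕ :=
  ((Finset.Icc 1 n ×ˢ Finset.Icc 1 n ×ˢ Finset.Icc 1 n).filter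
    fun p : ℕ × ℕ × ℕ => p.1 * p.2.1 * p.2.2 = n).card

/-- sum over integers `a ≤ k ≤ b` where terms at integer endpoints are halved -/
noncomputable def psum (a b : ℝ) (f : ℕ → ℂ) : ℂ :=
  ∑ k ∈ Finset.Icc ⌈a⌉₊ ⌊b⌋₊,
    (if (k : ℝ) = a ∨ (k : ℝ) = b then (1 / 2 : ℂ) else 1) * f k

/-- The additive character `x ↦ exp (2 π i x)`. -/
noncomputable def ee (x : ℝ) : ℂ := Complex.exp (2 * π * x * I)

lemma norm_ee (x : ℝ) : ‖ee x‖ = 1 := by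
  have : (2 * π * x * I : ℂ) = ((2 * π * x : ℝ) : ℂ) * I := by push_cast; ring
  rw [ee, this, Complex.norm_exp_ofReal_mul_I]

lemma ee_add (x y : ℝ) : ee (x + y) = ee x * ee y := by
  rw [ee, ee, ee, ← Complex.exp_add]; congr 1; push_cast; ring

lemma ee_int_add (n : ℤ) (x : ℝ) : ee (n + x) = ee x := by
  have : ee n = 1 := by
    rw [ee, Complex.exp_eq_one_iff]; exact ⟨n, by push_cast; ring⟩
  rw [ee_add, this, one_mul]

lemma conj_ee (x : ℝ) : (starRingEnd ℂ) (ee x) = ee (-x) := by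
  rw [ee, ee, ← Complex.exp_conj]; congr 1; simp [Complex.conj_ofNat]

lemma continuous_ee : Continuous ee := by unfold ee; fun_prop

lemma hasDerivAt_ee_comp {h : ℝ → ℝ} {h1 x : ℝ} (hh : HasDerivAt h h1 x) :
    HasDerivAt (fun t => ee (h t)) (2 * π * I * h1 * ee (h x)) x := by
  have h' : HasDerivAt (fun t => ee (h t)) _ x :=
    ((hh.ofReal_comp.const_mul (2 * π : ℂ)).mul_const I).cexp
  refine h'.congr_deriv ?_
  unfold ee; ring

lemma hasSum_sq_inv_ee (t : ℝ) :
    HasSum (fun ν : ℤ => 1 / (ν : ℂ) ^ 2 * ee (ν * t))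
      (2 * π ^ 2 * (bernoulliFun 2 (Int.fract t) : ℂ)) := by
  have h := hasSum_one_div_pow_mul_fourier_mul_bernoulliFun (k := 2) le_rfl
    (x := Int.fract t) ⟨Int.fract_nonneg t, (Int.fract_lt_one t).le⟩
  convert h using 1
  · funext ν
    congr 1
    rw [fourier_coe_apply]
    have : ν * t = ((ν * ⌊t⌋ : ℤ) : ℝ) + ν * Int.fract t := by
      push_cast; rw [← mul_add, Int.floor_add_fract]
    rw [this, ee_int_add, ee]
    congr 1; push_cast; rw [div_one]; ring
  · rw [mul_pow, mul_pow, I_sq, Nat.factorial_two]; push_cast; ring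

lemma continuous_bernoulliFun_two_fract : Continuous fun t : ℝ => bernoulliFun 2 (Int.fract t) := by
  refine ContinuousOn.comp_fract'' (f := bernoulliFun 2) ?_ ?_
  · exact (contDiff_bernoulliFun 2).continuous.continuousOn
  · norm_num

lemma hasDerivAt_bernoulliFun_two_fract {t : ℝ} (ht : t ∉ Set.range ((↑) : ℤ → ℝ)) :
    HasDerivAt (fun t : ℝ => bernoulliFun 2 (Int.fract t)) (2 * (Int.fract t - 1 / 2)) t := by
  have h1 : HasDerivAt (fun s : ℝ => s - ⌊t⌋) 1 t := (hasDerivAt_id t).sub_const _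
  have h2 : HasDerivAt (bernoulliFun 2) (2 * (Int.fract t - 1 / 2)) (t - ⌊t⌋) := by
    have := hasDerivAt_bernoulliFun 2 (t - ⌊t⌋)
    rw [Int.self_sub_floor] at this ⊢
    norm_num at this ⊢
    exact this
  have h3 := HasDerivAt.comp t h2 h1
  rw [mul_one] at h3
  refine h3.congr_of_eventuallyEq ?_
  have hlt : (⌊t⌋ : ℝ) < t := lt_of_le_of_ne (Int.floor_le t) fun h => ht ⟨_, h⟩
  filter_upwards [Ioo_mem_nhds hlt (Int.lt_floor_add_one t)] with s hs
  have : ⌊s⌋ = ⌊t⌋ := Int.floor_eq_iff.2 ⟨hs.1.le, hs.2⟩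
  simp [Int.fract, this]

lemma hasSum_integral_mul_sawtooth {F1 F2 : ℝ → ℂ} {α β : ℝ} (hαβ : α ≤ β)
    (hF : ∀ x ∈ Set.Icc α β, HasDerivAt F1 (F2 x) x) (hc : ContinuousOn F2 (Set.Icc α β)) :
    HasSum (fun ν : ℤ => 1 / (ν : ℂ) * ∫ t in α..β, F1 t * ee (ν * t))
      (-(2 * π * I) * ∫ t in α..β, F1 t * ((Int.fract t - 1 / 2 : ℝ) : ℂ)) := by
  have hF1c : ContinuousOn F1 (Set.Icc α β) := fun x hx => (hF x hx).continuousAt.continuousWithinAt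
  have hu : Set.uIcc α β = Set.Icc α β := Set.uIcc_of_le hαβ
  have hpi : (π : ℂ) ≠ 0 := by exact_mod_cast Real.pi_ne_zero
  have hder : ∀ (ν : ℤ) (x : ℝ), HasDerivAt (fun t : ℝ => ee (ν * t)) (2 * π * I * ν * ee (ν * x)) x := by
    intro ν x
    have := hasDerivAt_ee_comp (h := fun t => ν * t) (h1 := ν) (x := x)
      (by simpa using (hasDerivAt_id x).const_mul (ν : ℝ))
    simpa using this
  have hcont : ∀ ν : ℤ, Continuous fun t : ℝ => ee (ν * t) := fun ν =>
    continuous_ee.comp (by fun_prop)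
  -- termwise integration by parts
  have hparts : ∀ ν : ℤ, 1 / (ν : ℂ) * ∫ t in α..β, F1 t * ee (ν * t) =
      1 / (2 * π * I) * (F1 β * (1 / (ν : ℂ) ^ 2 * ee (ν * β)) - F1 α * (1 / (ν : ℂ) ^ 2 * ee (ν * α))
        - ∫ t in α..β, F2 t * (1 / (ν : ℂ) ^ 2 * ee (ν * t))) := by
    intro ν
    rcases eq_or_ne ν 0 with rfl | hν
    · simp
    have hν' : (ν : ℂ) ≠ 0 := by exact_mod_cast hν
    have h := intervalIntegral.integral_mul_deriv_eq_deriv_mul (a := α) (b := β) (u := F1) (u' := F2)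
      (v := fun t : ℝ => ee (ν * t)) (v' := fun x => 2 * π * I * ν * ee (ν * x))
      (by rw [hu]; exact hF) (fun x _ => hder ν x)
      (ContinuousOn.intervalIntegrable (by rwa [hu]))
      (Continuous.intervalIntegrable (by have := hcont ν; fun_prop) _ _)
    have e1 : ∫ t in α..β, F1 t * (2 * π * I * ν * ee (ν * t)) =
        (2 * π * I * ν) * ∫ t in α..β, F1 t * ee (ν * t) := by
      rw [← intervalIntegral.integral_const_mul]; congr 1; funext t; ring
    have e2 : ∫ t in α..β, F2 t * (1 / (ν : ℂ) ^ 2 * ee (ν * t)) =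
        (1 / (ν : ℂ) ^ 2) * ∫ t in α..β, F2 t * ee (ν * t) := by
      rw [← intervalIntegral.integral_const_mul]; congr 1; funext t; ring
    rw [e1] at h
    rw [e2]
    have h' : ∫ t in α..β, F2 t * ee (ν * t) = F1 β * ee (ν * β) - F1 α * ee (ν * α)
      - (2 * π * I * ν) * ∫ t in α..β, F1 t * ee (ν * t) := by rw [h]; ring
    rw [h']
    field_simp
    ring
  simp_rw [hparts]
  have hsumm : Summable fun ν : ℤ => ‖(1 / (ν : ℂ) ^ 2)‖ := by
    have := (Real.summable_one_div_int_pow (p := 2)).2 (by norm_num)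
    refine this.congr fun ν => ?_
    simp
  have hintegral : HasSum (fun ν : ℤ => ∫ t in α..β, F2 t * (1 / (ν : ℂ) ^ 2 * ee (ν * t)))
      (∫ t in α..β, F2 t * (2 * π ^ 2 * (bernoulliFun 2 (Int.fract t) : ℂ))) := by
    refine intervalIntegral.hasSum_integral_of_dominated_convergence
      (fun ν t => ‖F2 t‖ * ‖(1 / (ν : ℂ) ^ 2)‖) ?_ ?_ ?_ ?_ ?_
    · intro ν
      have : ContinuousOn (fun t => F2 t * (1 / (ν : ℂ) ^ 2 * ee (ν * t))) (Set.Icc α β) :=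
        hc.mul (continuousOn_const.mul (hcont ν).continuousOn)
      exact (this.mono (by rw [← hu]; exact Set.uIoc_subset_uIcc)).aestronglyMeasurable
        measurableSet_uIoc
    · intro ν
      refine Eventually.of_forall fun t _ => ?_
      rw [norm_mul, norm_mul, norm_ee, mul_one]
    · exact Eventually.of_forall fun t _ => hsumm.mul_left _
    · simp_rw [tsum_mul_left]
      exact ContinuousOn.intervalIntegrable (by rw [hu]; exact hc.norm.mul continuousOn_const)
    · exact Eventually.of_forall fun t _ => (hasSum_sq_inv_ee t).mul_left _
  have htot := ((((hasSum_sq_inv_ee β).mul_left (F1 β)).sub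
    ((hasSum_sq_inv_ee α).mul_left (F1 α))).sub hintegral).mul_left (1 / (2 * π * I : ℂ))
  have hftc := MeasureTheory.integral_eq_of_hasDerivAt_off_countable
    (fun t => F1 t * (bernoulliFun 2 (Int.fract t) : ℂ))
    (fun t => F2 t * (bernoulliFun 2 (Int.fract t) : ℂ) + F1 t * ((2 * (Int.fract t - 1 / 2) : ℝ) : ℂ))
    (a := α) (b := β) (s := Set.range ((↑) : ℤ → ℝ)) (Set.countable_range _)
    (by
      rw [hu]
      exact hF1c.mul (Complex.continuous_ofReal.comp continuous_bernoulliFun_two_fract).continuousOn)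
    (by
      rintro x ⟨hx, hx'⟩
      rw [min_eq_left hαβ, max_eq_right hαβ] at hx
      exact (hF x ⟨hx.1.le, hx.2.le⟩).mul (hasDerivAt_bernoulliFun_two_fract hx').ofReal_comp)
  have hi1 : IntervalIntegrable (fun t => F2 t * (bernoulliFun 2 (Int.fract t) : ℂ)) volume α β :=
    ContinuousOn.intervalIntegrable (by
      rw [hu]
      exact hc.mul (Complex.continuous_ofReal.comp continuous_bernoulliFun_two_fract).continuousOn)
  have hi2 : IntervalIntegrable (fun t => F1 t * ((2 * (Int.fract t - 1 / 2) : ℝ) : ℂ)) volume α β := by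
    refine IntervalIntegrable.continuousOn_mul ?_ (by rwa [hu])
    refine (intervalIntegrable_const (c := (1 : ℝ))).mono_fun ?_ ?_
    · exact (Complex.measurable_ofReal.comp
        ((measurable_fract.sub_const _).const_mul _)).aestronglyMeasurable
    · refine Eventually.of_forall fun t => ?_
      simp only [Complex.norm_real, norm_one, Real.norm_eq_abs, abs_le]
      constructor <;> linarith [Int.fract_nonneg t, Int.fract_lt_one t]
  have hftc' := hftc (hi1.add hi2)
  rw [intervalIntegral.integral_add hi1 hi2] at hftc'
  have e3 : ∫ t in α..β, F1 t * ((2 * (Int.fract t - 1 / 2) : ℝ) : ℂ) =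
      2 * ∫ t in α..β, F1 t * ((Int.fract t - 1 / 2 : ℝ) : ℂ) := by
    rw [← intervalIntegral.integral_const_mul]; congr 1; funext t; push_cast; ring
  have e4 : ∫ t in α..β, F2 t * (2 * π ^ 2 * (bernoulliFun 2 (Int.fract t) : ℂ)) =
      2 * π ^ 2 * ∫ t in α..β, F2 t * (bernoulliFun 2 (Int.fract t) : ℂ) := by
    rw [← intervalIntegral.integral_const_mul]; congr 1; funext t; ring
  rw [e3] at hftc'
  rw [e4, eq_sub_of_add_eq hftc'] at htot
  convert! htot using 1
  field_simp
  rw [I_sq]; ring_nf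

lemma sum_Ioc_floor_eq {F F1 : ℝ → ℂ} {α β : ℝ} (hα : 0 ≤ α) (hαβ : α ≤ β)
    (hF : ∀ x ∈ Set.Icc α β, HasDerivAt F (F1 x) x) (hc : ContinuousOn F1 (Set.Icc α β)) :
    ∑ n ∈ Finset.Ioc ⌊α⌋₊ ⌊β⌋₊, F n = (∫ t in α..β, F t)
      + (∫ t in α..β, F1 t * ((Int.fract t - 1 / 2 : ℝ) : ℂ))
      + (F β * ((1 / 2 - Int.fract β : ℝ) : ℂ) - F α * ((1 / 2 - Int.fract α : ℝ) : ℂ)) := by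
  have hu : Set.uIcc α β = Set.Icc α β := Set.uIcc_of_le hαβ
  have hFc : ContinuousOn F (Set.Icc α β) := fun x hx => (hF x hx).continuousAt.continuousWithinAt
  have hderiv : Set.EqOn (deriv F) F1 (Set.Icc α β) := fun x hx => (hF x hx).deriv
  have h := sum_mul_eq_sub_sub_integral_mul (fun _ => (1 : ℂ)) (f := F) hα hαβ
    (fun t ht => (hF t ht).differentiableAt)
    ((hc.integrableOn_Icc).congr_fun hderiv.symm measurableSet_Icc)
  simp only [mul_one, sum_const, Nat.card_Icc, nsmul_eq_mul, tsub_zero] at h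
  have hfl : ∀ t : ℝ, 0 ≤ t → (((⌊t⌋₊ + 1 : ℕ) : ℝ)) = t - Int.fract t + 1 := by
    intro t ht
    push_cast
    rw [natCast_floor_eq_intCast_floor ht, Int.self_sub_fract]
  have hflC : ∀ t : ℝ, 0 ≤ t → (((⌊t⌋₊ + 1 : ℕ) : ℂ)) = ((t - Int.fract t + 1 : ℝ) : ℂ) := by
    intro t ht; rw [← hfl t ht]; push_cast; rfl
  rw [h, ← intervalIntegral.integral_of_le hαβ, hflC β (hα.trans hαβ), hflC α hα]
  have e1 : ∫ t in α..β, deriv F t * ((⌊t⌋₊ + 1 : ℕ) : ℂ) =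
      ∫ t in α..β, (F1 t * ((t + 1 / 2 : ℝ) : ℂ) - F1 t * ((Int.fract t - 1 / 2 : ℝ) : ℂ)) := by
    refine intervalIntegral.integral_congr fun t ht => ?_
    rw [hu] at ht
    rw [hderiv ht, hflC t (hα.trans ht.1)]
    push_cast; ring
  have hi1 : IntervalIntegrable (fun t => F1 t * ((t + 1 / 2 : ℝ) : ℂ)) volume α β :=
    ContinuousOn.intervalIntegrable (by rw [hu]; exact hc.mul (by fun_prop))
  have hi2 : IntervalIntegrable (fun t => F1 t * ((Int.fract t - 1 / 2 : ℝ) : ℂ)) volume α β := by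
    refine IntervalIntegrable.continuousOn_mul ?_ (by rwa [hu])
    refine (intervalIntegrable_const (c := (1 : ℝ))).mono_fun ?_ ?_
    · exact (Complex.measurable_ofReal.comp (measurable_fract.sub_const _)).aestronglyMeasurable
    · refine Eventually.of_forall fun t => ?_
      simp only [Complex.norm_real, norm_one, Real.norm_eq_abs, abs_le]
      constructor <;> linarith [Int.fract_nonneg t, Int.fract_lt_one t]
  rw [e1, intervalIntegral.integral_sub hi1 hi2]
  have hp := intervalIntegral.integral_mul_deriv_eq_deriv_mul (a := α) (b := β)
    (u := fun t : ℝ => ((t + 1 / 2 : ℝ) : ℂ)) (u' := fun _ => 1) (v := F) (v' := F1)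
    (fun x _ => by
      simpa using ((hasDerivAt_id x).add_const (1 / 2 : ℝ)).ofReal_comp) (by rw [hu]; exact hF)
    intervalIntegrable_const (ContinuousOn.intervalIntegrable (by rwa [hu]))
  have e2 : ∫ t in α..β, F1 t * ((t + 1 / 2 : ℝ) : ℂ) = ∫ t in α..β, ((t + 1 / 2 : ℝ) : ℂ) * F1 t := by
    congr 1; funext t; ring
  rw [e2, hp]
  simp only [one_mul]
  push_cast
  ring

/-- First derivative test for an oscillatory integral with monotone phase derivative. -/
lemma norm_integral_mul_ee_le {h h1 h2 : ℝ → ℝ} {w w1 : ℝ → ℂ} {α β D K K1 : ℝ} (hαβ : α ≤ β)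
    (hh : ∀ x ∈ Set.Icc α β, HasDerivAt h (h1 x) x)
    (hh1 : ∀ x ∈ Set.Icc α β, HasDerivAt h1 (h2 x) x)
    (hw : ∀ x ∈ Set.Icc α β, HasDerivAt w (w1 x) x)
    (hc2 : ContinuousOn h2 (Set.Icc α β)) (hcw : ContinuousOn w1 (Set.Icc α β))
    (hs : (∀ x ∈ Set.Icc α β, 0 ≤ h2 x) ∨ (∀ x ∈ Set.Icc α β, h2 x ≤ 0))
    (hD : 0 < D) (hD1 : ∀ x ∈ Set.Icc α β, D ≤ |h1 x|)
    (hK : ∀ x ∈ Set.Icc α β, ‖w x‖ ≤ K) (hK1 : ∀ x ∈ Set.Icc α β, ‖w1 x‖ ≤ K1) :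
    ‖∫ t in α..β, w t * ee (h t)‖ ≤ (K + K1 * (β - α)) / D := by
  have hu : Set.uIcc α β = Set.Icc α β := Set.uIcc_of_le hαβ
  have hα : α ∈ Set.Icc α β := ⟨le_rfl, hαβ⟩
  have hβ : β ∈ Set.Icc α β := ⟨hαβ, le_rfl⟩
  have hK0 : 0 ≤ K := (norm_nonneg _).trans (hK α hα)
  have hK10 : 0 ≤ K1 := (norm_nonneg _).trans (hK1 α hα)
  have hne : ∀ x ∈ Set.Icc α β, h1 x ≠ 0 := fun x hx h0 => by
    have := hD1 x hx; rw [h0, abs_zero] at this; linarith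
  have hneC : ∀ x ∈ Set.Icc α β, (h1 x : ℂ) ≠ 0 := fun x hx => by exact_mod_cast hne x hx
  have hpiI : (2 * π * I : ℂ) ≠ 0 := Complex.two_pi_I_ne_zero
  have hcont : ∀ {f f' : ℝ → ℝ}, (∀ x ∈ Set.Icc α β, HasDerivAt f (f' x) x) →
      ContinuousOn f (Set.Icc α β) := fun hf x hx => (hf x hx).continuousAt.continuousWithinAt
  have hwc : ContinuousOn w (Set.Icc α β) := fun x hx => (hw x hx).continuousAt.continuousWithinAt
  have hc0 := hcont hh
  have hc1 := hcont hh1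
  have hc1C : ContinuousOn (fun x => (h1 x : ℂ)) (Set.Icc α β) :=
    Complex.continuous_ofReal.comp_continuousOn hc1
  have hc2C : ContinuousOn (fun x => (h2 x : ℂ)) (Set.Icc α β) :=
    Complex.continuous_ofReal.comp_continuousOn hc2
  have hce : ContinuousOn (fun x => ee (h x)) (Set.Icc α β) :=
    continuous_ee.comp_continuousOn hc0
  set v : ℝ → ℂ := fun x => 1 / (2 * π * I) * (w x / h1 x) with hv
  set v1 : ℝ → ℂ := fun x => 1 / (2 * π * I) * ((w1 x * h1 x - w x * h2 x) / (h1 x : ℂ) ^ 2) with hv1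
  have hvd : ∀ x ∈ Set.Icc α β, HasDerivAt v (v1 x) x := fun x hx =>
    ((hw x hx).div (hh1 x hx).ofReal_comp (hneC x hx)).const_mul _
  have hv1c : ContinuousOn v1 (Set.Icc α β) := by
    refine continuousOn_const.mul (ContinuousOn.div ?_ (hc1C.pow 2) fun x hx => pow_ne_zero 2 (hneC x hx))
    exact (hcw.mul hc1C).sub (hwc.mul hc2C)
  have hp := intervalIntegral.integral_mul_deriv_eq_deriv_mul (a := α) (b := β) (u := v) (u' := v1)
    (v := fun t => ee (h t)) (v' := fun t => 2 * π * I * h1 t * ee (h t))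
    (by rwa [hu]) (by rw [hu]; exact fun x hx => hasDerivAt_ee_comp (hh x hx))
    (ContinuousOn.intervalIntegrable (by rwa [hu]))
    (ContinuousOn.intervalIntegrable (by rw [hu]; exact (continuousOn_const.mul hc1C).mul hce))
  have e1 : ∫ t in α..β, w t * ee (h t) = ∫ t in α..β, v t * (2 * π * I * h1 t * ee (h t)) := by
    refine intervalIntegral.integral_congr fun t ht => ?_
    rw [hu] at ht
    have := hneC t ht
    simp only [hv]
    field_simp
  have hn1 : ‖(1 / (2 * π * I) : ℂ)‖ = 1 / (2 * π) := by
    simp [abs_of_pos Real.pi_pos]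
  have hpi : 1 / (2 * π) ≤ 1 / 6 := by
    apply one_div_le_one_div_of_le (by norm_num); linarith [Real.pi_gt_three]
  have hpi0 : 0 ≤ 1 / (2 * π) := by positivity
  have hvb : ∀ x ∈ Set.Icc α β, ‖v x * ee (h x)‖ ≤ 1 / 6 * (K / D) := by
    intro x hx
    rw [norm_mul, norm_ee, mul_one, hv, norm_mul, hn1, norm_div, Complex.norm_real, Real.norm_eq_abs]
    exact mul_le_mul hpi (div_le_div₀ hK0 (hK x hx) hD (hD1 x hx)) (by positivity) (by norm_num)
  obtain ⟨s, hs1, hs2⟩ : ∃ s : ℝ, |s| = 1 ∧ ∀ x ∈ Set.Icc α β, |h2 x| = s * h2 x := by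
    rcases hs with hs | hs
    · exact ⟨1, by simp, fun x hx => by rw [one_mul, abs_of_nonneg (hs x hx)]⟩
    · exact ⟨-1, by simp, fun x hx => by rw [neg_one_mul, abs_of_nonpos (hs x hx)]⟩
  have hcq : ContinuousOn (fun t => h2 t / h1 t ^ 2) (Set.Icc α β) :=
    hc2.div (hc1.pow 2) fun x hx => pow_ne_zero 2 (hne x hx)
  have hq : ∫ t in α..β, h2 t / h1 t ^ 2 = 1 / h1 α - 1 / h1 β := by
    rw [intervalIntegral.integral_eq_sub_of_hasDerivAt (f := fun t => -(h1 t)⁻¹)]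
    · ring
    · rw [hu]; intro x hx
      have h3 : HasDerivAt (fun t => -(h1 t)⁻¹) _ x := ((hh1 x hx).inv (hne x hx)).neg
      exact h3.congr_deriv (by ring)
    · exact ContinuousOn.intervalIntegrable (by rwa [hu])
  have hinv : ∀ x ∈ Set.Icc α β, |1 / h1 x| ≤ 1 / D := fun x hx => by
    rw [abs_div, abs_one]; exact one_div_le_one_div_of_le hD (hD1 x hx)
  have hqb : s * ∫ t in α..β, h2 t / h1 t ^ 2 ≤ 2 / D := by
    refine (le_abs_self _).trans ?_
    rw [abs_mul, hs1, one_mul, hq]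
    refine (abs_sub _ _).trans ?_
    have := hinv α hα; have := hinv β hβ
    have : 2 / D = 1 / D + 1 / D := by ring
    linarith
  have hintegral : ‖∫ t in α..β, v1 t * ee (h t)‖ ≤ 1 / 6 * (K1 / D * (β - α) + K * (2 / D)) := by
    have hb := intervalIntegral.norm_integral_le_of_norm_le (μ := volume) (a := α) (b := β)
      (f := fun t => v1 t * ee (h t))
      (g := fun t => 1 / 6 * (K1 / D + K * (s * (h2 t / h1 t ^ 2)))) hαβ
      (by
        refine Eventually.of_forall fun t ht => ?_
        have ht' : t ∈ Set.Icc α β := ⟨ht.1.le, ht.2⟩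
        have hpos : 0 < |h1 t| := abs_pos.2 (hne t ht')
        rw [norm_mul, norm_ee, mul_one, hv1, norm_mul, hn1]
        refine mul_le_mul hpi ?_ (norm_nonneg _) (by norm_num)
        have e : (w1 t * h1 t - w t * h2 t) / (h1 t : ℂ) ^ 2 =
            w1 t / h1 t - w t * (h2 t / (h1 t : ℂ) ^ 2) := by
          have := hneC t ht'
          field_simp
        rw [e]
        refine (norm_sub_le _ _).trans (add_le_add ?_ ?_)
        · rw [norm_div, Complex.norm_real, Real.norm_eq_abs]
          exact div_le_div₀ hK10 (hK1 t ht') hD (hD1 t ht')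
        · rw [norm_mul, norm_div, norm_pow, Complex.norm_real, Complex.norm_real, Real.norm_eq_abs,
            Real.norm_eq_abs, sq_abs, hs2 t ht', mul_div_assoc]
          refine mul_le_mul_of_nonneg_right (hK t ht') ?_
          rw [← mul_div_assoc, ← hs2 t ht']; positivity)
      (ContinuousOn.intervalIntegrable (by
        rw [hu]
        exact continuousOn_const.mul (continuousOn_const.add
          (continuousOn_const.mul (continuousOn_const.mul hcq)))))
    refine hb.trans ?_
    rw [intervalIntegral.integral_const_mul, intervalIntegral.integral_add
      intervalIntegrable_const (ContinuousOn.intervalIntegrable (by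
        rw [hu]; exact (continuousOn_const.mul (continuousOn_const.mul hcq)))),
      intervalIntegral.integral_const, intervalIntegral.integral_const_mul,
      intervalIntegral.integral_const_mul, smul_eq_mul]
    have := mul_le_mul_of_nonneg_left hqb hK0
    linarith
  rw [e1, hp]
  have hb1 := hvb α hα
  have hb2 := hvb β hβ
  have : ‖v β * ee (h β) - v α * ee (h α) - ∫ t in α..β, v1 t * ee (h t)‖ ≤
      1 / 6 * (K / D) + 1 / 6 * (K / D) + 1 / 6 * (K1 / D * (β - α) + K * (2 / D)) :=
    (norm_sub_le _ _).trans (add_le_add ((norm_sub_le _ _).trans (add_le_add hb2 hb1)) hintegral)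
  refine this.trans ?_
  have e2 : (K + K1 * (β - α)) / D = K / D + K1 / D * (β - α) := by ring
  have p1 : 0 ≤ K / D := by positivity
  have p2 : 0 ≤ K1 / D * (β - α) := mul_nonneg (by positivity) (by linarith)
  have e3 : K * (2 / D) = 2 * (K / D) := by ring
  rw [e2, e3]
  linarith

lemma sum_range_div_mul_add_le {R : ℝ} (hR : 0 < R) (X : ℕ) :
    ∑ n ∈ Finset.range X, (1 + R) / ((n : ℝ) * (n + R)) ≤ 1 + Real.log (2 + R) := by
  have key : ∀ k : ℕ, ∑ n ∈ Finset.range (k + 2), (1 + R) / ((n : ℝ) * (n + R)) ≤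
      1 + Real.log (2 + R) - Real.log (1 + (1 + R) / ((k : ℝ) + 1)) := by
    intro k
    induction k with
    | zero =>
      have : (2 + R) = 1 + (1 + R) := by ring
      have h1 : (1 + R) / (1 + R) = 1 := div_self (by positivity)
      simp [Finset.sum_range_succ, this, h1]
    | succ k ih =>
      rw [Finset.sum_range_succ]
      have hk : (0 : ℝ) ≤ k := Nat.cast_nonneg k
      set y : ℝ := (1 + (1 + R) / ((k : ℝ) + 1)) / (1 + (1 + R) / ((k : ℝ) + 1 + 1)) with hy
      have hy0 : 0 < y := by positivity
      have h1 := Real.one_sub_inv_le_log_of_pos hy0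
      have h2 : Real.log y = Real.log (1 + (1 + R) / ((k : ℝ) + 1)) -
          Real.log (1 + (1 + R) / ((k : ℝ) + 1 + 1)) :=
        Real.log_div (by positivity) (by positivity)
      have h3 : 1 - y⁻¹ = (1 + R) / (((k : ℝ) + 2) * (k + 2 + R)) := by
        rw [hy]
        have h4 : (k : ℝ) + 1 + 1 + (1 + R) ≠ 0 := by positivity
        have h5 : (k : ℝ) + 1 + (1 + R) ≠ 0 := by positivity
        have h6 : (k : ℝ) + 2 + R ≠ 0 := by positivity
        have h7 : (k : ℝ) + 1 + 1 ≠ 0 := by positivity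
        have h8 : (k : ℝ) + 2 ≠ 0 := by positivity
        field_simp
        ring
      push_cast
      rw [h3, h2] at h1
      linarith
  have hmono : ∑ n ∈ Finset.range X, (1 + R) / ((n : ℝ) * (n + R)) ≤
      ∑ n ∈ Finset.range (X + 2), (1 + R) / ((n : ℝ) * (n + R)) :=
    Finset.sum_le_sum_of_subset_of_nonneg (Finset.range_mono (by omega))
      fun i _ _ => by positivity
  have h0 : 0 ≤ Real.log (1 + (1 + R) / ((X : ℝ) + 1)) :=
    Real.log_nonneg (by have : 0 ≤ (1 + R) / ((X : ℝ) + 1) := by positivity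
                        linarith)
  linarith [key X]

/-- Truncated Poisson summation: van der Corput's process B before evaluation of the integrals. -/
lemma norm_sum_sub_sum_integral_le {f f1 f2 g g1 g2 : ℝ → ℝ} {α β R G : ℝ}
    (hα : 1 ≤ α) (hαβ : α ≤ β) (hβ4 : β ≤ 4 * α) (hR : 0 < R)
    (hf : ∀ x ∈ Set.Icc α β, HasDerivAt f (f1 x) x)
    (hf1 : ∀ x ∈ Set.Icc α β, HasDerivAt f1 (f2 x) x)
    (hg : ∀ x ∈ Set.Icc α β, HasDerivAt g (g1 x) x)
    (hg1 : ∀ x ∈ Set.Icc α β, HasDerivAt g1 (g2 x) x)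
    (hcf : ContinuousOn f2 (Set.Icc α β)) (hcg : ContinuousOn g2 (Set.Icc α β))
    (hs : (∀ x ∈ Set.Icc α β, 0 ≤ f2 x) ∨ (∀ x ∈ Set.Icc α β, f2 x ≤ 0))
    (hR1 : ∀ x ∈ Set.Icc α β, R ≤ f1 x) (hR2 : ∀ x ∈ Set.Icc α β, f1 x ≤ 2 * R)
    (hf2 : ∀ x ∈ Set.Icc α β, |f2 x| * x ≤ 2 * R)
    (hG : ∀ x ∈ Set.Icc α β, |g x| ≤ G) (hG1 : ∀ x ∈ Set.Icc α β, |g1 x| * x ≤ G)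
    (hG2 : ∀ x ∈ Set.Icc α β, |g2 x| * x ^ 2 ≤ G) :
    ‖∑ n ∈ Finset.Ioc ⌊α⌋₊ ⌊β⌋₊, (g n : ℂ) * ee (f n) -
      ∑ ν ∈ Finset.Icc ⌈R / 2⌉₊ ⌊4 * R⌋₊, ∫ t in α..β, (g t : ℂ) * ee (f t - ν * t)‖ ≤
      200 * G * (1 + 1 / R + Real.log (2 + R)) := by
  have hu : Set.uIcc α β = Set.Icc α β := Set.uIcc_of_le hαβ
  have hαm : α ∈ Set.Icc α β := ⟨le_rfl, hαβ⟩
  have hβm : β ∈ Set.Icc α β := ⟨hαβ, le_rfl⟩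
  have hG0 : 0 ≤ G := (abs_nonneg _).trans (hG α hαm)
  have hx1 : ∀ x ∈ Set.Icc α β, 1 ≤ x := fun x hx => hα.trans hx.1
  have hlen : ∀ x ∈ Set.Icc α β, β - α ≤ 3 * x := fun x hx => by linarith [hx.1]
  have hl0 : 0 ≤ β - α := by linarith
  have hcont : ∀ {f f' : ℝ → ℝ}, (∀ x ∈ Set.Icc α β, HasDerivAt f (f' x) x) →
      ContinuousOn f (Set.Icc α β) := fun hf x hx => (hf x hx).continuousAt.continuousWithinAt
  have hofR : ∀ {f : ℝ → ℝ}, ContinuousOn f (Set.Icc α β) →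
      ContinuousOn (fun x => (f x : ℂ)) (Set.Icc α β) :=
    fun hf => Complex.continuous_ofReal.comp_continuousOn hf
  have hG1' : ∀ x ∈ Set.Icc α β, |g1 x| ≤ G := fun x hx =>
    le_trans (le_mul_of_one_le_right (abs_nonneg _) (hx1 x hx)) (hG1 x hx)
  have hG1l : ∀ x ∈ Set.Icc α β, |g1 x| * (β - α) ≤ 3 * G := fun x hx => by
    have := mul_le_mul_of_nonneg_left (hlen x hx) (abs_nonneg (g1 x))
    linarith [hG1 x hx]
  have hG2l : ∀ x ∈ Set.Icc α β, |g2 x| * (β - α) ≤ 3 * G := fun x hx => by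
    have h1 := mul_le_mul_of_nonneg_left (hlen x hx) (abs_nonneg (g2 x))
    have h2 : |g2 x| * x ≤ |g2 x| * x ^ 2 :=
      mul_le_mul_of_nonneg_left (by nlinarith [hx1 x hx]) (abs_nonneg _)
    linarith [hG2 x hx]
  have hf2l : ∀ x ∈ Set.Icc α β, |f2 x| * (β - α) ≤ 6 * R := fun x hx => by
    have := mul_le_mul_of_nonneg_left (hlen x hx) (abs_nonneg (f2 x))
    linarith [hf2 x hx]
  set F : ℝ → ℂ := fun t => (g t : ℂ) * ee (f t) with hF
  set w : ℝ → ℂ := fun t => g1 t + 2 * π * I * (f1 t * g t) with hw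
  set w1 : ℝ → ℂ := fun t => g2 t + 2 * π * I * (f2 t * g t + f1 t * g1 t) with hw1
  have hwd : ∀ x ∈ Set.Icc α β, HasDerivAt w (w1 x) x := fun x hx =>
    (hg1 x hx).ofReal_comp.add
      (((hf1 x hx).ofReal_comp.mul (hg x hx).ofReal_comp).const_mul (2 * π * I : ℂ))
  have hw1c : ContinuousOn w1 (Set.Icc α β) :=
    (hofR hcg).add (continuousOn_const.mul (((hofR hcf).mul (hofR (hcont hg))).add
      ((hofR (hcont hf1)).mul (hofR (hcont hg1)))))
  have hwc : ContinuousOn w (Set.Icc α β) := fun x hx => (hwd x hx).continuousAt.continuousWithinAt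
  have hec : ContinuousOn (fun x => ee (f x)) (Set.Icc α β) :=
    continuous_ee.comp_continuousOn (hcont hf)
  have hFd : ∀ x ∈ Set.Icc α β, HasDerivAt F (w x * ee (f x)) x := fun x hx => by
    have := (hg x hx).ofReal_comp.mul (hasDerivAt_ee_comp (hf x hx))
    refine HasDerivAt.congr_deriv this ?_
    simp only [hw]; ring
  have hF1d : ∀ x ∈ Set.Icc α β, HasDerivAt (fun t => w t * ee (f t))
      (w1 x * ee (f x) + w x * (2 * π * I * f1 x * ee (f x))) x := fun x hx =>
    (hwd x hx).mul (hasDerivAt_ee_comp (hf x hx))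
  have hF2c : ContinuousOn (fun x => w1 x * ee (f x) + w x * (2 * π * I * f1 x * ee (f x)))
      (Set.Icc α β) :=
    (hw1c.mul hec).add (hwc.mul ((continuousOn_const.mul (hofR (hcont hf1))).mul hec))
  have hF1c : ContinuousOn (fun t => w t * ee (f t)) (Set.Icc α β) := hwc.mul hec
  have hnI : ‖(2 * π * I : ℂ)‖ = 2 * π := by simp [abs_of_pos Real.pi_pos]
  have hpi := Real.pi_lt_d2
  have hpi3 := Real.pi_gt_three
  have hf1abs : ∀ x ∈ Set.Icc α β, |f1 x| ≤ 2 * R := fun x hx => by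
    rw [abs_of_nonneg (hR.le.trans (hR1 x hx))]; exact hR2 x hx
  have hwb : ∀ x ∈ Set.Icc α β, ‖w x‖ ≤ G + 13 * (R * G) := fun x hx => by
    refine (norm_add_le _ _).trans ?_
    rw [norm_mul, hnI, norm_mul, Complex.norm_real, Complex.norm_real, Complex.norm_real,
      Real.norm_eq_abs, Real.norm_eq_abs, Real.norm_eq_abs]
    have h1 := mul_le_mul (hf1abs x hx) (hG x hx) (abs_nonneg _) (by positivity)
    have h2 : 2 * π * (|f1 x| * |g x|) ≤ 6.5 * (2 * R * G) :=
      mul_le_mul (by linarith) h1 (by positivity) (by norm_num)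
    linarith [hG1' x hx]
  have hfirst : ∀ (ν D : ℝ), 0 < D → (∀ x ∈ Set.Icc α β, D ≤ |f1 x - ν|) →
      ‖∫ t in α..β, w t * ee (f t - ν * t)‖ ≤ 100 * G * (1 + R) / D := by
    intro ν D hD hDx
    rcases eq_or_lt_of_le hαβ with heq | hlt
    · rw [heq, intervalIntegral.integral_same, norm_zero]; positivity
    have hl : 0 < β - α := by linarith
    have h := norm_integral_mul_ee_le (h := fun t => f t - ν * t) (h1 := fun t => f1 t - ν)
      (h2 := f2) (w := w) (w1 := w1) (D := D) (K := G + 13 * (R * G))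
      (K1 := (3 * G + 78 * (R * G)) / (β - α)) hαβ
      (fun x hx => ((hf x hx).fun_sub ((hasDerivAt_id x).const_mul ν)).congr_deriv (by ring))
      (fun x hx => (hf1 x hx).sub_const ν) hwd hcf hw1c hs hD hDx hwb
      (fun x hx => by
        rw [le_div_iff₀ hl]
        have h1 : ‖w1 x‖ ≤ |g2 x| + 2 * π * (|f2 x| * |g x| + |f1 x| * |g1 x|) := by
          refine (norm_add_le _ _).trans ?_
          rw [norm_mul, hnI, Complex.norm_real, Real.norm_eq_abs]
          gcongr
          refine (norm_add_le _ _).trans ?_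
          rw [norm_mul, norm_mul]
          simp only [Complex.norm_real, Real.norm_eq_abs]
          exact le_rfl
        have h2 : |f2 x| * (β - α) * |g x| ≤ 6 * R * G :=
          mul_le_mul (hf2l x hx) (hG x hx) (abs_nonneg _) (by positivity)
        have h3 : |f1 x| * (|g1 x| * (β - α)) ≤ 2 * R * (3 * G) :=
          mul_le_mul (hf1abs x hx) (hG1l x hx) (by positivity) (by positivity)
        have h4 : 2 * π * (|f2 x| * (β - α) * |g x| + |f1 x| * (|g1 x| * (β - α))) ≤
            6.5 * (6 * R * G + 2 * R * (3 * G)) :=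
          mul_le_mul (by linarith) (add_le_add h2 h3) (by positivity) (by norm_num)
        have h5 := mul_le_mul_of_nonneg_right h1 hl0
        have h6 := hG2l x hx
        nlinarith)
    refine h.trans ?_
    rw [div_mul_cancel₀ _ hl.ne']
    gcongr
    nlinarith [mul_nonneg hR.le hG0]
  set c : ℤ → ℂ := fun ν => -(1 / (2 * π * I)) *
    (1 / (ν : ℂ) * ∫ t in α..β, w t * ee (f t) * ee (ν * t)) with hc
  have hsum : HasSum c (∫ t in α..β, w t * ee (f t) * ((Int.fract t - 1 / 2 : ℝ) : ℂ)) := by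
    have h := (hasSum_integral_mul_sawtooth hαβ hF1d hF2c).mul_left (-(1 / (2 * π * I)) : ℂ)
    rwa [← mul_assoc (-(1 / (2 * π * I)) : ℂ) (-(2 * π * I)), neg_mul_neg,
      one_div_mul_cancel Complex.two_pi_I_ne_zero, one_mul] at h
  have hcc : ∀ ν : ℤ, ∫ t in α..β, w t * ee (f t) * ee (ν * t) =
      ∫ t in α..β, w t * ee (f t - (-ν : ℝ) * t) := fun ν => by
    congr 1; funext t
    rw [mul_assoc, ← ee_add]; congr 2; ring
  have hcb : ∀ (ν : ℤ) (n : ℕ), 0 < n → |(ν : ℝ)| = n →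
      (∀ x ∈ Set.Icc α β, (n + R) / 4 ≤ |f1 x - (-ν : ℝ)|) →
      ‖c ν‖ ≤ 80 * G * ((1 + R) / ((n : ℝ) * (n + R))) := by
    intro ν n hn hνn hD
    have hn' : (0 : ℝ) < n := by exact_mod_cast hn
    have h1 := hfirst (-ν) ((n + R) / 4) (by positivity) hD
    rw [hc]; simp only
    rw [norm_mul, norm_mul, norm_neg, norm_div, norm_div, hnI, norm_one, Complex.norm_intCast, hνn,
      hcc]
    have h2 : 1 / (2 * π) ≤ 1 / 6 := one_div_le_one_div_of_le (by norm_num) (by linarith)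
    calc 1 / (2 * π) * (1 / (n : ℝ) * ‖∫ t in α..β, w t * ee (f t - (-ν : ℝ) * t)‖)
        ≤ 1 / 6 * (1 / (n : ℝ) * (100 * G * (1 + R) / ((n + R) / 4))) := by gcongr
      _ = 400 / 6 * G * ((1 + R) / ((n : ℝ) * (n + R))) := by field_simp; ring
      _ ≤ _ := by
        have : 0 ≤ G * ((1 + R) / ((n : ℝ) * (n + R))) := by positivity
        nlinarith
  have hc0 : c 0 = 0 := by simp [hc]
  have hnat := hsum.nat_add_neg
  rw [hc0, add_zero] at hnat
  have hlog : 0 ≤ Real.log (2 + R) := Real.log_nonneg (by linarith)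
  -- truncation of the frequency sum
  have htrunc : ‖(∫ t in α..β, w t * ee (f t) * ((Int.fract t - 1 / 2 : ℝ) : ℂ)) -
      ∑ n ∈ Finset.Icc ⌈R / 2⌉₊ ⌊4 * R⌋₊, c (-(n : ℤ))‖ ≤
      160 * G * (1 + Real.log (2 + R)) := by
    have ht := (hnat.tendsto_sum_nat.sub_const
      (∑ n ∈ Finset.Icc ⌈R / 2⌉₊ ⌊4 * R⌋₊, c (-(n : ℤ)))).norm
    refine le_of_tendsto ht ?_
    filter_upwards [eventually_ge_atTop (⌊4 * R⌋₊ + 1)] with X hX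
    have hsub : Finset.Icc ⌈R / 2⌉₊ ⌊4 * R⌋₊ ⊆ Finset.range X := fun n hn => by
      rw [Finset.mem_Icc] at hn; rw [Finset.mem_range]; omega
    have e1 : ∑ n ∈ Finset.Icc ⌈R / 2⌉₊ ⌊4 * R⌋₊, c (-(n : ℤ)) =
        ∑ n ∈ Finset.range X, if n ∈ Finset.Icc ⌈R / 2⌉₊ ⌊4 * R⌋₊ then c (-(n : ℤ)) else 0 := by
      rw [Finset.sum_ite_mem, Finset.inter_eq_right.2 hsub]
    rw [e1, ← Finset.sum_sub_distrib]
    refine (norm_sum_le _ _).trans ?_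
    have h2 : ∀ n ∈ Finset.range X, ‖c n + c (-(n : ℤ)) -
        (if n ∈ Finset.Icc ⌈R / 2⌉₊ ⌊4 * R⌋₊ then c (-(n : ℤ)) else 0)‖ ≤
        160 * G * ((1 + R) / ((n : ℝ) * (n + R))) := by
      intro n _
      rcases Nat.eq_zero_or_pos n with h0 | hn
      · subst h0
        have : ⌈R / 2⌉₊ ≠ 0 := (Nat.ceil_pos.2 (by positivity)).ne'
        simp [hc0]
      have hn1 : (1 : ℝ) ≤ n := by exact_mod_cast hn
      have hpos : ‖c n‖ ≤ 80 * G * ((1 + R) / ((n : ℝ) * (n + R))) := by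
        refine hcb n n hn (by simp) fun x hx => ?_
        have := hR1 x hx
        refine le_trans ?_ (le_abs_self _)
        push_cast
        linarith
      have hB : 0 ≤ G * ((1 + R) / ((n : ℝ) * (n + R))) := by positivity
      split_ifs with hmem
      · rw [add_sub_cancel_right]; linarith
      · rw [sub_zero]
        refine (norm_add_le _ _).trans ?_
        have hneg : ‖c (-(n : ℤ))‖ ≤ 80 * G * ((1 + R) / ((n : ℝ) * (n + R))) := by
          refine hcb (-(n : ℤ)) n hn (by simp) fun x hx => ?_
          rw [Finset.mem_Icc, not_and_or, not_le, not_le, Nat.lt_ceil,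
            Nat.floor_lt (by positivity)] at hmem
          have h3 := hR1 x hx
          have h4 := hR2 x hx
          push_cast
          rw [neg_neg]
          rcases hmem with hm | hm
          · refine le_trans ?_ (le_abs_self _); linarith
          · refine le_trans ?_ (neg_le_abs _); linarith
        linarith
    refine (Finset.sum_le_sum h2).trans ?_
    rw [← Finset.mul_sum]
    exact mul_le_mul_of_nonneg_left (sum_range_div_mul_add_le hR X) (by positivity)
  -- the stationary range
  have hstat : ∀ n ∈ Finset.Icc ⌈R / 2⌉₊ ⌊4 * R⌋₊,
      ‖c (-(n : ℤ)) - ∫ t in α..β, (g t : ℂ) * ee (f t - n * t)‖ ≤ 2 * G / R := by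
    intro n hn
    rw [Finset.mem_Icc, Nat.ceil_le] at hn
    have hnR : R / 2 ≤ n := hn.1
    have hn0 : (0 : ℝ) < n := by linarith
    have hn0C : (n : ℂ) ≠ 0 := by exact_mod_cast hn0.ne'
    have hee : ∀ x, HasDerivAt (fun t => ee (-n * t)) (2 * π * I * ((-n : ℝ) : ℂ) * ee (-n * x)) x :=
      fun x => hasDerivAt_ee_comp (((hasDerivAt_id x).const_mul (-n : ℝ)).congr_deriv (mul_one _))
    have hnc : ContinuousOn (fun t : ℝ => ee (-n * t)) (Set.Icc α β) :=
      fun x _ => (hee x).continuousAt.continuousWithinAt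
    have hp := intervalIntegral.integral_mul_deriv_eq_deriv_mul (a := α) (b := β) (u := F)
      (u' := fun x => w x * ee (f x)) (v := fun t => ee (-n * t))
      (v' := fun x => 2 * π * I * ((-n : ℝ) : ℂ) * ee (-n * x))
      (by rwa [hu]) (fun x _ => hee x)
      (ContinuousOn.intervalIntegrable (by rwa [hu]))
      (ContinuousOn.intervalIntegrable (by rw [hu]; exact continuousOn_const.mul hnc))
    have e1 : ∫ t in α..β, F t * (2 * π * I * ((-n : ℝ) : ℂ) * ee (-n * t)) =
        -(2 * π * I * n) * ∫ t in α..β, (g t : ℂ) * ee (f t - n * t) := by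
      rw [← intervalIntegral.integral_const_mul]
      congr 1; funext t
      have : f t - n * t = f t + -n * t := by ring
      rw [this, ee_add, hF]; push_cast; ring
    have e2 : c (-(n : ℤ)) = 1 / (2 * π * I * n) * ∫ t in α..β, w t * ee (f t) * ee (-n * t) := by
      simp only [hc]
      push_cast
      have := Complex.two_pi_I_ne_zero
      field_simp
    have e3 : c (-(n : ℤ)) - ∫ t in α..β, (g t : ℂ) * ee (f t - n * t) =
        1 / (2 * π * I * n) * (F β * ee (-n * β) - F α * ee (-n * α)) := by
      rw [e1] at hp
      have h8 : ∫ t in α..β, w t * ee (f t) * ee (-n * t) =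
        F β * ee (-n * β) - F α * ee (-n * α) + 2 * π * I * n *
          ∫ t in α..β, (g t : ℂ) * ee (f t - n * t) := by linear_combination hp
      rw [e2, h8]
      have := Complex.two_pi_I_ne_zero
      field_simp
      ring
    have hFn : ∀ x ∈ Set.Icc α β, ∀ y, ‖F x * ee y‖ ≤ G := fun x hx y => by
      rw [norm_mul, norm_ee, mul_one, hF]; simp only
      rw [norm_mul, norm_ee, mul_one, Complex.norm_real]; exact hG x hx
    rw [e3, norm_mul, norm_div, norm_one, norm_mul, hnI, Complex.norm_natCast]
    have h9 : ‖F β * ee (-n * β) - F α * ee (-n * α)‖ ≤ 2 * G :=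
      (norm_sub_le _ _).trans (by linarith [hFn β hβm (-n * β), hFn α hαm (-n * α)])
    have h10 : 1 / (2 * π * n) ≤ 1 / R := one_div_le_one_div_of_le hR (by nlinarith)
    calc _ ≤ 1 / R * (2 * G) := mul_le_mul h10 h9 (norm_nonneg _) (by positivity)
      _ = _ := by ring
  have hstat' : ‖∑ n ∈ Finset.Icc ⌈R / 2⌉₊ ⌊4 * R⌋₊, c (-(n : ℤ)) -
      ∑ n ∈ Finset.Icc ⌈R / 2⌉₊ ⌊4 * R⌋₊, ∫ t in α..β, (g t : ℂ) * ee (f t - n * t)‖ ≤ 8 * G := by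
    rw [← Finset.sum_sub_distrib]
    refine (norm_sum_le _ _).trans ((Finset.sum_le_sum hstat).trans ?_)
    rw [Finset.sum_const, nsmul_eq_mul, Nat.card_Icc]
    have hc1 : 1 ≤ ⌈R / 2⌉₊ := Nat.ceil_pos.2 (by positivity)
    have h1 : ((⌊4 * R⌋₊ + 1 - ⌈R / 2⌉₊ : ℕ) : ℝ) ≤ 4 * R :=
      le_trans (by exact_mod_cast (by omega : ⌊4 * R⌋₊ + 1 - ⌈R / 2⌉₊ ≤ ⌊4 * R⌋₊))
        (Nat.floor_le (by positivity))
    calc _ ≤ 4 * R * (2 * G / R) := mul_le_mul_of_nonneg_right h1 (by positivity)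
      _ = 8 * G := by field_simp; ring
  have hzero : ‖∫ t in α..β, F t‖ ≤ 4 * G / R := by
    rcases eq_or_lt_of_le hαβ with heq | hlt
    · rw [heq, intervalIntegral.integral_same, norm_zero]; positivity
    have hl : 0 < β - α := by linarith
    have h := norm_integral_mul_ee_le (h := f) (h1 := f1)
      (h2 := f2) (w := fun t => (g t : ℂ)) (w1 := fun t => (g1 t : ℂ)) (D := R) (K := G)
      (K1 := 3 * G / (β - α)) hαβ hf hf1 (fun x hx => (hg x hx).ofReal_comp) hcf
      (hofR (hcont hg1)) hs hR (fun x hx => (hR1 x hx).trans (le_abs_self _))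
      (fun x hx => by rw [Complex.norm_real]; exact hG x hx)
      (fun x hx => by
        rw [le_div_iff₀ hl, Complex.norm_real]; exact hG1l x hx)
    refine h.trans ?_
    rw [div_mul_cancel₀ _ hl.ne']
    gcongr
    linarith
  have hend : ∀ x ∈ Set.Icc α β, ‖F x * ((1 / 2 - Int.fract x : ℝ) : ℂ)‖ ≤ G := fun x hx => by
    rw [norm_mul, hF]; simp only
    rw [norm_mul, norm_ee, mul_one, Complex.norm_real, Complex.norm_real, Real.norm_eq_abs,
      Real.norm_eq_abs]
    have h1 : |1 / 2 - Int.fract x| ≤ 1 := by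
      rw [abs_le]; constructor <;> linarith [Int.fract_nonneg x, (Int.fract_lt_one x).le]
    calc _ ≤ G * 1 := mul_le_mul (hG x hx) h1 (abs_nonneg _) hG0
      _ = G := mul_one G
  have hEM := sum_Ioc_floor_eq (by linarith) hαβ hFd hF1c
  set S := ∑ n ∈ Finset.Ioc ⌊α⌋₊ ⌊β⌋₊, F n with hS
  have hfin : ‖S - ∑ n ∈ Finset.Icc ⌈R / 2⌉₊ ⌊4 * R⌋₊,
      ∫ t in α..β, (g t : ℂ) * ee (f t - n * t)‖ ≤
      4 * G / R + 160 * G * (1 + Real.log (2 + R)) + 8 * G + (G + G) := by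
    rw [hEM]
    set J := ∑ n ∈ Finset.Icc ⌈R / 2⌉₊ ⌊4 * R⌋₊, ∫ t in α..β, (g t : ℂ) * ee (f t - n * t)
    set Q := ∑ n ∈ Finset.Icc ⌈R / 2⌉₊ ⌊4 * R⌋₊, c (-(n : ℤ))
    set U := ∫ t in α..β, w t * ee (f t) * ((Int.fract t - 1 / 2 : ℝ) : ℂ)
    have : ∀ a b e : ℂ, a + U + (b - e) - J = a + (U - Q) + (Q - J) + (b - e) := by
      intros; ring
    rw [this]
    refine (norm_add_le _ _).trans (add_le_add ((norm_add_le _ _).trans (add_le_add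
      ((norm_add_le _ _).trans (add_le_add hzero htrunc)) hstat')) ?_)
    exact (norm_sub_le _ _).trans (add_le_add (hend β hβm) (hend α hαm))
  refine hfin.trans ?_
  have h1 : 4 * G / R = 4 * (G * (1 / R)) := by ring
  have h2 : 0 ≤ G * (1 / R) := by positivity
  have h3 := mul_nonneg hG0 hlog
  nlinarith

lemma continuous_ee_sq : Continuous fun u : ℝ => ee (u ^ 2 / 2) := continuous_ee.comp (by fun_prop)

lemma intervalIntegrable_ee_sq (u v : ℝ) :
    IntervalIntegrable (fun u : ℝ => ee (u ^ 2 / 2)) volume u v :=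
  continuous_ee_sq.intervalIntegrable u v

lemma norm_integral_ee_sq_le {u v : ℝ} (hu : 0 < u) (huv : u ≤ v) :
    ‖∫ t in u..v, ee (t ^ 2 / 2)‖ ≤ 1 / u := by
  have h := norm_integral_mul_ee_le (h := fun t => t ^ 2 / 2) (h1 := fun t => t) (h2 := fun _ => 1)
    (w := fun _ => 1) (w1 := fun _ => 0) (D := u) (K := 1) (K1 := 0) huv
    (fun x _ => (((hasDerivAt_id x).pow 2).div_const 2).congr_deriv (by simp))
    (fun x _ => hasDerivAt_id x) (fun x _ => hasDerivAt_const x _) continuousOn_const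
    continuousOn_const (Or.inl fun _ _ => zero_le_one) hu
    (fun x hx => hx.1.trans (le_abs_self x)) (fun _ _ => by simp) (fun _ _ => by simp)
  simpa using h

lemma exists_tendsto_integral_ee_sq :
    ∃ κ : ℂ, ∀ v : ℝ, 0 ≤ v → ‖(∫ t in (0 : ℝ)..v, ee (t ^ 2 / 2)) - κ‖ ≤ 4 / (1 + v) := by
  set Φ : ℝ → ℂ := fun v => ∫ t in (0 : ℝ)..v, ee (t ^ 2 / 2) with hΦ
  have hsub : ∀ u v, Φ v - Φ u = ∫ t in u..v, ee (t ^ 2 / 2) := fun u v =>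
    intervalIntegral.integral_interval_sub_left (intervalIntegrable_ee_sq 0 v)
      (intervalIntegrable_ee_sq 0 u)
  have hΦb : ∀ u v : ℝ, 0 < u → u ≤ v → ‖Φ v - Φ u‖ ≤ 1 / u := fun u v h1 h2 => by
    rw [hsub]; exact norm_integral_ee_sq_le h1 h2
  have hcs : CauchySeq fun n : ℕ => Φ (n + 1) := by
    refine cauchySeq_of_le_tendsto_0 (fun n : ℕ => 2 / ((n : ℝ) + 1)) (fun n m k hn hm => ?_) ?_
    · have hk : (0 : ℝ) < (k : ℝ) + 1 := by positivity
      have hn' : (k : ℝ) + 1 ≤ n + 1 := by gcongr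
      have hm' : (k : ℝ) + 1 ≤ m + 1 := by gcongr
      have e : Φ (n + 1) - Φ (m + 1) = (Φ (n + 1) - Φ (k + 1)) - (Φ (m + 1) - Φ (k + 1)) := by ring
      rw [dist_eq_norm, e]
      refine (norm_sub_le _ _).trans ?_
      have : 2 / ((k : ℝ) + 1) = 1 / (k + 1) + 1 / (k + 1) := by ring
      rw [this]
      exact add_le_add (hΦb _ _ hk hn') (hΦb _ _ hk hm')
    · have := (tendsto_one_div_add_atTop_nhds_zero_nat (𝕜 := ℝ)).const_mul 2
      simpa [div_eq_mul_inv] using this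
  obtain ⟨κ, hκ⟩ := cauchySeq_tendsto_of_complete hcs
  have hpos : ∀ v : ℝ, 0 < v → ‖Φ v - κ‖ ≤ 1 / v := by
    intro v hv
    refine le_of_tendsto (tendsto_const_nhds.sub hκ).norm ?_
    obtain ⟨n0, hn0⟩ := exists_nat_ge v
    filter_upwards [eventually_ge_atTop n0] with n hn
    have : (n0 : ℝ) ≤ n := by exact_mod_cast hn
    rw [norm_sub_rev]
    exact hΦb v _ hv (by linarith)
  refine ⟨κ, fun v hv => ?_⟩
  change ‖Φ v - κ‖ ≤ _
  rcases le_total 1 v with h | h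
  · refine (hpos v (by linarith)).trans ?_
    rw [div_le_div_iff₀ (by linarith) (by linarith)]; linarith
  · have h1 : ‖Φ v - Φ 1‖ ≤ 1 := by
      rw [hsub]
      refine (intervalIntegral.norm_integral_le_of_norm_le_const (C := 1) fun x _ => ?_).trans ?_
      · rw [norm_ee]
      · rw [abs_of_nonpos (by linarith)]; linarith
    have h2 := hpos 1 one_pos
    have e : Φ v - κ = (Φ v - Φ 1) + (Φ 1 - κ) := by ring
    rw [e]
    refine (norm_add_le _ _).trans ?_
    have : 2 ≤ 4 / (1 + v) := by rw [le_div_iff₀ (by linarith)]; linarith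
    linarith

/-- The value of the improper integral of `exp (π i t²)` over the line. -/
noncomputable def fresnel : ℂ := 2 * exists_tendsto_integral_ee_sq.choose

lemma norm_integral_ee_sq_sub_le {u v : ℝ} (huv : u ≤ v) :
    ‖(∫ t in u..v, ee (t ^ 2 / 2)) - if u ≤ 0 ∧ 0 ≤ v then fresnel else 0‖ ≤
      4 / (1 + |u|) + 4 / (1 + |v|) := by
  have hκ := exists_tendsto_integral_ee_sq.choose_spec
  set κ := exists_tendsto_integral_ee_sq.choose with hκd
  have hf : fresnel = κ + κ := by rw [fresnel, two_mul]
  set Φ : ℝ → ℂ := fun v => ∫ t in (0 : ℝ)..v, ee (t ^ 2 / 2) with hΦ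
  have hodd : ∀ v, Φ (-v) = -Φ v := fun v => by
    have := intervalIntegral.integral_comp_neg (a := 0) (b := v) (fun t : ℝ => ee (t ^ 2 / 2))
    simp only [neg_sq, neg_zero] at this
    simp only [hΦ]
    rw [this, intervalIntegral.integral_symm (-v) 0]
  have hsub : (∫ t in u..v, ee (t ^ 2 / 2)) = Φ v - Φ u :=
    (intervalIntegral.integral_interval_sub_left (intervalIntegrable_ee_sq 0 v)
      (intervalIntegrable_ee_sq 0 u)).symm
  have hp : ∀ x, 0 ≤ x → ‖Φ x - κ‖ ≤ 4 / (1 + |x|) := fun x hx => by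
    rw [abs_of_nonneg hx]; exact hκ x hx
  have hn : ∀ x, x ≤ 0 → ‖Φ x + κ‖ ≤ 4 / (1 + |x|) := fun x hx => by
    have := hp (-x) (by linarith)
    rwa [hodd, abs_neg, ← neg_add', norm_neg] at this
  rw [hsub]
  split_ifs with h
  · rw [hf, show Φ v - Φ u - (κ + κ) = -(Φ u + κ) + (Φ v - κ) by ring]
    exact (norm_add_le _ _).trans (add_le_add (by rw [norm_neg]; exact hn u h.1) (hp v h.2))
  · rw [not_and_or, not_le, not_le] at h
    rcases h with h | h
    · rw [show Φ v - Φ u - 0 = -(Φ u - κ) + (Φ v - κ) by ring]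
      exact (norm_add_le _ _).trans
        (add_le_add (by rw [norm_neg]; exact hp u h.le) (hp v (by linarith)))
    · rw [show Φ v - Φ u - 0 = -(Φ u + κ) + (Φ v + κ) by ring]
      exact (norm_add_le _ _).trans
        (add_le_add (by rw [norm_neg]; exact hn u (by linarith)) (hn v h.le))

/-- Stationary phase for a phase that is a square up to a constant. -/
lemma norm_integral_sub_fresnel_le {y y1 g ψ ψ1 : ℝ → ℝ} {α β h0 G0 K : ℝ} (hαβ : α ≤ β)
    (hy : ∀ x ∈ Set.Icc α β, HasDerivAt y (y1 x) x) (hy1 : ContinuousOn y1 (Set.Icc α β))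
    (hyp : ∀ x ∈ Set.Icc α β, 0 ≤ y1 x)
    (hψ : ∀ x ∈ Set.Icc α β, HasDerivAt ψ (ψ1 x) x) (hψ1 : ContinuousOn ψ1 (Set.Icc α β))
    (hg : ∀ x ∈ Set.Icc α β, g x = G0 * y1 x + ψ x * (y x * y1 x))
    (hK : ∀ x ∈ Set.Icc α β, |ψ x| ≤ K) (hK1 : ∀ x ∈ Set.Icc α β, |ψ1 x| * (β - α) ≤ K) :
    ‖(∫ t in α..β, (g t : ℂ) * ee (h0 + y t ^ 2 / 2)) -
      if y α ≤ 0 ∧ 0 ≤ y β then fresnel * (G0 * ee h0) else 0‖ ≤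
      |G0| * (4 / (1 + |y α|) + 4 / (1 + |y β|)) + K := by
  have hu : Set.uIcc α β = Set.Icc α β := Set.uIcc_of_le hαβ
  have hαm : α ∈ Set.Icc α β := ⟨le_rfl, hαβ⟩
  have hβm : β ∈ Set.Icc α β := ⟨hαβ, le_rfl⟩
  have hyc : ContinuousOn y (Set.Icc α β) := fun x hx => (hy x hx).continuousAt.continuousWithinAt
  have hψc : ContinuousOn ψ (Set.Icc α β) := fun x hx => (hψ x hx).continuousAt.continuousWithinAt
  have hofR : ∀ {f : ℝ → ℝ}, ContinuousOn f (Set.Icc α β) →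
      ContinuousOn (fun x => (f x : ℂ)) (Set.Icc α β) :=
    fun hf => Complex.continuous_ofReal.comp_continuousOn hf
  have hec : ContinuousOn (fun x => ee (y x ^ 2 / 2)) (Set.Icc α β) :=
    continuous_ee_sq.comp_continuousOn hyc
  have hmono : y α ≤ y β := by
    refine monotoneOn_of_deriv_nonneg (convex_Icc α β) hyc (fun x hx => ?_) (fun x hx => ?_)
      hαm hβm hαβ
    · rw [interior_Icc] at hx
      exact (hy x ⟨hx.1.le, hx.2.le⟩).differentiableAt.differentiableWithinAt
    · rw [interior_Icc] at hx
      rw [(hy x ⟨hx.1.le, hx.2.le⟩).deriv]; exact hyp x ⟨hx.1.le, hx.2.le⟩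
  have hsub : ∫ t in α..β, (y1 t : ℂ) * ee (y t ^ 2 / 2) = ∫ t in (y α)..(y β), ee (t ^ 2 / 2) := by
    have := intervalIntegral.integral_deriv_smul_comp (a := α) (b := β) (f := y) (f' := y1)
      (g := fun t => ee (t ^ 2 / 2)) (by rwa [hu]) (by rwa [hu]) continuous_ee_sq
    rw [← this]
    refine intervalIntegral.integral_congr fun t _ => ?_
    simp
  have hparts : ‖∫ t in α..β, (ψ t : ℂ) * (2 * π * I * ((y t * y1 t : ℝ) : ℂ) * ee (y t ^ 2 / 2))‖ ≤
      3 * K := by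
    have hd : ∀ x ∈ Set.Icc α β, HasDerivAt (fun t => y t ^ 2 / 2) (y x * y1 x) x := fun x hx =>
      (((hy x hx).pow 2).div_const 2).congr_deriv (by simp; ring)
    have hp := intervalIntegral.integral_mul_deriv_eq_deriv_mul (a := α) (b := β)
      (u := fun t => (ψ t : ℂ)) (u' := fun t => (ψ1 t : ℂ)) (v := fun t => ee (y t ^ 2 / 2))
      (v' := fun t => 2 * π * I * ((y t * y1 t : ℝ) : ℂ) * ee (y t ^ 2 / 2))
      (by rw [hu]; exact fun x hx => (hψ x hx).ofReal_comp)
      (by rw [hu]; exact fun x hx => hasDerivAt_ee_comp (hd x hx))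
      (ContinuousOn.intervalIntegrable (by rw [hu]; exact hofR hψ1))
      (ContinuousOn.intervalIntegrable (by
        rw [hu]; exact (continuousOn_const.mul (hofR (hyc.mul hy1))).mul hec))
    rw [hp]
    have hb : ∀ x ∈ Set.Icc α β, ‖(ψ x : ℂ) * ee (y x ^ 2 / 2)‖ ≤ K := fun x hx => by
      rw [norm_mul, norm_ee, mul_one, Complex.norm_real]; exact hK x hx
    have hi : ‖∫ t in α..β, (ψ1 t : ℂ) * ee (y t ^ 2 / 2)‖ ≤ K := by
      rcases eq_or_lt_of_le hαβ with heq | hlt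
      · rw [heq, intervalIntegral.integral_same, norm_zero]
        exact (abs_nonneg _).trans (hK α hαm)
      have hl : 0 < β - α := by linarith
      have := intervalIntegral.norm_integral_le_of_norm_le_const (a := α) (b := β)
        (C := K / (β - α)) (f := fun t => (ψ1 t : ℂ) * ee (y t ^ 2 / 2)) fun x hx => by
          rw [Set.uIoc_of_le hαβ] at hx
          rw [norm_mul, norm_ee, mul_one, Complex.norm_real, le_div_iff₀ hl]
          exact hK1 x ⟨hx.1.le, hx.2⟩
      rwa [abs_of_pos hl, div_mul_cancel₀ _ hl.ne'] at this
    calc _ ≤ (K + K) + K := (norm_sub_le _ _).trans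
          (add_le_add ((norm_sub_le _ _).trans (add_le_add (hb β hβm) (hb α hαm))) hi)
      _ = 3 * K := by ring
  have hsplit : ∫ t in α..β, (g t : ℂ) * ee (h0 + y t ^ 2 / 2) =
      G0 * ee h0 * (∫ t in (y α)..(y β), ee (t ^ 2 / 2)) + ee h0 / (2 * π * I) *
        ∫ t in α..β, (ψ t : ℂ) * (2 * π * I * ((y t * y1 t : ℝ) : ℂ) * ee (y t ^ 2 / 2)) := by
    rw [← hsub, ← intervalIntegral.integral_const_mul, ← intervalIntegral.integral_const_mul,
      ← intervalIntegral.integral_add]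
    · refine intervalIntegral.integral_congr fun t ht => ?_
      rw [hu] at ht
      have := Complex.two_pi_I_ne_zero
      rw [hg t ht, ee_add]
      push_cast
      field_simp
    · refine ContinuousOn.intervalIntegrable ?_
      rw [hu]; exact continuousOn_const.mul ((hofR hy1).mul hec)
    · refine ContinuousOn.intervalIntegrable ?_
      rw [hu]
      exact continuousOn_const.mul
        ((hofR hψc).mul ((continuousOn_const.mul (hofR (hyc.mul hy1))).mul hec))
  have hmain := norm_integral_ee_sq_sub_le hmono
  rw [hsplit]
  set J := ∫ t in (y α)..(y β), ee (t ^ 2 / 2)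
  set J' := ∫ t in α..β, (ψ t : ℂ) * (2 * π * I * ((y t * y1 t : ℝ) : ℂ) * ee (y t ^ 2 / 2))
  have e : G0 * ee h0 * J + ee h0 / (2 * π * I) * J' -
      (if y α ≤ 0 ∧ 0 ≤ y β then fresnel * (G0 * ee h0) else 0) =
      G0 * ee h0 * (J - if y α ≤ 0 ∧ 0 ≤ y β then fresnel else 0) +
        ee h0 / (2 * π * I) * J' := by
    split_ifs <;> ring
  rw [e]
  refine (norm_add_le _ _).trans (add_le_add ?_ ?_)
  · rw [norm_mul, norm_mul, norm_ee, mul_one, Complex.norm_real, Real.norm_eq_abs]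
    exact mul_le_mul_of_nonneg_left hmain (abs_nonneg _)
  · have hnI : ‖(2 * π * I : ℂ)‖ = 2 * π := by simp [abs_of_pos Real.pi_pos]
    have hK0 : 0 ≤ K := (abs_nonneg _).trans (hK α hαm)
    rw [norm_mul, norm_div, norm_ee, hnI]
    have h2 : 1 / (2 * π) ≤ 1 / 6 :=
      one_div_le_one_div_of_le (by norm_num) (by linarith [Real.pi_gt_three])
    calc _ ≤ 1 / 6 * (3 * K) := mul_le_mul h2 hparts (norm_nonneg _) (by norm_num)
      _ ≤ K := by linarith

/-- Stationary phase on `[1/4, 4]` with stationary point `1` and a large parameter `P`. -/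
lemma exists_norm_integral_sub_fresnel_le {η η1 g q : ℝ → ℝ} {G0 : ℝ}
    (hη : ∀ x ∈ Set.Icc (1 / 4 : ℝ) 4, HasDerivAt η (η1 x) x)
    (hη1 : ContinuousOn η1 (Set.Icc (1 / 4 : ℝ) 4))
    (hηp : ∀ x ∈ Set.Icc (1 / 4 : ℝ) 4, 0 ≤ η1 x)
    (hq : ContDiffOn ℝ 1 q (Set.Ioi 0))
    (hs1 : ∀ x ∈ Set.Icc (1 / 4 : ℝ) 4, η x ≤ 0 ↔ x ≤ 1)
    (hs2 : ∀ x ∈ Set.Icc (1 / 4 : ℝ) 4, 0 ≤ η x ↔ 1 ≤ x)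
    (habs : ∀ x ∈ Set.Icc (1 / 4 : ℝ) 4, |x - 1| ≤ |η x|)
    (hg : ∀ x ∈ Set.Icc (1 / 4 : ℝ) 4, g x = G0 * η1 x + q x * (η x * η1 x)) :
    ∃ C : ℝ, 0 < C ∧ ∀ P u v : ℝ, 1 / 64 ≤ P → 1 / 4 ≤ u → u ≤ v → v ≤ 4 →
      ‖(∫ t in u..v, (g t : ℂ) * ee (P * (η t ^ 2 / 2 - 1 / 2))) -
        if u ≤ 1 ∧ 1 ≤ v then fresnel * ((G0 / √P : ℝ) * ee (-(P / 2))) else 0‖ ≤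
      C * (1 / (√P + P * |u - 1|) + 1 / (√P + P * |v - 1|)) := by
  have hsubset : Set.Icc (1 / 4 : ℝ) 4 ⊆ Set.Ioi 0 := fun x hx =>
    lt_of_lt_of_le (by norm_num) hx.1
  have hqc : ContinuousOn q (Set.Icc (1 / 4 : ℝ) 4) := hq.continuousOn.mono hsubset
  have hq1c : ContinuousOn (deriv q) (Set.Icc (1 / 4 : ℝ) 4) :=
    (hq.continuousOn_deriv_of_isOpen isOpen_Ioi le_rfl).mono hsubset
  have hqd : ∀ x ∈ Set.Icc (1 / 4 : ℝ) 4, HasDerivAt q (deriv q x) x := fun x hx =>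
    ((hq.differentiableOn one_ne_zero).differentiableAt (Ioi_mem_nhds (hsubset hx))).hasDerivAt
  obtain ⟨C1, hC1⟩ := isCompact_Icc.exists_bound_of_continuousOn hqc
  obtain ⟨C2, hC2⟩ := isCompact_Icc.exists_bound_of_continuousOn hq1c
  set C3 : ℝ := |C1| + 4 * |C2| with hC3
  refine ⟨4 * |G0| + 11 * C3 + 1, by positivity, fun P u v hP hu huv hv => ?_⟩
  have hP0 : 0 < P := by linarith
  have hsub : Set.Icc u v ⊆ Set.Icc (1 / 4 : ℝ) 4 := Set.Icc_subset_Icc hu hv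
  have hum : u ∈ Set.Icc (1 / 4 : ℝ) 4 := hsub ⟨le_rfl, huv⟩
  have hvm : v ∈ Set.Icc (1 / 4 : ℝ) 4 := hsub ⟨huv, le_rfl⟩
  have hsq : √P * √P = P := Real.mul_self_sqrt hP0.le
  have hsP : 0 < √P := Real.sqrt_pos.2 hP0
  have h := norm_integral_sub_fresnel_le (y := fun x => √P * η x) (y1 := fun x => √P * η1 x)
    (g := g) (ψ := fun x => q x / P) (ψ1 := fun x => deriv q x / P) (α := u) (β := v)
    (h0 := -(P / 2)) (G0 := G0 / √P) (K := C3 / P) huv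
    (fun x hx => (hη x (hsub hx)).const_mul _) (continuousOn_const.mul (hη1.mono hsub))
    (fun x hx => mul_nonneg hsP.le (hηp x (hsub hx)))
    (fun x hx => (hqd x (hsub hx)).div_const _) ((hq1c.mono hsub).div_const _)
    (fun x hx => by
      rw [hg x (hsub hx)]
      have e : q x / P * (√P * η x * (√P * η1 x)) = q x * (η x * η1 x) * (√P * √P / P) := by ring
      rw [e, hsq, div_self hP0.ne']
      field_simp)
    (fun x hx => by
      rw [abs_div, abs_of_pos hP0]
      have h1 := hC1 x (hsub hx)
      rw [Real.norm_eq_abs] at h1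
      gcongr
      linarith [le_abs_self C1, abs_nonneg C2])
    (fun x hx => by
      have h1 := hC2 x (hsub hx)
      rw [Real.norm_eq_abs] at h1
      rw [abs_div, abs_of_pos hP0, div_mul_eq_mul_div]
      gcongr
      calc |deriv q x| * (v - u) ≤ |C2| * 4 :=
            mul_le_mul (h1.trans (le_abs_self _)) (by linarith) (by linarith) (abs_nonneg _)
        _ ≤ C3 := by linarith [abs_nonneg C1])
  have e1 : ∀ t, -(P / 2) + (√P * η t) ^ 2 / 2 = P * (η t ^ 2 / 2 - 1 / 2) := fun t => by
    rw [mul_pow, Real.sq_sqrt hP0.le]; ring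
  have e2 : (√P * η u ≤ 0 ∧ 0 ≤ √P * η v) = (u ≤ 1 ∧ 1 ≤ v) := by
    rw [← hs1 u hum, ← hs2 v hvm, mul_nonneg_iff_of_pos_left hsP, mul_nonpos_iff_pos_imp_nonpos]
    simp [hsP, hsP.le]
  simp only [e1, e2] at h
  refine h.trans ?_
  have hend : ∀ x ∈ Set.Icc (1 / 4 : ℝ) 4, |G0 / √P| * (4 / (1 + |√P * η x|)) ≤
      4 * |G0| * (1 / (√P + P * |x - 1|)) := fun x hx => by
    have h1 : √P * |x - 1| ≤ |√P * η x| := by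
      rw [abs_mul, abs_of_pos hsP]; exact mul_le_mul_of_nonneg_left (habs x hx) hsP.le
    rw [abs_div, abs_of_pos hsP]
    calc |G0| / √P * (4 / (1 + |√P * η x|)) ≤ |G0| / √P * (4 / (1 + √P * |x - 1|)) := by gcongr
      _ = 4 * |G0| * (1 / (√P * (1 + √P * |x - 1|))) := by
        have : (1 + √P * |x - 1|) ≠ 0 := by positivity
        field_simp
      _ = _ := by rw [mul_add, ← mul_assoc, hsq, mul_one]
  have hK : C3 / P ≤ 11 * C3 * (1 / (√P + P * |u - 1|)) := by
    have h1 : √P ≤ 8 * P := by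
      have : 1 / 8 ≤ √P := Real.le_sqrt_of_sq_le (by linarith)
      nlinarith
    have h2 : |u - 1| ≤ 3 := by rw [abs_le]; constructor <;> linarith [hum.1, hum.2]
    have h3 : √P + P * |u - 1| ≤ 11 * P := by nlinarith
    have h4 : 1 / (11 * P) ≤ 1 / (√P + P * |u - 1|) :=
      one_div_le_one_div_of_le (by positivity) h3
    calc C3 / P = 11 * C3 * (1 / (11 * P)) := by field_simp
      _ ≤ _ := mul_le_mul_of_nonneg_left h4 (by positivity)
  have p1 : 0 ≤ 1 / (√P + P * |u - 1|) := by positivity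
  have p2 : 0 ≤ 1 / (√P + P * |v - 1|) := by positivity
  have hu' := hend u hum
  have hv' := hend v hvm
  have hC30 : 0 ≤ C3 := by positivity
  nlinarith [mul_nonneg hC30 p2]

lemma exists_integral_quadratic_phase_le :
    ∃ C : ℝ, 0 < C ∧ ∀ P u v : ℝ, 1 / 64 ≤ P → 1 / 4 ≤ u → u ≤ v → v ≤ 4 →
      ‖(∫ t in u..v, (√t : ℂ) * ee (P * (t ^ 2 / 2 - t))) -
        if u ≤ 1 ∧ 1 ≤ v then fresnel * ((1 / √P : ℝ) * ee (-(P / 2))) else 0‖ ≤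
      C * (1 / (√P + P * |u - 1|) + 1 / (√P + P * |v - 1|)) := by
  have h := exists_norm_integral_sub_fresnel_le (η := fun x => x - 1) (η1 := fun _ => 1)
    (g := fun x => √x) (q := fun x => 1 / (√x + 1)) (G0 := 1)
    (fun x _ => (hasDerivAt_id x).sub_const 1) continuousOn_const (fun _ _ => zero_le_one)
    (fun x hx => by
      refine ContDiffAt.contDiffWithinAt ?_
      have : √x + 1 ≠ 0 := by positivity
      exact contDiffAt_const.div ((contDiffAt_id.sqrt (ne_of_gt hx)).add contDiffAt_const) this)
    (fun x _ => sub_nonpos) (fun x _ => sub_nonneg) (fun _ _ => le_rfl)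
    (fun x hx => by
      have hx0 : 0 ≤ x := le_trans (by norm_num) hx.1
      have h1 : √x + 1 ≠ 0 := by positivity
      have h2 : √x * √x = x := Real.mul_self_sqrt hx0
      field_simp
      nlinarith)
  obtain ⟨C, hC, h⟩ := h
  refine ⟨C, hC, fun P u v hP hu huv hv => ?_⟩
  convert h P u v hP hu huv hv using 8
  ring

lemma exists_integral_cubic_phase_le :
    ∃ C : ℝ, 0 < C ∧ ∀ P u v : ℝ, 1 / 64 ≤ P → 1 / 4 ≤ u → u ≤ v → v ≤ 4 →
      ‖(∫ t in u..v, ((t * √t : ℝ) : ℂ) * ee (P * (t ^ 3 - 3 / 2 * t ^ 2))) -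
        if u ≤ 1 ∧ 1 ≤ v then fresnel * ((1 / √3 / √P : ℝ) * ee (-(P / 2))) else 0‖ ≤
      C * (1 / (√P + P * |u - 1|) + 1 / (√P + P * |v - 1|)) := by
  have hpos : ∀ x ∈ Set.Icc (1 / 4 : ℝ) 4, 0 < x := fun x hx => lt_of_lt_of_le (by norm_num) hx.1
  have hd : ∀ x ∈ Set.Icc (1 / 4 : ℝ) 4, HasDerivAt (fun x => (x - 1) * √(2 * x + 1))
      (3 * x / √(2 * x + 1)) x := fun x hx => by
    have hx0 := hpos x hx
    have h1 : (2 * x + 1) ≠ 0 := by positivity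
    have h2 : HasDerivAt (fun x : ℝ => 2 * x + 1) 2 x := by
      simpa using ((hasDerivAt_id x).const_mul 2).add_const 1
    have h3 := ((hasDerivAt_id x).sub_const 1).mul (h2.sqrt h1)
    refine h3.congr_deriv ?_
    have h4 : √(2 * x + 1) ≠ 0 := by positivity
    have h5 : √(2 * x + 1) ^ 2 = 2 * x + 1 := Real.sq_sqrt (by positivity)
    simp only [id]
    field_simp
    rw [h5]; ring
  have hcs : ContinuousOn (fun x : ℝ => 3 * x / √(2 * x + 1)) (Set.Icc (1 / 4 : ℝ) 4) :=
    ContinuousOn.div (by fun_prop) (by fun_prop) fun x hx => by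
      have := hpos x hx; positivity
  have hsqrt1 : ∀ x ∈ Set.Icc (1 / 4 : ℝ) 4, 1 ≤ √(2 * x + 1) := fun x hx =>
    Real.one_le_sqrt.2 (by linarith [hpos x hx])
  have h := exists_norm_integral_sub_fresnel_le (η := fun x => (x - 1) * √(2 * x + 1))
    (η1 := fun x => 3 * x / √(2 * x + 1)) (g := fun x => x * √x)
    (q := fun x => (2 * x + 3) / (3 * (√(2 * x + 1) * (√x * √(2 * x + 1) + √3))))
    (G0 := 1 / √3) hd hcs
    (fun x hx => by have := hpos x hx; positivity)
    (fun x hx => by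
      have hx0 : 0 < x := hx
      refine ContDiffAt.contDiffWithinAt ?_
      have h1 : 3 * (√(2 * x + 1) * (√x * √(2 * x + 1) + √3)) ≠ 0 := by positivity
      have h2 : ContDiffAt ℝ 1 (fun x : ℝ => √(2 * x + 1)) x :=
        ContDiffAt.sqrt (by fun_prop) (by positivity)
      have h3 : ContDiffAt ℝ 1 (fun x : ℝ => √x) x := contDiffAt_id.sqrt hx0.ne'
      exact ContDiffAt.div (by fun_prop)
        (contDiffAt_const.mul (h2.mul ((h3.mul h2).add contDiffAt_const))) h1)
    (fun x hx => by
      rw [← sub_nonpos (a := x)]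
      have := hsqrt1 x hx
      constructor <;> intro h <;> nlinarith)
    (fun x hx => by
      rw [← sub_nonneg (b := (1 : ℝ))]
      have := hsqrt1 x hx
      constructor <;> intro h <;> nlinarith)
    (fun x hx => by
      rw [abs_mul, abs_of_nonneg (Real.sqrt_nonneg (2 * x + 1))]
      exact le_mul_of_one_le_right (abs_nonneg _) (hsqrt1 x hx))
    (fun x hx => by
      have hx0 := hpos x hx
      set s := √(2 * x + 1) with hs
      have hs0 : 0 < s := by positivity
      have hs2 : s * s = 2 * x + 1 := Real.mul_self_sqrt (by positivity)
      set r := √x with hr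
      have hr0 : 0 < r := by positivity
      have hr2 : r * r = x := Real.mul_self_sqrt hx0.le
      set c := √3 with hc
      have hc0 : 0 < c := by positivity
      have hc2 : c * c = 3 := Real.mul_self_sqrt (by norm_num)
      have hne : r * s + c ≠ 0 := by positivity
      have e1 : 1 / c * (3 * x / s) = x * c / s := by
        rw [← hc2]; field_simp
      have e2 : (2 * x + 3) / (3 * (s * (r * s + c))) * ((x - 1) * s * (3 * x / s)) =
          x * ((2 * x + 3) * (x - 1)) / (s * (r * s + c)) := by
        field_simp
      have e3 : (2 * x + 3) * (x - 1) = (r * s - c) * (r * s + c) := by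
        have : (r * s - c) * (r * s + c) = (r * r) * (s * s) - c * c := by ring
        rw [this, hr2, hs2, hc2]; ring
      rw [e1, e2, e3]
      field_simp
      ring)
  obtain ⟨C, hC, h⟩ := h
  refine ⟨C, hC, fun P u v hP hu huv hv => ?_⟩
  have e : ∫ t in u..v, ((t * √t : ℝ) : ℂ) * ee (P * (t ^ 3 - 3 / 2 * t ^ 2)) =
      ∫ t in u..v, ((t * √t : ℝ) : ℂ) * ee (P * (((t - 1) * √(2 * t + 1)) ^ 2 / 2 - 1 / 2)) := by
    refine intervalIntegral.integral_congr fun t ht => ?_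
    rw [Set.uIcc_of_le huv] at ht
    have ht0 : 0 ≤ 2 * t + 1 := by linarith [ht.1]
    rw [mul_pow, Real.sq_sqrt ht0]
    congr 2; ring
  rw [e]
  exact h P u v hP hu huv hv

lemma integral_cubic_substitution {ω a m u v : ℝ} (hω : 0 < ω) (ha : 0 < a) (hm : 0 < m)
    (hu : 0 < u) (huv : u ≤ v) :
    ∫ b in (ω ^ 2 * a / m * u) ^ 3 / a..(ω ^ 2 * a / m * v) ^ 3 / a,
      (((a * b) ^ (-(1 : ℝ) / 6) : ℝ) : ℂ) * ee (m * b - 3 / 2 * (ω ^ 3 * (a * b)) ^ ((2 : ℝ) / 3)) =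
    ((3 * ω ^ 5 * a * √a / (m ^ 2 * √m) : ℝ) : ℂ) *
      ∫ t in u..v, ((t * √t : ℝ) : ℂ) * ee (ω ^ 6 * a ^ 2 / m ^ 2 * (t ^ 3 - 3 / 2 * t ^ 2)) := by
  have hu' : Set.uIcc u v = Set.Icc u v := Set.uIcc_of_le huv
  have hsub := intervalIntegral.integral_deriv_smul_comp' (a := u) (b := v)
    (f := fun t => (ω ^ 2 * a / m * t) ^ 3 / a)
    (f' := fun t => 3 * (ω ^ 2 * a / m * t) ^ 2 * (ω ^ 2 * a / m) / a)
    (g := fun b => (((a * b) ^ (-(1 : ℝ) / 6) : ℝ) : ℂ) *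
      ee (m * b - 3 / 2 * (ω ^ 3 * (a * b)) ^ ((2 : ℝ) / 3)))
    (fun x _ => by
      have := (((hasDerivAt_id x).const_mul (ω ^ 2 * a / m)).pow 3).div_const a
      exact this.congr_deriv (by simp))
    (by fun_prop)
    (by
      rintro _ ⟨t, ht, rfl⟩
      rw [hu'] at ht
      have ht0 : 0 < t := hu.trans_le ht.1
      have hb0 : 0 < (ω ^ 2 * a / m * t) ^ 3 / a := by positivity
      refine ContinuousAt.continuousWithinAt ?_
      refine ContinuousAt.mul ?_ ?_
      · refine Complex.continuous_ofReal.continuousAt.comp ?_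
        exact ContinuousAt.rpow_const (by fun_prop) (Or.inl (by positivity))
      · refine continuous_ee.continuousAt.comp ?_
        refine ContinuousAt.sub (by fun_prop) (continuousAt_const.mul ?_)
        exact ContinuousAt.rpow_const (by fun_prop) (Or.inr (by norm_num)))
  rw [← hsub, ← intervalIntegral.integral_const_mul]
  refine intervalIntegral.integral_congr fun t ht => ?_
  rw [hu'] at ht
  have ht0 : 0 < t := hu.trans_le ht.1
  set x := ω ^ 2 * a / m * t with hx
  have hx0 : 0 < x := by positivity
  have e1 : a * (x ^ 3 / a) = x ^ 3 := by field_simp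
  have e2 : (x ^ 3) ^ (-(1 : ℝ) / 6) = 1 / √x := by
    rw [← Real.rpow_natCast, ← Real.rpow_mul hx0.le, Real.sqrt_eq_rpow, one_div,
      ← Real.rpow_neg hx0.le]
    norm_num
  have e3 : (ω ^ 3 * x ^ 3) ^ ((2 : ℝ) / 3) = (ω * x) ^ 2 := by
    rw [← mul_pow, ← Real.rpow_natCast, ← Real.rpow_mul (by positivity), ← Real.rpow_natCast]
    norm_num
  have e4 : √x = ω * √a / √m * √t := by
    rw [hx, Real.sqrt_mul (by positivity), Real.sqrt_div (by positivity),
      Real.sqrt_mul (by positivity), Real.sqrt_sq hω.le]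
  have e5 : m * (x ^ 3 / a) - 3 / 2 * (ω * x) ^ 2 =
      ω ^ 6 * a ^ 2 / m ^ 2 * (t ^ 3 - 3 / 2 * t ^ 2) := by
    rw [hx]; field_simp
  have e6 : 3 * x ^ 2 * (ω ^ 2 * a / m) / a * (1 / √x) =
      3 * ω ^ 5 * a * √a / (m ^ 2 * √m) * (t * √t) := by
    have h1 : √a * √a = a := Real.mul_self_sqrt ha.le
    have h2 : √m * √m = m := Real.mul_self_sqrt hm.le
    have h3 : √t * √t = t := Real.mul_self_sqrt ht0.le
    have p1 : 0 < √a := by positivity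
    have p2 : 0 < √m := by positivity
    have p3 : 0 < √t := by positivity
    rw [e4, hx]
    generalize √a = ra at *
    generalize √m = rm at *
    generalize √t = rt at *
    subst h1 h2 h3
    field_simp
  simp only [Function.comp, Complex.real_smul]
  rw [e1, e2, e3, e5, ← mul_assoc, ← Complex.ofReal_mul, e6]
  push_cast; ring

lemma integral_quadratic_substitution {ω a m u v : ℝ} (hω : 0 < ω) (ha : 0 < a) (hm : 0 < m)
    (hu : 0 < u) (huv : u ≤ v) :
    ∫ c in a * ω ^ 6 / m ^ 2 * u..a * ω ^ 6 / m ^ 2 * v,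
      (√(m * c) : ℂ) * ee ((m * c) ^ 2 / (2 * ω ^ 6) - a * c) =
    ((ω ^ 9 * a * √a / (m ^ 2 * √m) : ℝ) : ℂ) *
      ∫ t in u..v, (√t : ℂ) * ee (ω ^ 6 * a ^ 2 / m ^ 2 * (t ^ 2 / 2 - t)) := by
  have hc0 : a * ω ^ 6 / m ^ 2 ≠ 0 := by positivity
  rw [← intervalIntegral.smul_integral_comp_mul_left, ← intervalIntegral.integral_const_mul,
    ← intervalIntegral.integral_smul]
  refine intervalIntegral.integral_congr fun t ht => ?_
  rw [Set.uIcc_of_le huv] at ht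
  have ht0 : 0 < t := hu.trans_le ht.1
  have e1 : √(m * (a * ω ^ 6 / m ^ 2 * t)) = ω ^ 3 * √a / √m * √t := by
    have : m * (a * ω ^ 6 / m ^ 2 * t) = (ω ^ 3) ^ 2 * a / m * t := by field_simp
    rw [this, Real.sqrt_mul (by positivity), Real.sqrt_div (by positivity),
      Real.sqrt_mul (by positivity), Real.sqrt_sq (by positivity)]
  have e2 : (m * (a * ω ^ 6 / m ^ 2 * t)) ^ 2 / (2 * ω ^ 6) - a * (a * ω ^ 6 / m ^ 2 * t) =
      ω ^ 6 * a ^ 2 / m ^ 2 * (t ^ 2 / 2 - t) := by field_simp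
  have e3 : a * ω ^ 6 / m ^ 2 * (ω ^ 3 * √a / √m * √t) =
      ω ^ 9 * a * √a / (m ^ 2 * √m) * √t := by
    have p2 : 0 < √m := by positivity
    field_simp
  simp only [Complex.real_smul]
  rw [e1, e2, ← mul_assoc, ← Complex.ofReal_mul, e3]
  push_cast; ring

/-- The common main term of the two stationary phase expansions. -/
noncomputable def mainTerm (ω a m : ℝ) : ℂ :=
  ((√3 * ω ^ 2 * √a / (m * √m) : ℝ) : ℂ) * ee (-(ω ^ 6 * a ^ 2 / m ^ 2 / 2))

lemma sqrt_phase {ω a m : ℝ} (hω : 0 < ω) (ha : 0 < a) (hm : 0 < m) :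
    √(ω ^ 6 * a ^ 2 / m ^ 2) = ω ^ 3 * a / m := by
  have : ω ^ 6 * a ^ 2 / m ^ 2 = (ω ^ 3 * a / m) ^ 2 := by field_simp
  rw [this, Real.sqrt_sq (by positivity)]

lemma exists_norm_integral_sub_mainTerm_le :
    ∃ C : ℝ, 0 < C ∧ ∀ ω ρ a m τ1 τ2 : ℝ, 0 < ω → 0 < ρ → 0 < a → 0 < m →
      1 / 64 ≤ ω ^ 6 * a ^ 2 / m ^ 2 → ρ ^ 2 ≤ τ1 → τ1 ≤ τ2 →
      ω ^ 2 * a / m ≤ 4 * τ1 → τ2 ≤ 4 * (ω ^ 2 * a / m) →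
      ‖(∫ b in τ1 ^ 3 / a..τ2 ^ 3 / a, (((a * b) ^ (-(1 : ℝ) / 6) : ℝ) : ℂ) *
          ee (m * b - 3 / 2 * (ω ^ 3 * (a * b)) ^ ((2 : ℝ) / 3))) -
        if τ1 ≤ ω ^ 2 * a / m ∧ ω ^ 2 * a / m ≤ τ2 then fresnel * mainTerm ω a m else 0‖ ≤
      C / ρ * (1 / (m ^ 2 / (ω ^ 3 * a) + |m - ω ^ 2 * a / τ1|) +
        1 / (m ^ 2 / (ω ^ 3 * a) + |m - ω ^ 2 * a / τ2|)) := by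
  obtain ⟨C, hC, h⟩ := exists_integral_cubic_phase_le
  refine ⟨24 * C, by positivity, ?_⟩
  intro ω ρ a m τ1 τ2 hω hρ ha hm hP hτ1 hτ hx1 hx2
  set x := ω ^ 2 * a / m with hx
  have hx0 : 0 < x := by positivity
  have hτ10 : 0 < τ1 := lt_of_lt_of_le (by positivity) hτ1
  have hu0 : 0 < τ1 / x := by positivity
  have huv : τ1 / x ≤ τ2 / x := by gcongr
  have e1 : τ1 = x * (τ1 / x) := by field_simp
  have e2 : τ2 = x * (τ2 / x) := by field_simp
  have hintegral := integral_cubic_substitution hω ha hm hu0 huv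
  rw [← hx, ← e1, ← e2] at hintegral
  set P := ω ^ 6 * a ^ 2 / m ^ 2 with hPd
  have hP0 : 0 < P := by positivity
  have hsP : √P = ω ^ 3 * a / m := sqrt_phase hω ha hm
  have h4 := h P (τ1 / x) (τ2 / x) hP (by rw [le_div_iff₀ hx0]; linarith) huv
    (by rw [div_le_iff₀ hx0]; linarith)
  simp only [div_le_one hx0, one_le_div hx0] at h4
  set S : ℝ := 3 * ω ^ 5 * a * √a / (m ^ 2 * √m) with hS
  have hS0 : 0 ≤ S := by positivity
  have hmain : (S : ℂ) * (fresnel * ((1 / √3 / √P : ℝ) * ee (-(P / 2)))) =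
      fresnel * mainTerm ω a m := by
    have : √3 * ω ^ 2 * √a / (m * √m) = S * (1 / √3 / √P) := by
      have h3 : √3 * √3 = 3 := Real.mul_self_sqrt (by norm_num)
      rw [hsP, hS]
      have p3 : 0 < √3 := by positivity
      field_simp
      rw [sq, h3]
    rw [mainTerm, this]; push_cast; ring
  rw [hintegral]
  have e3 : (S : ℂ) * (∫ t in τ1 / x..τ2 / x, ((t * √t : ℝ) : ℂ) * ee (P * (t ^ 3 - 3 / 2 * t ^ 2))) -
      (if τ1 ≤ x ∧ x ≤ τ2 then fresnel * mainTerm ω a m else 0) =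
      S * ((∫ t in τ1 / x..τ2 / x, ((t * √t : ℝ) : ℂ) * ee (P * (t ^ 3 - 3 / 2 * t ^ 2))) -
        if τ1 ≤ x ∧ x ≤ τ2 then fresnel * ((1 / √3 / √P : ℝ) * ee (-(P / 2))) else 0) := by
    rw [← hmain]; split_ifs <;> ring
  rw [e3, norm_mul, Complex.norm_real, Real.norm_of_nonneg hS0]
  have hend : ∀ τ, ρ ^ 2 ≤ τ → x ≤ 4 * τ → τ ≤ 4 * x → S * (1 / (√P + P * |τ / x - 1|)) ≤
      24 / ρ * (1 / (m ^ 2 / (ω ^ 3 * a) + |m - ω ^ 2 * a / τ|)) := by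
    intro τ h1 h2 h3
    have hτ0 : 0 < τ := lt_of_lt_of_le (by positivity) h1
    have hsx : √x = ω * √a / √m := by
      rw [hx, Real.sqrt_div (by positivity), Real.sqrt_mul (by positivity), Real.sqrt_sq hω.le]
    have hρx : ρ / 2 ≤ √x := Real.le_sqrt_of_sq_le (by nlinarith)
    set w := m ^ 2 / (ω ^ 3 * a) with hw
    have hw0 : 0 < w := by positivity
    have hPw : P = S * √x / 3 * m := by
      rw [hS, hsx, hPd]
      have h5 : √a * √a = a := Real.mul_self_sqrt ha.le
      have h6 : √m * √m = m := Real.mul_self_sqrt hm.le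
      have p1 : 0 < √a := by positivity
      have p2 : 0 < √m := by positivity
      generalize √a = ra at *
      generalize √m = rm at *
      subst h5 h6
      field_simp
    have hPw2 : √P = S * √x / 3 * w := by
      have h5 : S * √x / 3 = P / m := by rw [hPw]; field_simp
      rw [h5, hsP, hw, hPd]; field_simp
    have habs : |m - ω ^ 2 * a / τ| / 4 ≤ m * |τ / x - 1| := by
      have e : m * |τ / x - 1| = τ / x * |m - ω ^ 2 * a / τ| := by
        rw [← abs_of_pos hm, ← abs_mul, ← abs_of_pos (div_pos hτ0 hx0), ← abs_mul,
          abs_of_pos hm, abs_of_pos (div_pos hτ0 hx0)]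
        congr 1
        rw [hx]; field_simp
      rw [e]
      have h5 : 1 / 4 ≤ τ / x := by rw [le_div_iff₀ hx0]; linarith
      nlinarith [abs_nonneg (m - ω ^ 2 * a / τ)]
    have hden : S * √x / 3 * ((w + |m - ω ^ 2 * a / τ|) / 4) ≤ √P + P * |τ / x - 1| := by
      have e : √P + P * |τ / x - 1| = S * √x / 3 * (w + m * |τ / x - 1|) := by
        rw [hPw2, mul_add]; congr 1; rw [hPw]; ring
      rw [e]
      refine mul_le_mul_of_nonneg_left ?_ (by positivity)
      linarith
    have hSp : 0 < S := by positivity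
    have hsx0 : 0 < √x := by positivity
    set D := w + |m - ω ^ 2 * a / τ| with hD
    have hD0 : 0 < D := by positivity
    calc S * (1 / (√P + P * |τ / x - 1|)) ≤ S * (1 / (S * √x / 3 * (D / 4))) :=
          mul_le_mul_of_nonneg_left (one_div_le_one_div_of_le (by positivity) hden) hS0
      _ = 12 / √x * (1 / D) := by field_simp; norm_num
      _ ≤ 12 / (ρ / 2) * (1 / D) := by gcongr
      _ = 24 / ρ * (1 / D) := by ring
  have h5 := hend τ1 hτ1 hx1 (hτ.trans hx2)
  have h6 := hend τ2 (hτ1.trans hτ) (hx1.trans (by linarith)) hx2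
  calc _ ≤ S * (C * (1 / (√P + P * |τ1 / x - 1|) + 1 / (√P + P * |τ2 / x - 1|))) :=
        mul_le_mul_of_nonneg_left h4 hS0
    _ = C * (S * (1 / (√P + P * |τ1 / x - 1|)) + S * (1 / (√P + P * |τ2 / x - 1|))) := by ring
    _ ≤ C * (24 / ρ * (1 / (m ^ 2 / (ω ^ 3 * a) + |m - ω ^ 2 * a / τ1|)) +
        24 / ρ * (1 / (m ^ 2 / (ω ^ 3 * a) + |m - ω ^ 2 * a / τ2|))) := by gcongr
    _ = _ := by ring

lemma exists_norm_integral_sub_mainTerm_le' :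
    ∃ C : ℝ, 0 < C ∧ ∀ ω B a m γ1 γ2 : ℝ, 0 < ω → 0 < B → 0 < a → 0 < m →
      1 / 64 ≤ ω ^ 6 * a ^ 2 / m ^ 2 → 0 < γ1 → γ1 ≤ γ2 → m * γ2 ≤ B ^ 2 →
      a * ω ^ 6 / m ^ 2 ≤ 4 * γ1 → γ2 ≤ 4 * (a * ω ^ 6 / m ^ 2) →
      ‖(√3 / ω ^ 4 : ℝ) * (∫ c in γ1..γ2, (√(m * c) : ℂ) * ee ((m * c) ^ 2 / (2 * ω ^ 6) - a * c)) -
        if γ1 ≤ a * ω ^ 6 / m ^ 2 ∧ a * ω ^ 6 / m ^ 2 ≤ γ2 then fresnel * mainTerm ω a m else 0‖ ≤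
      C * B / ω ^ 4 * (1 / (m / ω ^ 3 + |a - m ^ 2 * γ1 / ω ^ 6|) +
        1 / (m / ω ^ 3 + |a - m ^ 2 * γ2 / ω ^ 6|)) := by
  obtain ⟨C, hC, h⟩ := exists_integral_quadratic_phase_le
  refine ⟨2 * √3 * C, by positivity, ?_⟩
  intro ω B a m γ1 γ2 hω hB ha hm hP hγ1 hγ hγB hx1 hx2
  set x := a * ω ^ 6 / m ^ 2 with hx
  have hx0 : 0 < x := by positivity
  have hu0 : 0 < γ1 / x := by positivity
  have huv : γ1 / x ≤ γ2 / x := by gcongr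
  have e1 : γ1 = x * (γ1 / x) := by field_simp
  have e2 : γ2 = x * (γ2 / x) := by field_simp
  have hintegral := integral_quadratic_substitution hω ha hm hu0 huv
  rw [← hx, ← e1, ← e2] at hintegral
  set P := ω ^ 6 * a ^ 2 / m ^ 2 with hPd
  have hP0 : 0 < P := by positivity
  have hsP : √P = ω ^ 3 * a / m := sqrt_phase hω ha hm
  have h4 := h P (γ1 / x) (γ2 / x) hP (by rw [le_div_iff₀ hx0]; linarith) huv
    (by rw [div_le_iff₀ hx0]; linarith)
  simp only [div_le_one hx0, one_le_div hx0] at h4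
  set S : ℝ := √3 / ω ^ 4 * (ω ^ 9 * a * √a / (m ^ 2 * √m)) with hS
  have hS0 : 0 ≤ S := by positivity
  have hmain : (S : ℂ) * (fresnel * ((1 / √P : ℝ) * ee (-(P / 2)))) =
      fresnel * mainTerm ω a m := by
    have : √3 * ω ^ 2 * √a / (m * √m) = S * (1 / √P) := by
      rw [hsP, hS]
      field_simp
    rw [mainTerm, this]; push_cast; ring
  rw [hintegral, ← mul_assoc, ← Complex.ofReal_mul]
  have e3 : (S : ℂ) * (∫ t in γ1 / x..γ2 / x, (√t : ℂ) * ee (P * (t ^ 2 / 2 - t))) -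
      (if γ1 ≤ x ∧ x ≤ γ2 then fresnel * mainTerm ω a m else 0) =
      S * ((∫ t in γ1 / x..γ2 / x, (√t : ℂ) * ee (P * (t ^ 2 / 2 - t))) -
        if γ1 ≤ x ∧ x ≤ γ2 then fresnel * ((1 / √P : ℝ) * ee (-(P / 2))) else 0) := by
    rw [← hmain]; split_ifs <;> ring
  rw [e3, norm_mul, Complex.norm_real, Real.norm_of_nonneg hS0]
  have hsx : √x = ω ^ 3 * √a / m := by
    have : x = (ω ^ 3) ^ 2 * a / m ^ 2 := by rw [hx]; ring
    rw [this, Real.sqrt_div (by positivity), Real.sqrt_mul (by positivity),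
      Real.sqrt_sq (by positivity), Real.sqrt_sq hm.le]
  have hxB : √m * √x ≤ 2 * B := by
    rw [← Real.sqrt_mul hm.le]
    refine Real.sqrt_le_iff.2 ⟨by positivity, ?_⟩
    nlinarith
  have hSx : S = √3 / ω ^ 4 * (√m * √x) * x := by
    rw [hS, hsx, hx]
    have h6 : √m * √m = m := Real.mul_self_sqrt hm.le
    have p2 : 0 < √m := by positivity
    generalize √m = rm at *
    subst h6
    field_simp
  have hPx : P = x * a := by rw [hx, hPd]; ring
  have hend : ∀ τ, 0 < τ → S * (1 / (√P + P * |τ / x - 1|)) ≤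
      2 * √3 * B / ω ^ 4 * (1 / (m / ω ^ 3 + |a - m ^ 2 * τ / ω ^ 6|)) := by
    intro τ hτ0
    have habs : a * |τ / x - 1| = |a - m ^ 2 * τ / ω ^ 6| := by
      rw [← abs_of_pos ha, ← abs_mul, abs_of_pos ha, abs_sub_comm]
      congr 1
      rw [hx]; field_simp
    have hden : √P + P * |τ / x - 1| = x * (m / ω ^ 3 + |a - m ^ 2 * τ / ω ^ 6|) := by
      rw [mul_add, ← habs, hsP, hPx]
      have : x * (m / ω ^ 3) = ω ^ 3 * a / m := by rw [hx]; field_simp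
      rw [this]; ring
    rw [hden]
    set D := m / ω ^ 3 + |a - m ^ 2 * τ / ω ^ 6| with hD
    have hD0 : 0 < D := by positivity
    calc S * (1 / (x * D)) = √3 / ω ^ 4 * (√m * √x) * (1 / D) := by rw [hSx]; field_simp
      _ ≤ √3 / ω ^ 4 * (2 * B) * (1 / D) := by gcongr
      _ = _ := by ring
  have h5 := hend γ1 hγ1
  have h6 := hend γ2 (hγ1.trans_le hγ)
  calc _ ≤ S * (C * (1 / (√P + P * |γ1 / x - 1|) + 1 / (√P + P * |γ2 / x - 1|))) :=
        mul_le_mul_of_nonneg_left h4 hS0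
    _ = C * (S * (1 / (√P + P * |γ1 / x - 1|)) + S * (1 / (√P + P * |γ2 / x - 1|))) := by ring
    _ ≤ C * (2 * √3 * B / ω ^ 4 * (1 / (m / ω ^ 3 + |a - m ^ 2 * γ1 / ω ^ 6|)) +
        2 * √3 * B / ω ^ 4 * (1 / (m / ω ^ 3 + |a - m ^ 2 * γ2 / ω ^ 6|))) := by gcongr
    _ = _ := by ring

lemma norm_sum_mul_card_divisors_sub_le {x y U : ℝ} {u : ℕ → ℂ} (hx : 0 < x) (hy : 0 ≤ y)
    (hU0 : 0 ≤ U) (hU : ∀ k : ℕ, x ≤ k → k ≤ y → ‖u k‖ ≤ U) :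
    ‖∑ k ∈ Finset.Icc ⌈x⌉₊ ⌊y⌋₊, (d k : ℂ) * u k -
      2 * ∑ a ∈ Finset.Icc 1 ⌊√y⌋₊, ∑ b ∈ Finset.Ioc ⌊max (a : ℝ) (x / a)⌋₊ ⌊y / a⌋₊, u (a * b)‖ ≤
    3 * U * √y := by
  classical
  set S := ((Finset.Icc 1 ⌊y⌋₊) ×ˢ (Finset.Icc 1 ⌊y⌋₊)).filter
    (fun p => p.1 * p.2 ∈ Finset.Icc ⌈x⌉₊ ⌊y⌋₊) with hS
  have hx1 : 1 ≤ ⌈x⌉₊ := Nat.one_le_ceil_iff.2 hx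
  have e1 : ∑ k ∈ Finset.Icc ⌈x⌉₊ ⌊y⌋₊, (d k : ℂ) * u k = ∑ p ∈ S, u (p.1 * p.2) := by
    rw [← Finset.sum_fiberwise_of_maps_to (s := S) (t := Finset.Icc ⌈x⌉₊ ⌊y⌋₊)
      (g := fun p => p.1 * p.2) (fun p hp => (Finset.mem_filter.1 hp).2)]
    refine Finset.sum_congr rfl fun k hk => ?_
    have hk0 : k ≠ 0 := by have := (Finset.mem_Icc.1 hk).1; omega
    have : S.filter (fun p => p.1 * p.2 = k) = k.divisorsAntidiagonal := by
      ext ⟨a, b⟩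
      simp only [hS, Finset.mem_filter, Finset.mem_product, Nat.mem_divisorsAntidiagonal]
      constructor
      · rintro ⟨_, h⟩; exact ⟨h, hk0⟩
      · rintro ⟨h, _⟩
        subst h
        have ha : a ≠ 0 := by rintro rfl; simp at hk0
        have hb : b ≠ 0 := by rintro rfl; simp at hk0
        have hk2 := (Finset.mem_Icc.1 hk).2
        refine ⟨⟨⟨Finset.mem_Icc.2 ⟨by omega, ?_⟩, Finset.mem_Icc.2 ⟨by omega, ?_⟩⟩, hk⟩, rfl⟩
        · exact (Nat.le_mul_of_pos_right a (by omega)).trans hk2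
        · exact (Nat.le_mul_of_pos_left b (by omega)).trans hk2
    rw [Finset.sum_congr rfl (g := fun _ => u k) (fun p hp => by rw [(Finset.mem_filter.1 hp).2]),
      Finset.sum_const, this, nsmul_eq_mul]
    congr 2
    rw [d, ← Nat.map_div_right_divisors, Finset.card_map]
  have e2 : ∑ p ∈ S, u (p.1 * p.2) = ∑ p ∈ S.filter (fun p => p.1 = p.2), u (p.1 * p.2) +
      2 * ∑ p ∈ S.filter (fun p => p.1 < p.2), u (p.1 * p.2) := by
    have h1 : ∑ p ∈ S.filter (fun p => p.2 < p.1), u (p.1 * p.2) =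
        ∑ p ∈ S.filter (fun p => p.1 < p.2), u (p.1 * p.2) := by
      refine Finset.sum_bij' (fun p _ => p.swap) (fun p _ => p.swap) ?_ ?_ ?_ ?_ ?_
      · rintro ⟨a, b⟩ h
        simp only [hS, Finset.mem_filter, Finset.mem_product, Prod.swap, mul_comm b a] at h ⊢
        tauto
      · rintro ⟨a, b⟩ h
        simp only [hS, Finset.mem_filter, Finset.mem_product, Prod.swap, mul_comm b a] at h ⊢
        tauto
      · intros; simp
      · intros; simp
      · rintro ⟨a, b⟩ h; simp [mul_comm]
    clear_value S
    rw [← Finset.sum_filter_add_sum_filter_not S (fun p => p.1 = p.2), two_mul]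
    congr 1
    rw [← Finset.sum_filter_add_sum_filter_not _ (fun p : ℕ × ℕ => p.1 < p.2)]
    congr 1
    · congr 1; ext p
      rw [Finset.mem_filter, Finset.mem_filter, Finset.mem_filter]
      constructor
      · rintro ⟨⟨h, _⟩, h'⟩; exact ⟨h, h'⟩
      · rintro ⟨h, h'⟩; exact ⟨⟨h, by omega⟩, h'⟩
    · rw [← h1]
      congr 1; ext p
      rw [Finset.mem_filter, Finset.mem_filter, Finset.mem_filter]
      constructor
      · rintro ⟨⟨h, _⟩, h'⟩; exact ⟨h, by omega⟩
      · rintro ⟨h, h'⟩; exact ⟨⟨h, by omega⟩, by omega⟩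
  have hdiag : ‖∑ p ∈ S.filter (fun p => p.1 = p.2), u (p.1 * p.2)‖ ≤ U * √y := by
    have hc : (S.filter (fun p => p.1 = p.2)).card ≤ ⌊√y⌋₊ := by
      have := Finset.card_le_card_of_injOn (s := S.filter (fun p => p.1 = p.2))
        (t := Finset.Icc 1 ⌊√y⌋₊) (fun p => p.1) (by
          rintro ⟨a, b⟩ h
          simp only [hS, Finset.coe_filter, Finset.mem_filter, Finset.mem_product, Set.mem_ofPred_eq,
            Finset.mem_Icc] at h
          obtain ⟨⟨⟨⟨ha, _⟩, _⟩, _, h2⟩, rfl⟩ := h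
          simp only [Finset.coe_Icc, Set.mem_Icc]
          refine ⟨ha, Nat.le_floor ?_⟩
          refine Real.le_sqrt_of_sq_le ?_
          have := (Nat.le_floor_iff hy).1 h2
          push_cast at this; nlinarith) (by
          rintro ⟨a, b⟩ h ⟨a', b'⟩ h' hh
          simp only [Finset.coe_filter, Set.mem_ofPred_eq] at h h' hh
          ext <;> simp <;> omega)
      simpa using this
    calc _ ≤ ∑ p ∈ S.filter (fun p => p.1 = p.2), U := norm_sum_le_of_le _ fun p hp => by
          have := Finset.mem_Icc.1 (Finset.mem_filter.1 (Finset.mem_filter.1 hp).1).2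
          exact hU _ (Nat.ceil_le.1 this.1) ((Nat.le_floor_iff hy).1 this.2)
      _ = U * (S.filter (fun p => p.1 = p.2)).card := by rw [Finset.sum_const, nsmul_eq_mul]; ring
      _ ≤ U * √y := by
        gcongr
        exact (Nat.cast_le.2 hc).trans (Nat.floor_le (by positivity))
  have e3 : ∑ p ∈ S.filter (fun p => p.1 < p.2), u (p.1 * p.2) =
      ∑ a ∈ Finset.Icc 1 ⌊√y⌋₊, ∑ b ∈ (Finset.Ioc a ⌊y / a⌋₊).filter (fun b : ℕ => x ≤ a * b),
        u (a * b) := by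
    rw [Finset.sum_sigma']
    refine Finset.sum_bij' (fun p _ => ⟨p.1, p.2⟩) (fun p _ => ⟨p.1, p.2⟩) ?_ ?_ ?_ ?_ ?_
    · rintro ⟨a, b⟩ h
      simp only [hS, Finset.mem_filter, Finset.mem_product, Finset.mem_Icc] at h
      obtain ⟨⟨⟨⟨ha, _⟩, _⟩, h1, h2⟩, h3⟩ := h
      have h1' := Nat.ceil_le.1 h1
      have h2' := (Nat.le_floor_iff hy).1 h2
      push_cast at h1' h2'
      have ha0 : (0 : ℝ) < a := by exact_mod_cast ha
      have h3' : (a : ℝ) < b := by exact_mod_cast h3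
      simp only [Finset.mem_sigma, Finset.mem_Icc, Finset.mem_filter, Finset.mem_Ioc]
      refine ⟨⟨ha, Nat.le_floor (Real.le_sqrt_of_sq_le (by nlinarith))⟩,
        ⟨h3, Nat.le_floor ?_⟩, h1'⟩
      rw [le_div_iff₀ ha0]; linarith
    · rintro ⟨a, b⟩ h
      simp only [Finset.mem_sigma, Finset.mem_Icc, Finset.mem_filter, Finset.mem_Ioc] at h
      obtain ⟨⟨ha, _⟩, ⟨h3, h2⟩, h1⟩ := h
      have ha0 : (0 : ℝ) < a := by exact_mod_cast ha
      have h2' : (b : ℝ) * a ≤ y := by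
        rw [← le_div_iff₀ ha0]; exact (Nat.le_floor_iff (by positivity)).1 h2
      have hab : a * b ≤ ⌊y⌋₊ := Nat.le_floor (by push_cast; linarith)
      simp only [hS, Finset.mem_filter, Finset.mem_product, Finset.mem_Icc]
      refine ⟨⟨⟨⟨ha, ?_⟩, ⟨by omega, ?_⟩⟩, Nat.ceil_le.2 (by push_cast; exact h1), hab⟩, h3⟩
      · exact (Nat.le_mul_of_pos_right a (by omega)).trans hab
      · exact (Nat.le_mul_of_pos_left b (by omega)).trans hab
    · intros; rfl
    · intros; rfl
    · intros; rfl
  have e4 : ∀ a ∈ Finset.Icc 1 ⌊√y⌋₊,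
      ‖∑ b ∈ (Finset.Ioc a ⌊y / a⌋₊).filter (fun b : ℕ => x ≤ a * b), u (a * b) -
        ∑ b ∈ Finset.Ioc ⌊max (a : ℝ) (x / a)⌋₊ ⌊y / a⌋₊, u (a * b)‖ ≤ U := by
    intro a ha
    have ha0 : (0 : ℝ) < a := by exact_mod_cast (Finset.mem_Icc.1 ha).1
    have hsub : Finset.Ioc ⌊max (a : ℝ) (x / a)⌋₊ ⌊y / a⌋₊ ⊆
        (Finset.Ioc a ⌊y / a⌋₊).filter (fun b : ℕ => x ≤ a * b) := by
      intro b hb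
      have h1 := (Nat.floor_lt (by positivity)).1 (Finset.mem_Ioc.1 hb).1
      rw [max_lt_iff, div_lt_iff₀ ha0] at h1
      refine Finset.mem_filter.2 ⟨Finset.mem_Ioc.2 ⟨by exact_mod_cast h1.1,
        (Finset.mem_Ioc.1 hb).2⟩, by linarith⟩
    rw [← Finset.sum_sdiff hsub, add_sub_cancel_right]
    have hkey : ∀ b ∈ (Finset.Ioc a ⌊y / a⌋₊).filter (fun b : ℕ => x ≤ a * b) \
        Finset.Ioc ⌊max (a : ℝ) (x / a)⌋₊ ⌊y / a⌋₊, (b : ℝ) = x / a ∧ ‖u (a * b)‖ ≤ U := by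
      intro b hb
      simp only [Finset.mem_sdiff, Finset.mem_filter, Finset.mem_Ioc, not_and_or, not_lt] at hb
      obtain ⟨⟨⟨h1, h2⟩, h3⟩, h4⟩ := hb
      rcases h4 with h4 | h4
      · have h5 := (Nat.le_floor_iff (by positivity)).1 h4
        have h1' : (a : ℝ) < b := by exact_mod_cast h1
        rcases le_max_iff.1 h5 with h6 | h6
        · linarith
        · refine ⟨le_antisymm h6 (by rw [div_le_iff₀ ha0]; linarith), hU _ (by push_cast; exact h3) ?_⟩
          have h2' := (Nat.le_floor_iff (by positivity)).1 h2
          rw [le_div_iff₀ ha0] at h2'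
          push_cast; linarith
      · exact absurd h2 h4
    have hcard : ((Finset.Ioc a ⌊y / a⌋₊).filter (fun b : ℕ => x ≤ a * b) \
        Finset.Ioc ⌊max (a : ℝ) (x / a)⌋₊ ⌊y / a⌋₊).card ≤ 1 :=
      Finset.card_le_one.2 fun b hb c hc => by
        have := (hkey b hb).1.trans (hkey c hc).1.symm
        exact_mod_cast this
    refine (norm_sum_le_of_le _ fun b hb => (hkey b hb).2).trans ?_
    rw [Finset.sum_const, nsmul_eq_mul]
    have : (((Finset.Ioc a ⌊y / a⌋₊).filter (fun b : ℕ => x ≤ a * b) \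
        Finset.Ioc ⌊max (a : ℝ) (x / a)⌋₊ ⌊y / a⌋₊).card : ℝ) ≤ 1 := by exact_mod_cast hcard
    nlinarith
  rw [e1, e2, e3, add_sub_assoc, ← mul_sub, ← Finset.sum_sub_distrib]
  refine (norm_add_le _ _).trans ?_
  have h5 : ‖∑ a ∈ Finset.Icc 1 ⌊√y⌋₊,
      (∑ b ∈ (Finset.Ioc a ⌊y / a⌋₊).filter (fun b : ℕ => x ≤ a * b), u (a * b) -
        ∑ b ∈ Finset.Ioc ⌊max (a : ℝ) (x / a)⌋₊ ⌊y / a⌋₊, u (a * b))‖ ≤ √y * U := by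
    refine (norm_sum_le_of_le _ e4).trans ?_
    rw [Finset.sum_const, nsmul_eq_mul, Nat.card_Icc, Nat.add_sub_cancel]
    gcongr
    exact Nat.floor_le (by positivity)
  rw [norm_mul, Complex.norm_ofNat]
  linarith

lemma rpow_third_pow {x : ℝ} (hx : 0 ≤ x) : (x ^ ((1 : ℝ) / 3)) ^ 3 = x := by
  rw [← Real.rpow_natCast, ← Real.rpow_mul hx]; norm_num

lemma integral_mul_ee_neg (g f : ℝ → ℝ) (u v : ℝ) :
    ∫ t in u..v, (g t : ℂ) * ee (-(f t)) =
      starRingEnd ℂ (∫ t in u..v, (g t : ℂ) * ee (f t)) := by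
  rw [← intervalIntegral.intervalIntegral_conj]
  refine intervalIntegral.integral_congr fun t _ => ?_
  simp only [map_mul, Complex.conj_ofReal, conj_ee]

lemma hasDerivAt_const_mul_rpow {c k p x : ℝ} (hx : 0 < k * x) :
    HasDerivAt (fun t => c * (k * t) ^ p) (c * p * k * (k * x) ^ (p - 1)) x := by
  have h := (((hasDerivAt_id x).const_mul k).rpow_const (p := p) (Or.inl hx.ne')).const_mul c
  refine h.congr_deriv ?_
  simp only [id]; ring

/-- The range of pairs `(a, m)` in which the stationary phase contributes. -/
def Stationary (ω ρ a m : ℝ) : Prop :=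
  m ^ 3 ≤ ω ^ 6 * a ∧ ρ ^ 2 * m ≤ ω ^ 2 * a ∧ ω ^ 2 * a ≤ √2 * (ρ ^ 2 * m)

lemma sqrt_two_bounds : 1.414 < √2 ∧ √2 < 1.415 := by
  constructor
  · rw [Real.lt_sqrt (by norm_num)]; norm_num
  · rw [Real.sqrt_lt' (by norm_num)]; norm_num

lemma sqrt_two_pow_three : √2 ^ 3 = 2 * √2 := by
  rw [pow_succ, Real.sq_sqrt (by norm_num)]

set_option maxHeartbeats 2000000 in
open Classical in
lemma exists_norm_sum_rpow_sub_le : ∃ C : ℝ, 0 < C ∧ ∀ ω ρ a : ℝ, 0 < ω → 0 < ρ → 1 ≤ a →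
    a ^ 2 ≤ 2 * √2 * ρ ^ 6 →
    ‖∑ b ∈ Finset.Ioc ⌊max a (ρ ^ 6 / a)⌋₊ ⌊2 * √2 * ρ ^ 6 / a⌋₊,
        (((a * b) ^ (-(1 : ℝ) / 6) : ℝ) : ℂ) * ee (3 / 2 * (ω ^ 3 * (a * b)) ^ ((2 : ℝ) / 3)) -
      ∑ m ∈ Finset.Icc ⌈ω ^ 2 * a / (√2 * ρ ^ 2) / 2⌉₊ ⌊4 * (ω ^ 2 * a / (√2 * ρ ^ 2))⌋₊,
        starRingEnd ℂ (if Stationary ω ρ a m then fresnel * mainTerm ω a m else 0)‖ ≤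
    C / ρ * (1 + 1 / (ω ^ 2 * a / (√2 * ρ ^ 2)) + Real.log (2 + ω ^ 2 * a / (√2 * ρ ^ 2)) +
      ∑ m ∈ Finset.Icc ⌈ω ^ 2 * a / (√2 * ρ ^ 2) / 2⌉₊ ⌊4 * (ω ^ 2 * a / (√2 * ρ ^ 2))⌋₊,
        (1 / ((m : ℝ) ^ 2 / (ω ^ 3 * a) +
            |m - min (ω ^ 2 * a / ρ ^ 2) (ω ^ 2 * a ^ ((1 : ℝ) / 3))|) +
          1 / ((m : ℝ) ^ 2 / (ω ^ 3 * a) + |m - ω ^ 2 * a / (√2 * ρ ^ 2)|))) := by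
  obtain ⟨C, hC, h⟩ := exists_norm_integral_sub_mainTerm_le
  refine ⟨C + 200, by positivity, ?_⟩
  intro ω ρ a hω hρ ha1 ha2
  obtain ⟨h2l, h2u⟩ := sqrt_two_bounds
  have h23 := sqrt_two_pow_three
  have ha : 0 < a := by linarith
  set R := ω ^ 2 * a / (√2 * ρ ^ 2) with hRd
  have hR : 0 < R := by positivity
  set s := a ^ ((1 : ℝ) / 3) with hs
  have hs0 : 0 < s := by positivity
  have hs3 : s ^ 3 = a := rpow_third_pow ha.le
  set τ1 := max (ρ ^ 2) (s ^ 2) with hτ1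
  set τ2 := √2 * ρ ^ 2 with hτ2
  have hτ10 : 0 < τ1 := lt_max_of_lt_left (by positivity)
  have hτ20 : 0 < τ2 := by positivity
  have hτ1c : τ1 ^ 3 = max (ρ ^ 6) (a ^ 2) := by
    have hmono : MonotoneOn (fun x : ℝ => x ^ 3) (Set.Ici 0) := fun x hx y _ hxy =>
      pow_le_pow_left₀ hx hxy 3
    have e1 : max (ρ ^ 2) (s ^ 2) ^ 3 = max ((ρ ^ 2) ^ 3) ((s ^ 2) ^ 3) :=
      hmono.map_max (a := ρ ^ 2) (b := s ^ 2) (Set.mem_Ici.2 (by positivity))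
        (Set.mem_Ici.2 (by positivity))
    rw [hτ1, e1, ← hs3]; congr 1 <;> ring
  have hα : τ1 ^ 3 / a = max a (ρ ^ 6 / a) := by
    rw [hτ1c, ← max_div_div_right ha.le, max_comm]
    congr 1; field_simp
  have hβ : τ2 ^ 3 / a = 2 * √2 * ρ ^ 6 / a := by
    rw [hτ2, mul_pow, h23]; ring
  have hτ12 : τ1 ≤ τ2 := by
    have : τ1 ^ 3 ≤ τ2 ^ 3 := by
      rw [hτ1c, hτ2, mul_pow, h23]
      refine max_le ?_ (by linarith [ha2])
      have : 0 < ρ ^ 6 := by positivity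
      nlinarith
    exact le_of_pow_le_pow_left₀ (by norm_num) hτ20.le this
  have hz : min (ω ^ 2 * a / ρ ^ 2) (ω ^ 2 * s) = ω ^ 2 * a / τ1 := by
    rw [hτ1]
    have e : ω ^ 2 * s = ω ^ 2 * a / s ^ 2 := by rw [← hs3]; field_simp
    rw [e]
    rcases le_total (ρ ^ 2) (s ^ 2) with hh | hh
    · rw [max_eq_right hh, min_eq_right]; gcongr
    · rw [max_eq_left hh, min_eq_left]; gcongr
  have hR' : ω ^ 2 * a / τ2 = R := rfl
  rw [hz, ← hα, ← hβ]
  have hα1 : 1 ≤ τ1 ^ 3 / a := by rw [hα]; exact le_max_of_le_left ha1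
  have hαβ : τ1 ^ 3 / a ≤ τ2 ^ 3 / a := by gcongr
  have hkey : ∀ t ∈ Set.Icc (τ1 ^ 3 / a) (τ2 ^ 3 / a), ∃ r : ℝ, ρ ^ 2 ≤ r ∧ r ≤ τ2 ∧ a * t = r ^ 3 := by
    intro t ht
    have h1 := (div_le_iff₀ ha).1 ht.1
    have h2 := (le_div_iff₀ ha).1 ht.2
    have ht0 : 0 ≤ a * t := by nlinarith [pow_pos hτ10 3]
    refine ⟨(a * t) ^ ((1 : ℝ) / 3), ?_, ?_, (rpow_third_pow ht0).symm⟩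
    · refine le_of_pow_le_pow_left₀ (n := 3) (by norm_num) (by positivity) ?_
      rw [rpow_third_pow ht0]
      calc (ρ ^ 2) ^ 3 ≤ τ1 ^ 3 := by gcongr; exact le_max_left _ _
        _ ≤ _ := by linarith
    · refine le_of_pow_le_pow_left₀ (n := 3) (by norm_num) (by positivity) ?_
      rw [rpow_third_pow ht0]; linarith
  have hρ2 : 0 < ρ ^ 2 := by positivity
  have hpos : ∀ t ∈ Set.Icc (τ1 ^ 3 / a) (τ2 ^ 3 / a), 0 < t := fun t ht => by linarith [ht.1]
  have hval : ∀ t ∈ Set.Icc (τ1 ^ 3 / a) (τ2 ^ 3 / a), ∃ r q : ℝ, 0 < r ∧ 0 < q ∧ ρ ^ 2 ≤ r ∧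
      r ≤ τ2 ∧ q ≤ 1 / ρ ∧ t = r ^ 3 / a ∧ (ω ^ 3 * a * t) ^ ((2 : ℝ) / 3 - 1) = 1 / (ω * r) ∧
      (ω ^ 3 * a * t) ^ ((2 : ℝ) / 3 - 1 - 1) = 1 / (ω * r) ^ 4 ∧
      (a * t) ^ (-(1 : ℝ) / 6) = q ∧ (a * t) ^ (-(1 : ℝ) / 6 - 1) = q / r ^ 3 ∧
      (a * t) ^ (-(1 : ℝ) / 6 - 1 - 1) = q / r ^ 6 := by
    intro t ht
    obtain ⟨r, hr1, hr2, hr3⟩ := hkey t ht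
    have hr0 : 0 < r := hρ2.trans_le hr1
    have e1 : ω ^ 3 * a * t = (ω * r) ^ 3 := by rw [mul_assoc, hr3]; ring
    have hr30 : 0 < r ^ 3 := by positivity
    refine ⟨r, 1 / √r, hr0, by positivity, hr1, hr2, ?_, by rw [← hr3]; field_simp, ?_, ?_, ?_, ?_, ?_⟩
    · gcongr; exact Real.le_sqrt_of_sq_le hr1
    · rw [e1, ← Real.rpow_natCast, ← Real.rpow_mul (by positivity), one_div, ← Real.rpow_neg_one]
      norm_num
    · rw [e1, ← Real.rpow_natCast, ← Real.rpow_mul (by positivity), one_div, ← Real.rpow_natCast,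
        ← Real.rpow_neg (by positivity)]
      norm_num
    all_goals rw [hr3]
    · rw [← Real.rpow_natCast, ← Real.rpow_mul hr0.le, Real.sqrt_eq_rpow, one_div,
        ← Real.rpow_neg hr0.le]
      norm_num
    · rw [Real.rpow_sub_one hr30.ne', ← Real.rpow_natCast, ← Real.rpow_mul hr0.le,
        Real.sqrt_eq_rpow, one_div, ← Real.rpow_neg hr0.le]
      norm_num
    · rw [Real.rpow_sub_one hr30.ne', Real.rpow_sub_one hr30.ne', ← Real.rpow_natCast,
        ← Real.rpow_mul hr0.le, Real.sqrt_eq_rpow, one_div, ← Real.rpow_neg hr0.le, div_div,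
        Real.rpow_natCast, ← pow_add]
      norm_num
  have hP3 := norm_sum_sub_sum_integral_le
    (f := fun t => 3 / 2 * (ω ^ 3 * a * t) ^ ((2 : ℝ) / 3))
    (f1 := fun t => 3 / 2 * ((2 : ℝ) / 3) * (ω ^ 3 * a) * (ω ^ 3 * a * t) ^ ((2 : ℝ) / 3 - 1))
    (f2 := fun t => 3 / 2 * ((2 : ℝ) / 3) * (ω ^ 3 * a) * ((2 : ℝ) / 3 - 1) * (ω ^ 3 * a) *
      (ω ^ 3 * a * t) ^ ((2 : ℝ) / 3 - 1 - 1))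
    (g := fun t => 1 * (a * t) ^ (-(1 : ℝ) / 6))
    (g1 := fun t => 1 * (-(1 : ℝ) / 6) * a * (a * t) ^ (-(1 : ℝ) / 6 - 1))
    (g2 := fun t => 1 * (-(1 : ℝ) / 6) * a * (-(1 : ℝ) / 6 - 1) * a *
      (a * t) ^ (-(1 : ℝ) / 6 - 1 - 1))
    (α := τ1 ^ 3 / a) (β := τ2 ^ 3 / a) (R := R) (G := 1 / ρ) hα1 hαβ
    (by
      have : τ2 ^ 3 ≤ 4 * τ1 ^ 3 := by
        rw [hτ1c, hτ2, mul_pow, h23]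
        have h1 : ρ ^ 6 ≤ max (ρ ^ 6) (a ^ 2) := le_max_left _ _
        have : 0 < ρ ^ 6 := by positivity
        nlinarith
      calc τ2 ^ 3 / a ≤ 4 * τ1 ^ 3 / a := by gcongr
        _ = _ := by ring)
    hR
    (fun t ht => hasDerivAt_const_mul_rpow (by have := hpos t ht; positivity))
    (fun t ht => hasDerivAt_const_mul_rpow (by have := hpos t ht; positivity))
    (fun t ht => hasDerivAt_const_mul_rpow (by have := hpos t ht; positivity))
    (fun t ht => hasDerivAt_const_mul_rpow (by have := hpos t ht; positivity))
    (by
      refine ContinuousOn.mul continuousOn_const ?_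
      exact ContinuousOn.rpow_const (by fun_prop)
        fun t ht => Or.inl (by have := hpos t ht; positivity))
    (by
      refine ContinuousOn.mul continuousOn_const ?_
      exact ContinuousOn.rpow_const (by fun_prop)
        fun t ht => Or.inl (by have := hpos t ht; positivity))
    (Or.inr fun t ht => by
      have := hpos t ht
      have e : 3 / 2 * ((2 : ℝ) / 3) * (ω ^ 3 * a) * ((2 : ℝ) / 3 - 1) * (ω ^ 3 * a) *
        (ω ^ 3 * a * t) ^ ((2 : ℝ) / 3 - 1 - 1) =
        -(1 / 3 * (ω ^ 3 * a) ^ 2 * (ω ^ 3 * a * t) ^ ((2 : ℝ) / 3 - 1 - 1)) := by ring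
      rw [e, neg_nonpos]; positivity)
    (fun t ht => by
      obtain ⟨r, q, hr0, hq0, hr1, hr2, hq, ht', v1, v2, w0, w1, w2⟩ := hval t ht
      rw [v1, hRd]
      have e : 3 / 2 * ((2 : ℝ) / 3) * (ω ^ 3 * a) * (1 / (ω * r)) = ω ^ 2 * a / r := by field_simp
      rw [e]; gcongr)
    (fun t ht => by
      obtain ⟨r, q, hr0, hq0, hr1, hr2, hq, ht', v1, v2, w0, w1, w2⟩ := hval t ht
      rw [v1, hRd]
      have e : 3 / 2 * ((2 : ℝ) / 3) * (ω ^ 3 * a) * (1 / (ω * r)) = ω ^ 2 * a / r := by field_simp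
      have e2 : 2 * (ω ^ 2 * a / τ2) = ω ^ 2 * a / (τ2 / 2) := by field_simp
      rw [e, e2]; gcongr; rw [hτ2]; nlinarith)
    (fun t ht => by
      obtain ⟨r, q, hr0, hq0, hr1, hr2, hq, ht', v1, v2, w0, w1, w2⟩ := hval t ht
      rw [v2, hRd]
      have e : |3 / 2 * ((2 : ℝ) / 3) * (ω ^ 3 * a) * ((2 : ℝ) / 3 - 1) * (ω ^ 3 * a) *
          (1 / (ω * r) ^ 4)| = 1 / 3 * (ω ^ 2 * a ^ 2 / r ^ 4) := by
        rw [← abs_neg, abs_of_nonneg]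
        · field_simp; norm_num
        · have e : -(3 / 2 * ((2 : ℝ) / 3) * (ω ^ 3 * a) * ((2 : ℝ) / 3 - 1) * (ω ^ 3 * a) *
            (1 / (ω * r) ^ 4)) = 1 / 3 * (ω ^ 3 * a) ^ 2 * (1 / (ω * r) ^ 4) := by ring
          rw [e]; positivity
      have e3 : 1 / 3 * (ω ^ 2 * a ^ 2 / r ^ 4) * (r ^ 3 / a) = ω ^ 2 * a / (3 * r) := by
        field_simp
      have e2 : 2 * (ω ^ 2 * a / τ2) = ω ^ 2 * a / (τ2 / 2) := by field_simp
      rw [e, ht', e3, e2]; gcongr; rw [hτ2]; nlinarith)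
    (fun t ht => by
      obtain ⟨r, q, hr0, hq0, hr1, hr2, hq, ht', v1, v2, w0, w1, w2⟩ := hval t ht
      rw [w0, one_mul, abs_of_pos hq0]; exact hq)
    (fun t ht => by
      obtain ⟨r, q, hr0, hq0, hr1, hr2, hq, ht', v1, v2, w0, w1, w2⟩ := hval t ht
      have e : |1 * (-(1 : ℝ) / 6) * a * (q / r ^ 3)| * (r ^ 3 / a) = q / 6 := by
        rw [show 1 * (-(1 : ℝ) / 6) * a * (q / r ^ 3) = -(1 / 6 * a * (q / r ^ 3)) by ring, abs_neg,
          abs_of_nonneg (by positivity)]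
        field_simp
      rw [w1, ht', e]; linarith)
    (fun t ht => by
      obtain ⟨r, q, hr0, hq0, hr1, hr2, hq, ht', v1, v2, w0, w1, w2⟩ := hval t ht
      have e : |1 * (-(1 : ℝ) / 6) * a * (-(1 : ℝ) / 6 - 1) * a * (q / r ^ 6)| * (r ^ 3 / a) ^ 2 =
          7 / 36 * q := by
        rw [show 1 * (-(1 : ℝ) / 6) * a * (-(1 : ℝ) / 6 - 1) * a * (q / r ^ 6) =
          7 / 36 * a ^ 2 * (q / r ^ 6) by ring, abs_of_nonneg (by positivity)]
        field_simp
      rw [w2, ht', e]; linarith)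
  have hW : ∀ m ∈ Finset.Icc ⌈R / 2⌉₊ ⌊4 * R⌋₊,
      ‖(∫ t in τ1 ^ 3 / a..τ2 ^ 3 / a, ((1 * (a * t) ^ (-(1 : ℝ) / 6) : ℝ) : ℂ) *
        ee (3 / 2 * (ω ^ 3 * a * t) ^ ((2 : ℝ) / 3) - m * t)) -
        starRingEnd ℂ (if Stationary ω ρ a m then fresnel * mainTerm ω a m else 0)‖ ≤
      C / ρ * (1 / ((m : ℝ) ^ 2 / (ω ^ 3 * a) + |m - ω ^ 2 * a / τ1|) +
        1 / ((m : ℝ) ^ 2 / (ω ^ 3 * a) + |m - ω ^ 2 * a / τ2|)) := by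
    intro m hm
    have hm1 : 1 ≤ m := (Nat.one_le_ceil_iff.2 (by positivity)).trans (Finset.mem_Icc.1 hm).1
    have hm1' : (1 : ℝ) ≤ m := by exact_mod_cast hm1
    have hm0 : (0 : ℝ) < m := by linarith
    have hl : R / 2 ≤ m := Nat.ceil_le.1 (Finset.mem_Icc.1 hm).1
    have hu : (m : ℝ) ≤ 4 * R := (Nat.le_floor_iff (by positivity)).1 (Finset.mem_Icc.1 hm).2
    set x := ω ^ 2 * a / m with hx
    have hx0 : 0 < x := by positivity
    have hRτ : R * τ2 = ω ^ 2 * a := by rw [hRd]; field_simp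
    have hxm : x * m = ω ^ 2 * a := by rw [hx]; field_simp
    have hρτ1 : ρ ^ 2 ≤ τ1 := le_max_left _ _
    have hx1 : x ≤ 4 * τ1 := by
      have : x ≤ 2 * τ2 := by
        rw [hx, div_le_iff₀ hm0, ← hRτ]; nlinarith
      rw [hτ2] at this; nlinarith
    have hx2 : τ2 ≤ 4 * x := by
      have : τ2 * m ≤ 4 * x * m := by nlinarith
      exact le_of_mul_le_mul_right this hm0
    have hβ1 : a ≤ τ2 ^ 3 := by
      have := (one_le_div ha).1 (hα1.trans hαβ); linarith
    have hP : 1 / 64 ≤ ω ^ 6 * a ^ 2 / (m : ℝ) ^ 2 := by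
      have e : ω ^ 6 * a ^ 2 / (m : ℝ) ^ 2 = x ^ 3 / a * m := by rw [hx]; field_simp
      have h5 : τ2 ^ 3 ≤ (4 * x) ^ 3 := by gcongr
      have h6 : 1 / 64 ≤ x ^ 3 / a := by
        rw [le_div_iff₀ ha]; nlinarith
      rw [e]; nlinarith
    have hcond : (τ1 ≤ x ∧ x ≤ τ2) ↔ Stationary ω ρ a m := by
      have h7 : τ1 ≤ x ↔ ρ ^ 2 ≤ x ∧ s ^ 2 ≤ x := by rw [hτ1, max_le_iff]
      have h8 : ρ ^ 2 ≤ x ↔ ρ ^ 2 * m ≤ ω ^ 2 * a := by rw [hx, le_div_iff₀ hm0]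
      have h9 : x ≤ τ2 ↔ ω ^ 2 * a ≤ √2 * (ρ ^ 2 * m) := by
        rw [hx, div_le_iff₀ hm0, hτ2, mul_assoc]
      have h10 : s ^ 2 ≤ x ↔ (m : ℝ) ^ 3 ≤ ω ^ 6 * a := by
        rw [hx, le_div_iff₀ hm0, ← hs3]
        have e1 : s ^ 2 * m ≤ ω ^ 2 * s ^ 3 ↔ (m : ℝ) ≤ ω ^ 2 * s := by
          rw [show ω ^ 2 * s ^ 3 = s ^ 2 * (ω ^ 2 * s) by ring]
          exact mul_le_mul_iff_right₀ (by positivity)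
        rw [e1, show ω ^ 6 * s ^ 3 = (ω ^ 2 * s) ^ 3 by ring]
        exact (pow_le_pow_iff_left₀ hm0.le (by positivity) (by norm_num)).symm
      rw [h7, h8, h9, h10, Stationary]; tauto
    have h4 := h ω ρ a m τ1 τ2 hω hρ ha hm0 hP hρτ1 hτ12 hx1 hx2
    simp only [← hx, hcond] at h4
    refine le_trans (le_of_eq ?_) h4
    rw [← Complex.norm_conj, map_sub, Complex.conj_conj]
    congr 2
    rw [← integral_mul_ee_neg]
    refine intervalIntegral.integral_congr fun t _ => ?_
    simp only [one_mul, neg_sub, mul_assoc]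
  have htri : ∀ (X Y Z : ℂ) (p q : ℝ), ‖X - Y‖ ≤ p → ‖Y - Z‖ ≤ q → ‖X - Z‖ ≤ p + q :=
    fun X Y Z p q h1 h2 => by
      have := norm_add_le (X - Y) (Y - Z)
      rw [sub_add_sub_cancel] at this; linarith
  have hsumW := norm_sum_le_of_le _ hW
  rw [Finset.sum_sub_distrib, ← Finset.mul_sum] at hsumW
  have hsum := htri _ _ _ _ _ hP3 hsumW
  simp only [one_mul, mul_assoc] at hsum ⊢
  refine hsum.trans ?_
  have hnn : 0 ≤ ∑ m ∈ Finset.Icc ⌈R / 2⌉₊ ⌊4 * R⌋₊,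
      (1 / ((m : ℝ) ^ 2 / (ω ^ 3 * a) + |m - ω ^ 2 * a / τ1|) +
        1 / ((m : ℝ) ^ 2 / (ω ^ 3 * a) + |m - ω ^ 2 * a / τ2|)) :=
    Finset.sum_nonneg fun m _ => by positivity
  set X := ∑ m ∈ Finset.Icc ⌈R / 2⌉₊ ⌊4 * R⌋₊,
      (1 / ((m : ℝ) ^ 2 / (ω ^ 3 * a) + |m - ω ^ 2 * a / τ1|) +
        1 / ((m : ℝ) ^ 2 / (ω ^ 3 * a) + |m - ω ^ 2 * a / τ2|))
  have hl0 : 0 ≤ Real.log (2 + R) := Real.log_nonneg (by linarith)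
  have hY : 0 ≤ 1 + 1 / R + Real.log (2 + R) := by positivity
  rw [show C / ρ = C * (1 / ρ) by ring, show (C + 200) / ρ = (C + 200) * (1 / ρ) by ring]
  have hρi : 0 < 1 / ρ := by positivity
  nlinarith [mul_nonneg (mul_nonneg hC.le hρi.le) hY, mul_nonneg hρi.le hnn]

set_option maxHeartbeats 2000000 in
open Classical in
lemma exists_norm_sum_sqrt_sub_le : ∃ C : ℝ, 0 < C ∧ ∀ ω ρ m : ℝ, 0 < ω → 0 < ρ → 1 ≤ m →
    m ^ 2 ≤ √2 * (ω ^ 4 * ρ ^ 2) →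
    ‖((√3 / ω ^ 4 : ℝ) : ℂ) *
        ∑ c ∈ Finset.Ioc ⌊max m (ω ^ 4 * ρ ^ 2 / m)⌋₊ ⌊√2 * (ω ^ 4 * ρ ^ 2) / m⌋₊,
          (√(m * c) : ℂ) * ee ((m * c) ^ 2 / (2 * ω ^ 6)) -
      ∑ a ∈ Finset.Icc ⌈m * ρ ^ 2 / ω ^ 2 / 2⌉₊ ⌊4 * (m * ρ ^ 2 / ω ^ 2)⌋₊,
        (if Stationary ω ρ a m then fresnel * mainTerm ω a m else 0)‖ ≤
    C * ρ / ω ^ 2 * (1 + 1 / (m * ρ ^ 2 / ω ^ 2) + Real.log (2 + m * ρ ^ 2 / ω ^ 2) +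
      ∑ a ∈ Finset.Icc ⌈m * ρ ^ 2 / ω ^ 2 / 2⌉₊ ⌊4 * (m * ρ ^ 2 / ω ^ 2)⌋₊,
        (1 / (m / ω ^ 3 + |(a : ℝ) - m ^ 2 * max m (ω ^ 4 * ρ ^ 2 / m) / ω ^ 6|) +
          1 / (m / ω ^ 3 + |(a : ℝ) - m ^ 2 * (√2 * (ω ^ 4 * ρ ^ 2) / m) / ω ^ 6|))) := by
  obtain ⟨C, hC, h⟩ := exists_norm_integral_sub_mainTerm_le'
  refine ⟨2 * C + 400 * √3, by positivity, ?_⟩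
  intro ω ρ m hω hρ hm1 hm2
  obtain ⟨h2l, h2u⟩ := sqrt_two_bounds
  have hm : 0 < m := by linarith
  set R := m * ρ ^ 2 / ω ^ 2 with hRd
  have hR : 0 < R := by positivity
  set M := ω ^ 4 * ρ ^ 2 with hM
  have hM0 : 0 < M := by positivity
  have hRM : R = m * M / ω ^ 6 := by rw [hRd, hM]; field_simp
  set γ1 := max m (M / m) with hγ1
  set γ2 := √2 * M / m with hγ2
  have hγ1' : 1 ≤ γ1 := le_max_of_le_left hm1
  have hγ12 : γ1 ≤ γ2 := by
    refine max_le ?_ ?_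
    · rw [hγ2, le_div_iff₀ hm]; linarith
    · rw [hγ2]; gcongr; nlinarith
  have hγ2' : γ2 ≤ √2 * γ1 := by
    have : M / m ≤ γ1 := le_max_right _ _
    calc γ2 = √2 * (M / m) := by rw [hγ2]; ring
      _ ≤ _ := by gcongr
  have hkey : ∀ t ∈ Set.Icc γ1 γ2, 0 < t ∧ M ≤ m * t ∧ m * t ≤ √2 * M := by
    intro t ht
    refine ⟨by linarith [ht.1], ?_, ?_⟩
    · have := (le_max_right m (M / m)).trans ht.1
      rw [div_le_iff₀ hm] at this; linarith
    · have := ht.2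
      rw [hγ2, le_div_iff₀ hm] at this; linarith
  have hval : ∀ t ∈ Set.Icc γ1 γ2, ∃ q : ℝ, 0 < q ∧ q ≤ 2 * ω ^ 2 * ρ ∧
      (m * t) ^ ((1 : ℝ) / 2) = q ∧ (m * t) ^ ((1 : ℝ) / 2 - 1) = q / (m * t) ∧
      (m * t) ^ ((1 : ℝ) / 2 - 1 - 1) = q / (m * t) / (m * t) := by
    intro t ht
    obtain ⟨h1, h2, h3⟩ := hkey t ht
    have h0 : m * t ≠ 0 := by positivity
    refine ⟨√(m * t), by positivity, ?_, (Real.sqrt_eq_rpow _).symm, ?_, ?_⟩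
    · refine Real.sqrt_le_iff.2 ⟨by positivity, ?_⟩
      have : (2 * ω ^ 2 * ρ) ^ 2 = 4 * M := by rw [hM]; ring
      rw [this]; nlinarith
    · rw [Real.rpow_sub_one h0, ← Real.sqrt_eq_rpow]
    · rw [Real.rpow_sub_one h0, Real.rpow_sub_one h0, ← Real.sqrt_eq_rpow]
  have hP3 := norm_sum_sub_sum_integral_le
    (f := fun t => (m * t) ^ 2 / (2 * ω ^ 6))
    (f1 := fun t => m ^ 2 * t / ω ^ 6)
    (f2 := fun _ => m ^ 2 / ω ^ 6)
    (g := fun t => 1 * (m * t) ^ ((1 : ℝ) / 2))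
    (g1 := fun t => 1 * ((1 : ℝ) / 2) * m * (m * t) ^ ((1 : ℝ) / 2 - 1))
    (g2 := fun t => 1 * ((1 : ℝ) / 2) * m * ((1 : ℝ) / 2 - 1) * m *
      (m * t) ^ ((1 : ℝ) / 2 - 1 - 1))
    (α := γ1) (β := γ2) (R := R) (G := 2 * ω ^ 2 * ρ) hγ1' hγ12
    (by nlinarith) hR
    (fun t ht => by
      have h1 := ((((hasDerivAt_id t).const_mul m).pow 2).div_const (2 * ω ^ 6))
      refine h1.congr_deriv ?_
      simp only [id]; field_simp; norm_num; ring)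
    (fun t ht => by
      have h1 := ((hasDerivAt_id t).const_mul (m ^ 2)).div_const (ω ^ 6)
      exact h1.congr_deriv (by simp))
    (fun t ht => hasDerivAt_const_mul_rpow (mul_pos hm (hkey t ht).1))
    (fun t ht => hasDerivAt_const_mul_rpow (mul_pos hm (hkey t ht).1))
    continuousOn_const
    (by
      refine ContinuousOn.mul continuousOn_const ?_
      exact ContinuousOn.rpow_const (by fun_prop)
        fun t ht => Or.inl (mul_pos hm (hkey t ht).1).ne')
    (Or.inl fun t ht => by positivity)
    (fun t ht => by
      obtain ⟨h1, h2, h3⟩ := hkey t ht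
      rw [hRM, show m ^ 2 * t = m * (m * t) by ring]; gcongr)
    (fun t ht => by
      obtain ⟨h1, h2, h3⟩ := hkey t ht
      have e : 2 * (m * M / ω ^ 6) = m * (2 * M) / ω ^ 6 := by ring
      rw [hRM, e, show m ^ 2 * t = m * (m * t) by ring]
      refine div_le_div_of_nonneg_right
        (mul_le_mul_of_nonneg_left ?_ hm.le) (by positivity)
      nlinarith)
    (fun t ht => by
      obtain ⟨h1, h2, h3⟩ := hkey t ht
      have e : 2 * (m * M / ω ^ 6) = m * (2 * M) / ω ^ 6 := by ring
      rw [abs_of_nonneg (by positivity), hRM, e, div_mul_eq_mul_div,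
        show m ^ 2 * t = m * (m * t) by ring]
      refine div_le_div_of_nonneg_right
        (mul_le_mul_of_nonneg_left ?_ hm.le) (by positivity)
      nlinarith)
    (fun t ht => by
      obtain ⟨q, hq0, hq, w0, w1, w2⟩ := hval t ht
      rw [w0, one_mul, abs_of_pos hq0]; exact hq)
    (fun t ht => by
      obtain ⟨q, hq0, hq, w0, w1, w2⟩ := hval t ht
      have ht0 := (hkey t ht).1
      rw [w1, abs_of_nonneg (by positivity)]
      have e : 1 * ((1 : ℝ) / 2) * m * (q / (m * t)) * t = q / 2 := by field_simp
      rw [e]; linarith)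
    (fun t ht => by
      obtain ⟨q, hq0, hq, w0, w1, w2⟩ := hval t ht
      have ht0 := (hkey t ht).1
      rw [w2, show 1 * ((1 : ℝ) / 2) * m * ((1 : ℝ) / 2 - 1) * m * (q / (m * t) / (m * t)) =
        -(1 / 4 * m ^ 2 * (q / (m * t) / (m * t))) by ring, abs_neg, abs_of_nonneg (by positivity)]
      have e : 1 / 4 * m ^ 2 * (q / (m * t) / (m * t)) * t ^ 2 = q / 4 := by field_simp
      rw [e]; linarith)
  have hW : ∀ a ∈ Finset.Icc ⌈R / 2⌉₊ ⌊4 * R⌋₊,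
      ‖((√3 / ω ^ 4 : ℝ) : ℂ) * (∫ t in γ1..γ2, ((1 * (m * t) ^ ((1 : ℝ) / 2) : ℝ) : ℂ) *
        ee ((m * t) ^ 2 / (2 * ω ^ 6) - a * t)) -
        (if Stationary ω ρ a m then fresnel * mainTerm ω a m else 0)‖ ≤
      C * (2 * ω ^ 2 * ρ) / ω ^ 4 * (1 / (m / ω ^ 3 + |(a : ℝ) - m ^ 2 * γ1 / ω ^ 6|) +
        1 / (m / ω ^ 3 + |(a : ℝ) - m ^ 2 * γ2 / ω ^ 6|)) := by
    intro a ha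
    have ha1 : 1 ≤ a := (Nat.one_le_ceil_iff.2 (by positivity)).trans (Finset.mem_Icc.1 ha).1
    have ha1' : (1 : ℝ) ≤ a := by exact_mod_cast ha1
    have ha0 : (0 : ℝ) < a := by linarith
    have hl : R / 2 ≤ a := Nat.ceil_le.1 (Finset.mem_Icc.1 ha).1
    have hu : (a : ℝ) ≤ 4 * R := (Nat.le_floor_iff (by positivity)).1 (Finset.mem_Icc.1 ha).2
    set x := a * ω ^ 6 / m ^ 2 with hx
    have hx0 : 0 < x := by positivity
    have hRx : R * ω ^ 6 / m ^ 2 = M / m := by rw [hRM]; field_simp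
    have hMγ : M / m ≤ γ1 := le_max_right _ _
    have hx1 : x ≤ 4 * γ1 := by
      calc x ≤ 4 * R * ω ^ 6 / m ^ 2 := by rw [hx]; gcongr
        _ = 4 * (M / m) := by rw [← hRx]; ring
        _ ≤ _ := by linarith
    have hx2' : M / m ≤ 2 * x := by
      have : R * ω ^ 6 / m ^ 2 ≤ 2 * a * ω ^ 6 / m ^ 2 := by gcongr; linarith
      calc M / m ≤ 2 * a * ω ^ 6 / m ^ 2 := by rw [← hRx]; exact this
        _ = 2 * x := by rw [hx]; ring
    have hMm : 0 < M / m := by positivity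
    have hx2 : γ2 ≤ 4 * x := by
      have e : γ2 = √2 * (M / m) := by rw [hγ2]; ring
      rw [e]; nlinarith
    have hP : 1 / 64 ≤ ω ^ 6 * (a : ℝ) ^ 2 / m ^ 2 := by
      have e : ω ^ 6 * (a : ℝ) ^ 2 / m ^ 2 = x * a := by rw [hx]; ring
      rw [e]; nlinarith
    have hB : m * γ2 ≤ (2 * ω ^ 2 * ρ) ^ 2 := by
      have e : m * γ2 = √2 * M := by rw [hγ2]; field_simp
      have : (2 * ω ^ 2 * ρ) ^ 2 = 4 * M := by rw [hM]; ring
      rw [e, this]; nlinarith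
    have hcond : (γ1 ≤ x ∧ x ≤ γ2) ↔ Stationary ω ρ a m := by
      have h7 : γ1 ≤ x ↔ m ≤ x ∧ M / m ≤ x := by rw [hγ1, max_le_iff]
      have h8 : m ≤ x ↔ m ^ 3 ≤ ω ^ 6 * a := by
        rw [hx, le_div_iff₀ (by positivity), show m * m ^ 2 = m ^ 3 by ring, mul_comm (a : ℝ)]
      have e : x = ω ^ 4 / m ^ 2 * (ω ^ 2 * a) := by rw [hx]; ring
      have hpos : 0 < ω ^ 4 / m ^ 2 := by positivity
      have h9 : M / m ≤ x ↔ ρ ^ 2 * m ≤ ω ^ 2 * a := by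
        have e' : M / m = ω ^ 4 / m ^ 2 * (ρ ^ 2 * m) := by rw [hM]; field_simp
        rw [e, e']; exact mul_le_mul_iff_right₀ hpos
      have h10 : x ≤ γ2 ↔ ω ^ 2 * a ≤ √2 * (ρ ^ 2 * m) := by
        have e' : γ2 = ω ^ 4 / m ^ 2 * (√2 * (ρ ^ 2 * m)) := by rw [hγ2, hM]; field_simp
        rw [e, e']; exact mul_le_mul_iff_right₀ hpos
      rw [h7, h8, h9, h10, Stationary]; tauto
    have h4 := h ω (2 * ω ^ 2 * ρ) a m γ1 γ2 hω (by positivity) ha0 hm hP (by linarith) hγ12 hB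
      hx1 hx2
    simp only [← hx, hcond] at h4
    simp only [one_mul, ← Real.sqrt_eq_rpow]
    exact h4
  have hsumW := norm_sum_le_of_le _ hW
  rw [Finset.sum_sub_distrib, ← Finset.mul_sum, ← Finset.mul_sum] at hsumW
  have h3 := mul_le_mul_of_nonneg_left hP3 (show (0 : ℝ) ≤ √3 / ω ^ 4 by positivity)
  rw [← Real.norm_of_nonneg (show (0 : ℝ) ≤ √3 / ω ^ 4 by positivity), ← Complex.norm_real,
    ← norm_mul, Complex.norm_real, Real.norm_of_nonneg (show (0 : ℝ) ≤ √3 / ω ^ 4 by positivity),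
    mul_sub] at h3
  have hsum := (norm_add_le _ _).trans (add_le_add h3 hsumW)
  rw [sub_add_sub_cancel] at hsum
  simp only [one_mul, ← Real.sqrt_eq_rpow] at hsum
  refine hsum.trans ?_
  have hnn : 0 ≤ ∑ a ∈ Finset.Icc ⌈R / 2⌉₊ ⌊4 * R⌋₊,
      (1 / (m / ω ^ 3 + |(a : ℝ) - m ^ 2 * γ1 / ω ^ 6|) +
        1 / (m / ω ^ 3 + |(a : ℝ) - m ^ 2 * γ2 / ω ^ 6|)) :=
    Finset.sum_nonneg fun a _ => by positivity
  set X := ∑ a ∈ Finset.Icc ⌈R / 2⌉₊ ⌊4 * R⌋₊,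
      (1 / (m / ω ^ 3 + |(a : ℝ) - m ^ 2 * γ1 / ω ^ 6|) +
        1 / (m / ω ^ 3 + |(a : ℝ) - m ^ 2 * γ2 / ω ^ 6|))
  have hl0 : 0 ≤ Real.log (2 + R) := Real.log_nonneg (by linarith)
  have hY : 0 ≤ 1 + 1 / R + Real.log (2 + R) := by positivity
  have hρi : 0 < ρ / ω ^ 2 := by positivity
  have e1 : √3 / ω ^ 4 * (200 * (2 * ω ^ 2 * ρ) * (1 + 1 / R + Real.log (2 + R))) =
      400 * √3 * (ρ / ω ^ 2 * (1 + 1 / R + Real.log (2 + R))) := by field_simp; norm_num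
  have e2 : C * (2 * ω ^ 2 * ρ) / ω ^ 4 * X = 2 * C * (ρ / ω ^ 2 * X) := by field_simp
  have e3 : (2 * C + 400 * √3) * ρ / ω ^ 2 * (1 + 1 / R + Real.log (2 + R) + X) =
      2 * C * (ρ / ω ^ 2 * X) + 400 * √3 * (ρ / ω ^ 2 * (1 + 1 / R + Real.log (2 + R))) +
      2 * C * (ρ / ω ^ 2 * (1 + 1 / R + Real.log (2 + R))) + 400 * √3 * (ρ / ω ^ 2 * X) := by ring
  rw [e1, e2, e3]
  have e4 : 0 ≤ 2 * C * (ρ / ω ^ 2 * (1 + 1 / R + Real.log (2 + R))) := by positivity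
  have e5 : 0 ≤ 400 * √3 * (ρ / ω ^ 2 * X) := by positivity
  linarith

lemma sum_Icc_one_div_nat_le {P Q : ℕ} (hP : 1 ≤ P) (hPQ : P ≤ Q) :
    ∑ m ∈ Finset.Icc P Q, (1 : ℝ) / m ≤ 1 / P + Real.log (Q / P) := by
  induction Q, hPQ using Nat.le_induction with
  | base =>
    have : (P : ℝ) ≠ 0 := by positivity
    simp [this]
  | succ Q hPQ ih =>
    have hP0 : (0 : ℝ) < P := by exact_mod_cast hP
    have hQ0 : (0 : ℝ) < Q := by exact_mod_cast hP.trans hPQ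
    rw [Finset.sum_Icc_succ_top (by omega)]
    have h := Real.one_sub_inv_le_log_of_pos (x := ((Q : ℝ) + 1) / Q) (by positivity)
    have e : 1 - (((Q : ℝ) + 1) / Q)⁻¹ = 1 / (Q + 1) := by field_simp; ring
    rw [e] at h
    have e2 : Real.log ((Q + 1 : ℕ) / P) = Real.log (Q / P) + Real.log (((Q : ℝ) + 1) / Q) := by
      rw [← Real.log_mul (by positivity) (by positivity)]
      congr 1; push_cast; field_simp
    rw [e2]; push_cast; linarith

lemma sum_Icc_one_div_le {p q : ℝ} (hp : 0 < p) (hpq : p ≤ q) :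
    ∑ m ∈ Finset.Icc ⌈p⌉₊ ⌊q⌋₊, (1 : ℝ) / m ≤ 1 + Real.log (q / p) := by
  have hlog : 0 ≤ Real.log (q / p) := Real.log_nonneg (by rwa [one_le_div hp])
  rcases le_or_gt ⌈p⌉₊ ⌊q⌋₊ with h | h
  · have hP1 : 1 ≤ ⌈p⌉₊ := Nat.one_le_ceil_iff.2 hp
    have hP1' : (1 : ℝ) ≤ ⌈p⌉₊ := by exact_mod_cast hP1
    refine (sum_Icc_one_div_nat_le hP1 h).trans (add_le_add ?_ ?_)
    · rw [div_le_one (by linarith)]; exact hP1'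
    · have hQ : (0 : ℝ) < ⌊q⌋₊ := by exact_mod_cast hP1.trans h
      refine Real.log_le_log (by positivity) ?_
      gcongr
      · exact hp.le.trans hpq
      · exact Nat.floor_le (hp.le.trans hpq)
      · exact Nat.le_ceil p
  · rw [Finset.Icc_eq_empty (by omega)]; simp; linarith

lemma sum_one_div_dist_le {K n0 : ℕ} (hK : 1 ≤ K) (hn0 : n0 ∈ Finset.Icc 1 K) :
    ∑ n ∈ (Finset.Icc 1 K).erase n0, 1 / |(n : ℝ) - n0| ≤ 2 * (1 + Real.log K) := by
  have hH : ∑ k ∈ Finset.Icc 1 K, (1 : ℝ) / k ≤ 1 + Real.log K := by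
    simpa using sum_Icc_one_div_nat_le le_rfl hK
  have key : ∀ (F : Finset ℕ) (e : ℕ → ℕ), Set.InjOn e F → (∀ n ∈ F, e n ∈ Finset.Icc 1 K) →
      (∀ n ∈ F, |(n : ℝ) - n0| = e n) → ∑ n ∈ F, 1 / |(n : ℝ) - n0| ≤ 1 + Real.log K := by
    intro F e he hm hv
    refine le_trans ?_ hH
    calc ∑ n ∈ F, 1 / |(n : ℝ) - n0| = ∑ n ∈ F, (1 : ℝ) / e n :=
          Finset.sum_congr rfl fun n hn => by rw [hv n hn]
      _ = ∑ k ∈ F.image e, (1 : ℝ) / k :=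
          (Finset.sum_image (f := fun k : ℕ => (1 : ℝ) / k) he).symm
      _ ≤ _ := Finset.sum_le_sum_of_subset_of_nonneg
        (Finset.image_subset_iff.2 hm) fun _ _ _ => by positivity
  rw [Finset.mem_Icc] at hn0
  rw [← Finset.sum_filter_add_sum_filter_not _ (fun n => n < n0), two_mul]
  refine add_le_add (key _ (fun n => n0 - n) ?_ ?_ ?_) (key _ (fun n => n - n0) ?_ ?_ ?_)
  · intro i hi j hj hij
    simp only [Finset.coe_filter, Set.mem_ofPred_eq] at hi hj hij
    omega
  · intro n hn
    simp only [Finset.mem_filter, Finset.mem_erase, Finset.mem_Icc] at hn ⊢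
    omega
  · intro n hn
    simp only [Finset.mem_filter] at hn
    have : (n : ℝ) < n0 := by exact_mod_cast hn.2
    rw [abs_of_neg (by linarith), Nat.cast_sub hn.2.le]; ring
  · intro i hi j hj hij
    simp only [Finset.coe_filter, Set.mem_ofPred_eq] at hi hj hij
    omega
  · intro n hn
    simp only [Finset.mem_filter, Finset.mem_erase, Finset.mem_Icc] at hn ⊢
    omega
  · intro n hn
    simp only [Finset.mem_filter, not_lt] at hn
    have : (n0 : ℝ) ≤ n := by exact_mod_cast hn.2
    rw [abs_of_nonneg (by linarith), Nat.cast_sub hn.2]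

lemma sum_one_div_add_abs_le {K : ℕ} (hK : 1 ≤ K) {W : Finset ℕ} (hW : W ⊆ Finset.Icc 1 K)
    {z : ℕ → ℝ} {s w y : ℝ} (hs : 0 < s) (hw : 0 < w)
    (hz : ∀ i ∈ W, ∀ j ∈ W, s * |(i : ℝ) - j| ≤ |z i - z j|) :
    ∑ n ∈ W, 1 / (w + |z n - y|) ≤ 1 / w + 4 / s * (1 + Real.log K) := by
  have hl : 0 ≤ Real.log K := Real.log_nonneg (by exact_mod_cast hK)
  rcases W.eq_empty_or_nonempty with rfl | hne
  · simp only [Finset.sum_empty]; positivity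
  obtain ⟨n0, hn0, hmin⟩ := Finset.exists_min_image W (fun n => |z n - y|) hne
  rw [← Finset.add_sum_erase W _ hn0]
  refine add_le_add ?_ ?_
  · gcongr; linarith [abs_nonneg (z n0 - y)]
  · calc ∑ n ∈ W.erase n0, 1 / (w + |z n - y|) ≤
        ∑ n ∈ W.erase n0, 2 / s * (1 / |(n : ℝ) - n0|) := Finset.sum_le_sum fun n hn => by
          have hn' := Finset.mem_erase.1 hn
          have h1 := hz n hn'.2 n0 hn0
          have h2 := hmin n hn'.2
          have h3 : |z n - z n0| ≤ |z n - y| + |z n0 - y| := by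
            have := abs_sub_le (z n) y (z n0)
            rwa [abs_sub_comm y] at this
          have h4 : 0 < |(n : ℝ) - n0| := by
            rw [abs_pos, sub_ne_zero]; exact_mod_cast hn'.1
          rw [show 2 / s * (1 / |(n : ℝ) - n0|) = 1 / (s * |(n : ℝ) - n0| / 2) by field_simp]
          gcongr
          linarith
      _ ≤ ∑ n ∈ (Finset.Icc 1 K).erase n0, 2 / s * (1 / |(n : ℝ) - n0|) :=
          Finset.sum_le_sum_of_subset_of_nonneg (Finset.erase_subset_erase _ hW)
            fun _ _ _ => by positivity
      _ = 2 / s * ∑ n ∈ (Finset.Icc 1 K).erase n0, 1 / |(n : ℝ) - n0| := by rw [Finset.mul_sum]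
      _ ≤ 2 / s * (2 * (1 + Real.log K)) := by
          gcongr; exact sum_one_div_dist_le hK (hW hn0)
      _ = _ := by ring

lemma one_le_two_mul_log {ρ : ℝ} (hρ : 2 ≤ ρ) : 1 ≤ 2 * Real.log ρ := by
  have h1 := Real.log_two_gt_d9
  have h2 := Real.log_le_log (by norm_num) hρ
  linarith

lemma log_le_mul_log_of_le {ρ x : ℝ} (k : ℕ) (hx : 0 < x) (hxρ : x ≤ ρ ^ k) :
    Real.log x ≤ k * Real.log ρ := by
  rw [← Real.log_pow]; exact Real.log_le_log hx hxρ

lemma log_one_add_sq_le {x : ℝ} (hx : 0 ≤ x) : Real.log (1 + x ^ 2) ≤ 2 * x := by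
  have h1 : Real.log (1 + x ^ 2) ≤ Real.log ((1 + x) ^ 2) :=
    Real.log_le_log (by positivity) (by nlinarith)
  rw [Real.log_pow] at h1
  have h2 := Real.log_le_sub_one_of_pos (x := 1 + x) (by positivity)
  push_cast at h1
  linarith

lemma log_two_add_le {ω ρ R : ℝ} (hω : 0 < ω) (hρ : 2 ≤ ρ) (hR0 : 0 ≤ R)
    (hR : R ≤ 2 * (ω ^ 2 * ρ)) : Real.log (2 + R) ≤ 4 * Real.log ρ + 2 * (ω / ρ) := by
  have hρ0 : 0 < ρ := by linarith
  have h1 : 2 + R ≤ ρ ^ 4 * (1 + (ω / ρ) ^ 2) := by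
    have e : ρ ^ 4 * (1 + (ω / ρ) ^ 2) = ρ ^ 4 + ρ * ρ * ω ^ 2 := by field_simp
    have h2 : (2 : ℝ) ^ 4 ≤ ρ ^ 4 := by gcongr
    have h3 : 2 * ρ * ω ^ 2 ≤ ρ * ρ * ω ^ 2 := by gcongr
    rw [e]; linarith
  have h2 := Real.log_le_log (by linarith) h1
  rw [Real.log_mul (by positivity) (by positivity), Real.log_pow] at h2
  have := log_one_add_sq_le (x := ω / ρ) (by positivity)
  push_cast at h2; linarith

lemma abs_rpow_third_sub_ge {ρ a b : ℝ} (hρ : 0 < ρ) (ha : 0 ≤ a) (hab : a ≤ b)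
    (hb : b ^ 2 ≤ 2 * √2 * ρ ^ 6) :
    (b - a) / (5 * ρ ^ 2) ≤ b ^ ((1 : ℝ) / 3) - a ^ ((1 : ℝ) / 3) := by
  have hb0 : 0 ≤ b := ha.trans hab
  set s := a ^ ((1 : ℝ) / 3) with hs
  set t := b ^ ((1 : ℝ) / 3) with ht
  have hs3 : s ^ 3 = a := rpow_third_pow ha
  have ht3 : t ^ 3 = b := rpow_third_pow hb0
  have hs0 : 0 ≤ s := by positivity
  have ht0 : 0 ≤ t := by positivity
  have hst : s ≤ t := by rw [hs, ht]; gcongr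
  have htρ : t ^ 2 ≤ √2 * ρ ^ 2 := by
    refine le_of_pow_le_pow_left₀ (n := 3) (by norm_num) (by positivity) ?_
    rw [mul_pow, sqrt_two_pow_three]
    calc (t ^ 2) ^ 3 = b ^ 2 := by rw [← ht3]; ring
      _ ≤ _ := by linarith
  obtain ⟨h2l, h2u⟩ := sqrt_two_bounds
  rw [div_le_iff₀ (by positivity), ← hs3, ← ht3]
  have e : t ^ 3 - s ^ 3 = (t - s) * (t ^ 2 + t * s + s ^ 2) := by ring
  rw [e]
  refine mul_le_mul_of_nonneg_left ?_ (by linarith)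
  have hρ2 : 0 < ρ ^ 2 := by positivity
  nlinarith

lemma abs_min_sub_ge {ω ρ a b : ℝ} (hω : 0 < ω) (hρ : 0 < ρ) (ha : 0 ≤ a) (hb : 0 ≤ b)
    (ha2 : a ^ 2 ≤ 2 * √2 * ρ ^ 6) (hb2 : b ^ 2 ≤ 2 * √2 * ρ ^ 6) :
    ω ^ 2 / ρ ^ 2 / 5 * |a - b| ≤ |min (ω ^ 2 * a / ρ ^ 2) (ω ^ 2 * a ^ ((1 : ℝ) / 3)) -
      min (ω ^ 2 * b / ρ ^ 2) (ω ^ 2 * b ^ ((1 : ℝ) / 3))| := by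
  have key : ∀ a b : ℝ, 0 ≤ a → a ≤ b → b ^ 2 ≤ 2 * √2 * ρ ^ 6 → ω ^ 2 / ρ ^ 2 / 5 * (b - a) ≤
      min (ω ^ 2 * b / ρ ^ 2) (ω ^ 2 * b ^ ((1 : ℝ) / 3)) -
      min (ω ^ 2 * a / ρ ^ 2) (ω ^ 2 * a ^ ((1 : ℝ) / 3)) := by
    intro a b ha hab hb
    rw [le_sub_iff_add_le]
    refine le_min ?_ ?_
    · refine (add_le_add le_rfl (min_le_left _ _)).trans ?_
      have e : ω ^ 2 / ρ ^ 2 / 5 * (b - a) + ω ^ 2 * a / ρ ^ 2 =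
        ω ^ 2 * ((b - a) / 5 + a) / ρ ^ 2 := by ring
      rw [e]; gcongr; linarith
    · refine (add_le_add le_rfl (min_le_right _ _)).trans ?_
      have h := abs_rpow_third_sub_ge hρ ha hab hb
      have e : ω ^ 2 / ρ ^ 2 / 5 * (b - a) = ω ^ 2 * ((b - a) / (5 * ρ ^ 2)) := by field_simp
      rw [e, ← mul_add]; gcongr; linarith
  rcases le_total a b with hab | hab
  · rw [abs_sub_comm, abs_of_nonneg (by linarith), abs_sub_comm]
    exact (key a b ha hab hb2).trans (le_abs_self _)
  · rw [abs_of_nonneg (by linarith)]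
    exact (key b a hb hab ha2).trans (le_abs_self _)

set_option maxHeartbeats 2000000 in
lemma exists_sum_cubic_error_le {c : ℝ} (hc : 0 < c) : ∃ C : ℝ, 0 < C ∧ ∀ ω ρ : ℝ, 0 < ω → 2 ≤ ρ →
    c ≤ ω ^ 2 * ρ →
    ∑ a ∈ Finset.Icc 1 ⌊√(2 * √2 * ρ ^ 6)⌋₊,
      (1 + 1 / (ω ^ 2 * a / (√2 * ρ ^ 2)) + Real.log (2 + ω ^ 2 * a / (√2 * ρ ^ 2)) +
      ∑ m ∈ Finset.Icc ⌈ω ^ 2 * a / (√2 * ρ ^ 2) / 2⌉₊ ⌊4 * (ω ^ 2 * a / (√2 * ρ ^ 2))⌋₊,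
        (1 / ((m : ℝ) ^ 2 / (ω ^ 3 * a) +
            |m - min (ω ^ 2 * a / ρ ^ 2) (ω ^ 2 * (a : ℝ) ^ ((1 : ℝ) / 3))|) +
          1 / ((m : ℝ) ^ 2 / (ω ^ 3 * a) + |m - ω ^ 2 * a / (√2 * ρ ^ 2)|))) ≤
    C * (ρ ^ 3 + ω * ρ ^ 2) * Real.log ρ := by
  refine ⟨2000 + 12 / c, by positivity, ?_⟩
  intro ω ρ hω hρ hcω
  obtain ⟨h2l, h2u⟩ := sqrt_two_bounds
  have hρ0 : 0 < ρ := by linarith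
  have hlog := one_le_two_mul_log hρ
  have hl0 : 0 < Real.log ρ := by linarith
  have hρ3 : 8 ≤ ρ ^ 3 := by
    calc (8 : ℝ) = 2 ^ 3 := by norm_num
      _ ≤ _ := by gcongr
  set K := ⌊√(2 * √2 * ρ ^ 6)⌋₊ with hK
  have hKu : (K : ℝ) ≤ 1.7 * ρ ^ 3 := by
    refine (Nat.floor_le (by positivity)).trans (Real.sqrt_le_iff.2 ⟨by positivity, ?_⟩)
    have : 0 < ρ ^ 6 := by positivity
    nlinarith
  have hK1 : 1 ≤ K := by
    refine Nat.le_floor (Real.le_sqrt_of_sq_le ?_)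
    have : ρ ^ 6 = ρ ^ 3 * ρ ^ 3 := by ring
    push_cast; nlinarith
  have hK1' : (1 : ℝ) ≤ K := by exact_mod_cast hK1
  have hlogK : 1 + Real.log K ≤ 6 * Real.log ρ := by
    have := log_le_mul_log_of_le (ρ := ρ) (x := K) 4 (by linarith)
      (hKu.trans (by nlinarith [show ρ ^ 4 = ρ * ρ ^ 3 by ring]))
    push_cast at this; linarith
  have hKsq : ∀ a ∈ Finset.Icc 1 K, (1 : ℝ) ≤ a ∧ (a : ℝ) ^ 2 ≤ 2 * √2 * ρ ^ 6 ∧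
      (a : ℝ) ≤ 1.7 * ρ ^ 3 := by
    intro a ha
    rw [Finset.mem_Icc] at ha
    refine ⟨by exact_mod_cast ha.1, ?_, le_trans (by exact_mod_cast ha.2) hKu⟩
    have h1 : (a : ℝ) ≤ √(2 * √2 * ρ ^ 6) := (Nat.le_floor_iff (by positivity)).1 ha.2
    have := pow_le_pow_left₀ (by positivity) h1 2
    rwa [Real.sq_sqrt (by positivity)] at this
  have hωρ : 0 < ω * ρ ^ 2 := by positivity
  set B := (ρ ^ 3 + ω * ρ ^ 2) * Real.log ρ with hB
  have hB1 : ρ ^ 3 * Real.log ρ ≤ B := by rw [hB]; gcongr; linarith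
  have hB2 : ω * ρ ^ 2 * Real.log ρ ≤ B := by rw [hB]; gcongr; linarith
  have hone : ∑ a ∈ Finset.Icc 1 K, (1 : ℝ) ≤ 4 * B := by
    simp only [Finset.sum_const, Nat.card_Icc, Nat.add_sub_cancel, nsmul_eq_mul, mul_one]
    nlinarith
  have hinv : ∑ a ∈ Finset.Icc 1 K, 1 / (ω ^ 2 * a / (√2 * ρ ^ 2)) ≤ 12 / c * B := by
    have h1 := sum_Icc_one_div_nat_le le_rfl hK1
    simp only [Nat.cast_one, div_one] at h1
    have h2 : ρ ^ 2 / ω ^ 2 ≤ ρ ^ 3 / c := by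
      rw [div_le_div_iff₀ (by positivity) hc]
      have : 0 < ρ ^ 2 := by positivity
      nlinarith
    calc ∑ a ∈ Finset.Icc 1 K, 1 / (ω ^ 2 * a / (√2 * ρ ^ 2)) =
          √2 * (ρ ^ 2 / ω ^ 2) * ∑ a ∈ Finset.Icc 1 K, (1 : ℝ) / a := by
          rw [Finset.mul_sum]
          refine Finset.sum_congr rfl fun a ha => ?_
          have := (hKsq a ha).1
          field_simp
      _ ≤ 2 * (ρ ^ 3 / c) * (6 * Real.log ρ) := by gcongr <;> linarith
      _ = 12 / c * (ρ ^ 3 * Real.log ρ) := by ring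
      _ ≤ _ := by gcongr
  have hlg : ∑ a ∈ Finset.Icc 1 K, Real.log (2 + ω ^ 2 * a / (√2 * ρ ^ 2)) ≤ 20 * B := by
    calc ∑ a ∈ Finset.Icc 1 K, Real.log (2 + ω ^ 2 * a / (√2 * ρ ^ 2)) ≤
        ∑ a ∈ Finset.Icc 1 K, (4 * Real.log ρ + 2 * (ω / ρ)) := Finset.sum_le_sum fun a ha => by
          have h1 := hKsq a ha
          refine log_two_add_le hω hρ (by positivity) ?_
          rw [div_le_iff₀ (by positivity)]
          have e : 2 * (ω ^ 2 * ρ) * (√2 * ρ ^ 2) = ω ^ 2 * (2 * √2 * ρ ^ 3) := by ring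
          rw [e]; gcongr; nlinarith
      _ = K * (4 * Real.log ρ + 2 * (ω / ρ)) := by
          simp only [Finset.sum_const, Nat.card_Icc, Nat.add_sub_cancel, nsmul_eq_mul]
      _ ≤ 1.7 * ρ ^ 3 * (4 * Real.log ρ + 2 * (ω / ρ)) := by gcongr
      _ = 6.8 * (ρ ^ 3 * Real.log ρ) + 3.4 * (ω * ρ ^ 2) := by field_simp; ring
      _ ≤ _ := by nlinarith
  set θ := ω ^ 2 / ρ ^ 2 with hθ
  have hθ0 : 0 < θ := by positivity
  have hmain : ∑ a ∈ Finset.Icc 1 K,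
      ∑ m ∈ Finset.Icc ⌈ω ^ 2 * a / (√2 * ρ ^ 2) / 2⌉₊ ⌊4 * (ω ^ 2 * a / (√2 * ρ ^ 2))⌋₊,
        (1 / ((m : ℝ) ^ 2 / (ω ^ 3 * a) +
            |m - min (ω ^ 2 * a / ρ ^ 2) (ω ^ 2 * (a : ℝ) ^ ((1 : ℝ) / 3))|) +
          1 / ((m : ℝ) ^ 2 / (ω ^ 3 * a) + |m - ω ^ 2 * a / (√2 * ρ ^ 2)|)) ≤ 1500 * B := by
    set W : ℕ → Finset ℕ := fun a =>
      Finset.Icc ⌈ω ^ 2 * a / (√2 * ρ ^ 2) / 2⌉₊ ⌊4 * (ω ^ 2 * a / (√2 * ρ ^ 2))⌋₊ with hW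
    have hWm : ∀ a ∈ Finset.Icc 1 K, ∀ m ∈ W a, θ * a ≤ 2 * √2 * m ∧ (m : ℝ) ≤ 3 * (θ * a) := by
      intro a ha m hm
      simp only [hW, Finset.mem_Icc] at hm
      have h1 := Nat.ceil_le.1 hm.1
      have h2 := (Nat.le_floor_iff (by positivity)).1 hm.2
      have e : ω ^ 2 * a / (√2 * ρ ^ 2) = θ * a / √2 := by rw [hθ]; field_simp
      rw [e] at h1 h2
      constructor
      · rw [div_div, div_le_iff₀ (by positivity)] at h1; linarith
      · refine h2.trans ?_
        rw [← mul_div_assoc, div_le_iff₀ (by positivity)]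
        have := (hKsq a ha).1
        have : 0 < θ * a := by positivity
        nlinarith
    have hL : 0 < θ / 3 := by positivity
    rw [Finset.sum_comm' (s' := fun m => (Finset.Icc 1 K).filter (fun a => m ∈ W a))
      (t' := Finset.Icc ⌈θ / 3⌉₊ ⌊6 * (θ * ρ ^ 3)⌋₊) (by
        intro a m
        constructor
        · rintro ⟨ha, hm⟩
          refine ⟨Finset.mem_filter.2 ⟨ha, hm⟩, ?_⟩
          obtain ⟨h1, h2⟩ := hWm a ha m hm
          obtain ⟨h3, _, h4⟩ := hKsq a ha
          have h5 : θ ≤ θ * a := le_mul_of_one_le_right hθ0.le h3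
          have h6 : θ * a ≤ θ * (1.7 * ρ ^ 3) := by gcongr
          have hm0 : (0 : ℝ) ≤ m := by positivity
          have h7 : 0 < θ * ρ ^ 3 := by positivity
          refine Finset.mem_Icc.2 ⟨Nat.ceil_le.2 ?_, Nat.le_floor ?_⟩
          · nlinarith
          · nlinarith
        · rintro ⟨h, _⟩
          exact Finset.mem_filter.1 h)]
    have hinner : ∀ m ∈ Finset.Icc ⌈θ / 3⌉₊ ⌊6 * (θ * ρ ^ 3)⌋₊,
        ∑ a ∈ (Finset.Icc 1 K).filter (fun a => m ∈ W a), (1 / ((m : ℝ) ^ 2 / (ω ^ 3 * a) +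
            |m - min (ω ^ 2 * a / ρ ^ 2) (ω ^ 2 * (a : ℝ) ^ ((1 : ℝ) / 3))|) +
          1 / ((m : ℝ) ^ 2 / (ω ^ 3 * a) + |m - ω ^ 2 * a / (√2 * ρ ^ 2)|)) ≤
        6 * (ω * ρ ^ 2) * (1 / m) + 240 / θ * Real.log ρ := by
      intro m hm
      have hm1 : 1 ≤ m := (Nat.one_le_ceil_iff.2 hL).trans (Finset.mem_Icc.1 hm).1
      have hm0 : (0 : ℝ) < m := by exact_mod_cast hm1
      have hw : 0 < m * θ / (3 * ω ^ 3) := by positivity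
      set V := (Finset.Icc 1 K).filter (fun a => m ∈ W a) with hV
      have hVK : V ⊆ Finset.Icc 1 K := Finset.filter_subset _ _
      have hwa : ∀ a ∈ V, m * θ / (3 * ω ^ 3) ≤ (m : ℝ) ^ 2 / (ω ^ 3 * a) := by
        intro a ha
        have hmem := Finset.mem_filter.1 ha
        have h1 := (hWm a hmem.1 m hmem.2).1
        have h2 := (hKsq a hmem.1).1
        rw [div_le_div_iff₀ (by positivity) (by positivity)]
        have e : (m : ℝ) * θ * (ω ^ 3 * a) = m * ω ^ 3 * (θ * a) := by ring
        have e2 : (m : ℝ) ^ 2 * (3 * ω ^ 3) = m * ω ^ 3 * (3 * m) := by ring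
        rw [e, e2]
        exact mul_le_mul_of_nonneg_left (by nlinarith) (by positivity)
      have hs : 0 < θ / 5 := by positivity
      have g1 := sum_one_div_add_abs_le (s := θ / 5) (w := m * θ / (3 * ω ^ 3)) (y := m)
        (z := fun a => min (ω ^ 2 * a / ρ ^ 2) (ω ^ 2 * (a : ℝ) ^ ((1 : ℝ) / 3)))
        hK1 hVK hs hw (fun i hi j hj => by
          have h1 := hKsq i (hVK hi)
          have h2 := hKsq j (hVK hj)
          exact abs_min_sub_ge hω hρ0 (by linarith) (by linarith) h1.2.1 h2.2.1)
      have g2 := sum_one_div_add_abs_le (s := θ / 5) (w := m * θ / (3 * ω ^ 3)) (y := m)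
        (z := fun a => ω ^ 2 * a / (√2 * ρ ^ 2))
        hK1 hVK hs hw (fun i hi j hj => by
          have e : ω ^ 2 * i / (√2 * ρ ^ 2) - ω ^ 2 * j / (√2 * ρ ^ 2) = θ / √2 * ((i : ℝ) - j) := by
            rw [hθ]; field_simp
          simp only [e]
          rw [abs_mul, abs_of_pos (show 0 < θ / √2 by positivity)]
          gcongr; linarith)
      have hew : 1 / (m * θ / (3 * ω ^ 3)) = 3 * (ω * ρ ^ 2) * (1 / m) := by
        rw [hθ]; field_simp
      have hes : 4 / (θ / 5) * (1 + Real.log K) ≤ 120 / θ * Real.log ρ := by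
        calc 4 / (θ / 5) * (1 + Real.log K) ≤ 4 / (θ / 5) * (6 * Real.log ρ) := by gcongr
          _ = _ := by field_simp; norm_num
      rw [hew] at g1 g2
      have hcomp : ∀ z : ℕ → ℝ, ∑ a ∈ V, 1 / ((m : ℝ) ^ 2 / (ω ^ 3 * a) + |m - z a|) ≤
          ∑ a ∈ V, 1 / (m * θ / (3 * ω ^ 3) + |z a - m|) := fun z =>
        Finset.sum_le_sum fun a ha => by
          rw [abs_sub_comm (m : ℝ)]
          exact one_div_le_one_div_of_le (by positivity) (by linarith [hwa a ha])
      rw [Finset.sum_add_distrib]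
      have t1 := (hcomp _).trans g1
      have t2 := (hcomp _).trans g2
      have e : 240 / θ * Real.log ρ = 120 / θ * Real.log ρ + 120 / θ * Real.log ρ := by ring
      rw [e]
      linarith
    refine (Finset.sum_le_sum hinner).trans ?_
    rw [Finset.sum_add_distrib, ← Finset.mul_sum]
    have hpq : θ / 3 ≤ 6 * (θ * ρ ^ 3) := by nlinarith
    have h1 := sum_Icc_one_div_le hL hpq
    have e : 6 * (θ * ρ ^ 3) / (θ / 3) = 18 * ρ ^ 3 := by field_simp; norm_num
    rw [e] at h1
    have h2 : 1 + Real.log (18 * ρ ^ 3) ≤ 10 * Real.log ρ := by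
      have := log_le_mul_log_of_le (ρ := ρ) (x := 18 * ρ ^ 3) 8 (by positivity) (by
        have : (2 : ℝ) ^ 5 ≤ ρ ^ 5 := by gcongr
        rw [show ρ ^ 8 = ρ ^ 5 * ρ ^ 3 by ring]; gcongr; linarith)
      push_cast at this; linarith
    have h3 : ∑ m ∈ Finset.Icc ⌈θ / 3⌉₊ ⌊6 * (θ * ρ ^ 3)⌋₊, 240 / θ * Real.log ρ ≤
        1440 * (ρ ^ 3 * Real.log ρ) := by
      rw [Finset.sum_const, nsmul_eq_mul, Nat.card_Icc]
      have hc1 : 1 ≤ ⌈θ / 3⌉₊ := Nat.one_le_ceil_iff.2 hL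
      have hc2 : ((⌊6 * (θ * ρ ^ 3)⌋₊ + 1 - ⌈θ / 3⌉₊ : ℕ) : ℝ) ≤ 6 * (θ * ρ ^ 3) :=
        (Nat.cast_le.2 (by omega : _ ≤ ⌊6 * (θ * ρ ^ 3)⌋₊)).trans (Nat.floor_le (by positivity))
      calc _ ≤ 6 * (θ * ρ ^ 3) * (240 / θ * Real.log ρ) := by gcongr
        _ = _ := by field_simp; norm_num
    have h4 : 6 * (ω * ρ ^ 2) * ∑ m ∈ Finset.Icc ⌈θ / 3⌉₊ ⌊6 * (θ * ρ ^ 3)⌋₊, (1 : ℝ) / m ≤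
        6 * (ω * ρ ^ 2) * (10 * Real.log ρ) := by gcongr; linarith
    have h5 : B = ρ ^ 3 * Real.log ρ + ω * ρ ^ 2 * Real.log ρ := by rw [hB]; ring
    have h6 : 0 < ω * ρ ^ 2 * Real.log ρ := by positivity
    have h7 : 0 < ρ ^ 3 * Real.log ρ := by positivity
    linarith
  rw [Finset.sum_add_distrib, Finset.sum_add_distrib, Finset.sum_add_distrib, mul_assoc, ← hB]
  have hB0 : 0 < B := by positivity
  have e : (2000 + 12 / c) * B = 2000 * B + 12 / c * B := by ring
  rw [e]; linarith

set_option maxHeartbeats 2000000 in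
lemma exists_sum_quadratic_error_le : ∃ C : ℝ, 0 < C ∧ ∀ ω ρ : ℝ, 0 < ω → 2 ≤ ρ →
    ∑ m ∈ Finset.Icc 1 ⌊√(√2 * (ω ^ 4 * ρ ^ 2))⌋₊,
      (1 + 1 / (m * ρ ^ 2 / ω ^ 2) + Real.log (2 + m * ρ ^ 2 / ω ^ 2) +
      ∑ a ∈ Finset.Icc ⌈m * ρ ^ 2 / ω ^ 2 / 2⌉₊ ⌊4 * (m * ρ ^ 2 / ω ^ 2)⌋₊,
        (1 / (m / ω ^ 3 + |(a : ℝ) - (m : ℝ) ^ 2 * max (m : ℝ) (ω ^ 4 * ρ ^ 2 / m) / ω ^ 6|) +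
          1 / (m / ω ^ 3 + |(a : ℝ) - (m : ℝ) ^ 2 * (√2 * (ω ^ 4 * ρ ^ 2) / m) / ω ^ 6|))) ≤
    C * (ω ^ 2 * ρ + ω ^ 3) * Real.log ρ := by
  refine ⟨150, by norm_num, ?_⟩
  intro ω ρ hω hρ
  obtain ⟨h2l, h2u⟩ := sqrt_two_bounds
  have hρ0 : 0 < ρ := by linarith
  have hlog := one_le_two_mul_log hρ
  have hl0 : 0 < Real.log ρ := by linarith
  have hρ3 : 8 ≤ ρ ^ 3 := by
    calc (8 : ℝ) = 2 ^ 3 := by norm_num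
      _ ≤ _ := by gcongr
  set Q := ⌊√(√2 * (ω ^ 4 * ρ ^ 2))⌋₊ with hQ
  have hQu : (Q : ℝ) ≤ 1.2 * (ω ^ 2 * ρ) := by
    refine (Nat.floor_le (by positivity)).trans (Real.sqrt_le_iff.2 ⟨by positivity, ?_⟩)
    have : 0 < ω ^ 4 * ρ ^ 2 := by positivity
    nlinarith
  rcases Nat.eq_zero_or_pos Q with hQ0 | hQ1
  · rw [hQ0]; simp only [zero_lt_one, Finset.Icc_eq_empty_of_lt, Finset.sum_empty]; positivity
  have hQ1' : (1 : ℝ) ≤ Q := by exact_mod_cast hQ1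
  have hmQ : ∀ m ∈ Finset.Icc 1 Q, (1 : ℝ) ≤ m ∧ (m : ℝ) ≤ 1.2 * (ω ^ 2 * ρ) := by
    intro m hm
    rw [Finset.mem_Icc] at hm
    exact ⟨by exact_mod_cast hm.1, le_trans (by exact_mod_cast hm.2) hQu⟩
  have hmQ' : ∀ m ∈ Finset.Icc 1 Q, m * ρ ^ 2 / ω ^ 2 ≤ 1.2 * ρ ^ 3 := by
    intro m hm
    rw [div_le_iff₀ (by positivity)]
    calc m * ρ ^ 2 ≤ 1.2 * (ω ^ 2 * ρ) * ρ ^ 2 := by gcongr; exact (hmQ m hm).2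
      _ = _ := by ring
  set X := ω ^ 2 * ρ * Real.log ρ with hX
  set Y := ω ^ 3 * Real.log ρ with hY
  have hX0 : 0 < X := by positivity
  have hY0 : 0 < Y := by positivity
  have hone : ∑ m ∈ Finset.Icc 1 Q, (1 : ℝ) ≤ 3 * X := by
    simp only [Finset.sum_const, Nat.card_Icc, Nat.add_sub_cancel, nsmul_eq_mul, mul_one]
    have : 0 < ω ^ 2 * ρ := by positivity
    rw [hX]; nlinarith
  have hinv : ∑ m ∈ Finset.Icc 1 Q, 1 / (m * ρ ^ 2 / ω ^ 2) ≤ 6 * X + 4 * Y := by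
    have h1 := sum_Icc_one_div_nat_le le_rfl hQ1
    simp only [Nat.cast_one, div_one] at h1
    have h2 : Real.log Q ≤ 4 * Real.log ρ + 2 * (ω / ρ) :=
      (Real.log_le_log (by linarith) (by linarith)).trans
        (log_two_add_le (R := Q) hω hρ (by linarith)
          (hQu.trans (by nlinarith [show 0 < ω ^ 2 * ρ by positivity])))
    have h3 : 1 ≤ ρ ^ 2 := by nlinarith
    have h4 : ω ^ 2 / ρ ^ 2 ≤ ω ^ 2 * ρ := by
      rw [div_le_iff₀ (by positivity)]
      calc ω ^ 2 = ω ^ 2 * 1 * 1 := by ring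
        _ ≤ ω ^ 2 * ρ * ρ ^ 2 := by gcongr; linarith
    have h5 : ω ^ 2 / ρ ^ 2 * (2 * (ω / ρ)) ≤ 2 * ω ^ 3 := by
      have e : ω ^ 2 / ρ ^ 2 * (2 * (ω / ρ)) = 2 * ω ^ 3 / ρ ^ 3 := by field_simp
      rw [e]; exact div_le_self (by positivity) (by linarith)
    calc ∑ m ∈ Finset.Icc 1 Q, 1 / (m * ρ ^ 2 / ω ^ 2) =
          ω ^ 2 / ρ ^ 2 * ∑ m ∈ Finset.Icc 1 Q, (1 : ℝ) / m := by
          rw [Finset.mul_sum]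
          refine Finset.sum_congr rfl fun m hm => ?_
          have := (hmQ m hm).1
          field_simp
      _ ≤ ω ^ 2 / ρ ^ 2 * (6 * Real.log ρ + 2 * (ω / ρ)) := by gcongr; linarith
      _ = ω ^ 2 / ρ ^ 2 * (6 * Real.log ρ) + ω ^ 2 / ρ ^ 2 * (2 * (ω / ρ)) := by ring
      _ ≤ ω ^ 2 * ρ * (6 * Real.log ρ) + 2 * ω ^ 3 := by gcongr
      _ ≤ _ := by
        have : 0 < ω ^ 3 := by positivity
        rw [hX, hY]; nlinarith
  have hlg : ∑ m ∈ Finset.Icc 1 Q, Real.log (2 + m * ρ ^ 2 / ω ^ 2) ≤ 5 * X := by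
    calc ∑ m ∈ Finset.Icc 1 Q, Real.log (2 + m * ρ ^ 2 / ω ^ 2) ≤
        ∑ m ∈ Finset.Icc 1 Q, 4 * Real.log ρ := Finset.sum_le_sum fun m hm => by
          have h0 : 0 ≤ m * ρ ^ 2 / ω ^ 2 := by positivity
          have := log_le_mul_log_of_le (ρ := ρ) (x := 2 + m * ρ ^ 2 / ω ^ 2) 4 (by linarith) (by
            have := hmQ' m hm
            nlinarith [show ρ ^ 4 = ρ * ρ ^ 3 by ring])
          exact_mod_cast this
      _ = Q * (4 * Real.log ρ) := by
          simp only [Finset.sum_const, Nat.card_Icc, Nat.add_sub_cancel, nsmul_eq_mul]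
      _ ≤ 1.2 * (ω ^ 2 * ρ) * (4 * Real.log ρ) := by gcongr
      _ = 4.8 * X := by rw [hX]; ring
      _ ≤ _ := by linarith
  set K := ⌊5 * ρ ^ 3⌋₊ with hK
  have hK1 : 1 ≤ K := Nat.le_floor (by push_cast; linarith)
  have hlogK : 1 + Real.log K ≤ 8 * Real.log ρ := by
    have := log_le_mul_log_of_le (ρ := ρ) (x := K) 6 (by exact_mod_cast hK1)
      ((Nat.floor_le (by positivity)).trans (by nlinarith [show ρ ^ 6 = ρ ^ 3 * ρ ^ 3 by ring]))
    push_cast at this; linarith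
  have hinner : ∀ m ∈ Finset.Icc 1 Q,
      ∑ a ∈ Finset.Icc ⌈m * ρ ^ 2 / ω ^ 2 / 2⌉₊ ⌊4 * (m * ρ ^ 2 / ω ^ 2)⌋₊,
        (1 / (m / ω ^ 3 + |(a : ℝ) - (m : ℝ) ^ 2 * max (m : ℝ) (ω ^ 4 * ρ ^ 2 / m) / ω ^ 6|) +
          1 / (m / ω ^ 3 + |(a : ℝ) - (m : ℝ) ^ 2 * (√2 * (ω ^ 4 * ρ ^ 2) / m) / ω ^ 6|)) ≤
      2 * ω ^ 3 * (if ω ^ 2 / ρ ^ 2 / 4 ≤ m then 1 / (m : ℝ) else 0) + 64 * Real.log ρ := by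
    intro m hm
    have hm1 := (hmQ m hm).1
    have hm0 : (0 : ℝ) < m := by linarith
    set W := Finset.Icc ⌈m * ρ ^ 2 / ω ^ 2 / 2⌉₊ ⌊4 * (m * ρ ^ 2 / ω ^ 2)⌋₊ with hW
    split_ifs with hθ
    · have hWK : W ⊆ Finset.Icc 1 K := by
        refine Finset.Icc_subset_Icc (Nat.one_le_ceil_iff.2 (by positivity)) ?_
        refine Nat.floor_le_floor ?_
        have := hmQ' m hm
        linarith
      have hz : ∀ i ∈ W, ∀ j ∈ W, (1 : ℝ) * |(i : ℝ) - j| ≤ |(i : ℝ) - j| :=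
        fun i _ j _ => (one_mul _).le
      have g := fun y => sum_one_div_add_abs_le (s := 1) (w := m / ω ^ 3) (y := y) hK1 hWK
        one_pos (by positivity) hz
      rw [Finset.sum_add_distrib]
      refine (add_le_add (g _) (g _)).trans ?_
      have e : 1 / (m / ω ^ 3) = ω ^ 3 * (1 / m) := by field_simp
      rw [e]; linarith
    · have hWe : W = ∅ := by
        refine Finset.Icc_eq_empty_of_lt ?_
        rw [not_le] at hθ
        have h1 : 4 * (m * ρ ^ 2 / ω ^ 2) < 1 := by
          rw [← mul_div_assoc, div_lt_one (by positivity)]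
          rw [div_div, lt_div_iff₀ (by positivity)] at hθ
          linarith
        rw [Nat.floor_eq_zero.2 h1]
        exact Nat.ceil_pos.2 (by positivity)
      rw [hWe]; simp only [Finset.sum_empty]; positivity
  have hmain := Finset.sum_le_sum hinner
  rw [Finset.sum_add_distrib, ← Finset.mul_sum, ← Finset.sum_filter] at hmain
  have hsub : ∑ m ∈ (Finset.Icc 1 Q).filter (fun m : ℕ => ω ^ 2 / ρ ^ 2 / 4 ≤ m), 1 / (m : ℝ) ≤
      8 * Real.log ρ := by
    have hpq : ω ^ 2 / ρ ^ 2 / 4 ≤ 1.2 * (ω ^ 2 * ρ) := by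
      rw [div_div, div_le_iff₀ (by positivity)]
      have e : 1.2 * (ω ^ 2 * ρ) * (ρ ^ 2 * 4) = ω ^ 2 * (4.8 * ρ ^ 3) := by ring
      rw [e]
      exact le_mul_of_one_le_right (by positivity) (by linarith)
    have h1 := sum_Icc_one_div_le (by positivity) hpq
    have e : 1.2 * (ω ^ 2 * ρ) / (ω ^ 2 / ρ ^ 2 / 4) = 4.8 * ρ ^ 3 := by field_simp; norm_num
    rw [e] at h1
    have h2 := log_le_mul_log_of_le (ρ := ρ) (x := 4.8 * ρ ^ 3) 6 (by positivity)
      (by nlinarith [show ρ ^ 6 = ρ ^ 3 * ρ ^ 3 by ring])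
    push_cast at h2
    refine le_trans (Finset.sum_le_sum_of_subset_of_nonneg ?_ fun _ _ _ => by positivity)
      (h1.trans (by linarith))
    intro m hm
    rw [Finset.mem_filter] at hm
    exact Finset.mem_Icc.2 ⟨Nat.ceil_le.2 hm.2, Nat.le_floor (hmQ m hm.1).2⟩
  have hconst : ∑ m ∈ Finset.Icc 1 Q, 64 * Real.log ρ ≤ 80 * X := by
    simp only [Finset.sum_const, Nat.card_Icc, Nat.add_sub_cancel, nsmul_eq_mul]
    calc (Q : ℝ) * (64 * Real.log ρ) ≤ 1.2 * (ω ^ 2 * ρ) * (64 * Real.log ρ) := by gcongr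
      _ = 76.8 * X := by rw [hX]; ring
      _ ≤ _ := by linarith
  have hsub2 : 2 * ω ^ 3 * ∑ m ∈ (Finset.Icc 1 Q).filter (fun m : ℕ => ω ^ 2 / ρ ^ 2 / 4 ≤ m),
      1 / (m : ℝ) ≤ 16 * Y := by
    calc _ ≤ 2 * ω ^ 3 * (8 * Real.log ρ) := by gcongr
      _ = 16 * Y := by rw [hY]; ring
  rw [Finset.sum_add_distrib, Finset.sum_add_distrib, Finset.sum_add_distrib]
  have e : 150 * (ω ^ 2 * ρ + ω ^ 3) * Real.log ρ = 150 * X + 150 * Y := by rw [hX, hY]; ring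
  rw [e]; linarith

open Classical in
noncomputable def stationaryTerm (ω ρ a m : ℝ) : ℂ :=
  if Stationary ω ρ a m then fresnel * mainTerm ω a m else 0

lemma stationary_of_stationaryTerm_ne_zero {ω ρ a m : ℝ} (h : stationaryTerm ω ρ a m ≠ 0) :
    Stationary ω ρ a m := by
  by_contra hS
  exact h (if_neg hS)

lemma Stationary.sq_le {ω ρ a m : ℝ} (h : Stationary ω ρ a m) (hω : 0 < ω) (hρ : 0 < ρ)
    (ha : 0 < a) : a ^ 2 ≤ 2 * √2 * ρ ^ 6 := by
  obtain ⟨h1, _, h3⟩ := h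
  have h4 := pow_le_pow_left₀ (by positivity) h3 3
  rw [mul_pow √2, sqrt_two_pow_three, mul_pow (ρ ^ 2)] at h4
  have h5 : ω ^ 6 * a * a ^ 2 ≤ ω ^ 6 * a * (2 * √2 * ρ ^ 6) := by
    calc ω ^ 6 * a * a ^ 2 = (ω ^ 2 * a) ^ 3 := by ring
      _ ≤ 2 * √2 * ((ρ ^ 2) ^ 3 * m ^ 3) := h4
      _ ≤ 2 * √2 * ((ρ ^ 2) ^ 3 * (ω ^ 6 * a)) := by gcongr
      _ = _ := by ring
  exact le_of_mul_le_mul_left h5 (by positivity)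

lemma Stationary.sq_le' {ω ρ a m : ℝ} (h : Stationary ω ρ a m) (hm : 0 < m) :
    m ^ 2 ≤ √2 * (ω ^ 4 * ρ ^ 2) := by
  obtain ⟨h1, _, h3⟩ := h
  have h5 : m * m ^ 2 ≤ m * (√2 * (ω ^ 4 * ρ ^ 2)) := by
    calc m * m ^ 2 = m ^ 3 := by ring
      _ ≤ ω ^ 4 * (ω ^ 2 * a) := by linarith
      _ ≤ ω ^ 4 * (√2 * (ρ ^ 2 * m)) := by gcongr
      _ = _ := by ring
  exact le_of_mul_le_mul_left h5 hm

lemma sum_sum_eq_sum_sum_Icc {K L : ℕ} {W : ℕ → Finset ℕ} {f : ℕ → ℕ → ℂ} (hKL : K ≤ L)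
    (hW : ∀ a ∈ Finset.Icc 1 K, W a ⊆ Finset.Icc 1 L)
    (hf : ∀ a ∈ Finset.Icc 1 L, ∀ m ∈ Finset.Icc 1 L, f a m ≠ 0 → a ≤ K ∧ m ∈ W a) :
    ∑ a ∈ Finset.Icc 1 K, ∑ m ∈ W a, f a m =
      ∑ a ∈ Finset.Icc 1 L, ∑ m ∈ Finset.Icc 1 L, f a m := by
  have h1 : ∀ a ∈ Finset.Icc 1 K, ∑ m ∈ W a, f a m = ∑ m ∈ Finset.Icc 1 L, f a m := by
    intro a ha
    refine Finset.sum_subset (hW a ha) fun m hm hmW => ?_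
    by_contra h0
    exact hmW (hf a (Finset.Icc_subset_Icc le_rfl hKL ha) m hm h0).2
  rw [Finset.sum_congr rfl h1]
  refine Finset.sum_subset (Finset.Icc_subset_Icc le_rfl hKL) fun a ha haK => ?_
  refine Finset.sum_eq_zero fun m hm => ?_
  by_contra h0
  exact haK (Finset.mem_Icc.2 ⟨(Finset.mem_Icc.1 ha).1, (hf a ha m hm h0).1⟩)

lemma eventually_sum_cubic_stationaryTerm_eq {ω ρ : ℝ} (hω : 0 < ω) (hρ : 0 < ρ) :
    ∀ᶠ L : ℕ in atTop, ∑ a ∈ Finset.Icc 1 ⌊√(2 * √2 * ρ ^ 6)⌋₊,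
      ∑ m ∈ Finset.Icc ⌈ω ^ 2 * a / (√2 * ρ ^ 2) / 2⌉₊ ⌊4 * (ω ^ 2 * a / (√2 * ρ ^ 2))⌋₊,
        stationaryTerm ω ρ a m =
      ∑ a ∈ Finset.Icc 1 L, ∑ m ∈ Finset.Icc 1 L, stationaryTerm ω ρ a m := by
  set K := ⌊√(2 * √2 * ρ ^ 6)⌋₊ with hK
  filter_upwards [eventually_ge_atTop K,
    eventually_ge_atTop ⌊4 * (ω ^ 2 * K / (√2 * ρ ^ 2))⌋₊] with L hL1 hL2
  refine sum_sum_eq_sum_sum_Icc (f := fun a m => stationaryTerm ω ρ a m) hL1 ?_ ?_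
  · intro a ha
    obtain ⟨ha1, ha2⟩ := Finset.mem_Icc.1 ha
    have ha0 : (0 : ℝ) < a := by exact_mod_cast ha1
    have haK : (a : ℝ) ≤ K := by exact_mod_cast ha2
    refine Finset.Icc_subset_Icc (Nat.one_le_ceil_iff.2 (by positivity)) (le_trans ?_ hL2)
    exact Nat.floor_le_floor (by gcongr)
  · intro a ha m hm h0
    have ha0 : (0 : ℝ) < a := by exact_mod_cast (Finset.mem_Icc.1 ha).1
    have hS := stationary_of_stationaryTerm_ne_zero h0
    refine ⟨Nat.le_floor (Real.le_sqrt_of_sq_le (hS.sq_le hω hρ ha0)), ?_⟩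
    obtain ⟨_, h2, h3⟩ := hS
    obtain ⟨h2l, h2u⟩ := sqrt_two_bounds
    have hm0 : (0 : ℝ) < m := by exact_mod_cast (Finset.mem_Icc.1 hm).1
    refine Finset.mem_Icc.2 ⟨Nat.ceil_le.2 ?_, Nat.le_floor ?_⟩
    · rw [div_div, div_le_iff₀ (by positivity)]
      have : 0 < √2 * (ρ ^ 2 * m) := by positivity
      linarith
    · rw [← mul_div_assoc, le_div_iff₀ (by positivity)]
      have : 0 < ρ ^ 2 * m := by positivity
      nlinarith

lemma eventually_sum_quadratic_stationaryTerm_eq {ω ρ : ℝ} (hω : 0 < ω) (hρ : 0 < ρ) :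
    ∀ᶠ L : ℕ in atTop, ∑ m ∈ Finset.Icc 1 ⌊√(√2 * (ω ^ 4 * ρ ^ 2))⌋₊,
      ∑ a ∈ Finset.Icc ⌈m * ρ ^ 2 / ω ^ 2 / 2⌉₊ ⌊4 * (m * ρ ^ 2 / ω ^ 2)⌋₊,
        stationaryTerm ω ρ a m =
      ∑ a ∈ Finset.Icc 1 L, ∑ m ∈ Finset.Icc 1 L, stationaryTerm ω ρ a m := by
  set K := ⌊√(√2 * (ω ^ 4 * ρ ^ 2))⌋₊ with hK
  filter_upwards [eventually_ge_atTop K,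
    eventually_ge_atTop ⌊4 * (K * ρ ^ 2 / ω ^ 2)⌋₊] with L hL1 hL2
  rw [Finset.sum_comm (s := Finset.Icc 1 L)]
  refine sum_sum_eq_sum_sum_Icc (f := fun m a => stationaryTerm ω ρ a m) hL1 ?_ ?_
  · intro m hm
    obtain ⟨hm1, hm2⟩ := Finset.mem_Icc.1 hm
    have hm0 : (0 : ℝ) < m := by exact_mod_cast hm1
    have hmK : (m : ℝ) ≤ K := by exact_mod_cast hm2
    refine Finset.Icc_subset_Icc (Nat.one_le_ceil_iff.2 (by positivity)) (le_trans ?_ hL2)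
    exact Nat.floor_le_floor (by gcongr)
  · intro m hm a ha h0
    have hm0 : (0 : ℝ) < m := by exact_mod_cast (Finset.mem_Icc.1 hm).1
    have hS := stationary_of_stationaryTerm_ne_zero h0
    refine ⟨Nat.le_floor (Real.le_sqrt_of_sq_le (hS.sq_le' hm0)), ?_⟩
    obtain ⟨_, h2, h3⟩ := hS
    obtain ⟨h2l, h2u⟩ := sqrt_two_bounds
    have : 0 < ρ ^ 2 * m := by positivity
    refine Finset.mem_Icc.2 ⟨Nat.ceil_le.2 ?_, Nat.le_floor ?_⟩
    · rw [div_div, div_le_iff₀ (by positivity)]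
      linarith
    · rw [← mul_div_assoc, le_div_iff₀ (by positivity)]
      nlinarith

lemma eventually_norm_sum_cubic_sub_le {c : ℝ} (hc : 0 < c) : ∃ C : ℝ, 0 < C ∧ ∀ ω ρ : ℝ,
    0 < ω → 2 ≤ ρ → c ≤ ω ^ 2 * ρ → ∀ᶠ L : ℕ in atTop,
    ‖∑ k ∈ Finset.Icc ⌈ρ ^ 6⌉₊ ⌊2 * √2 * ρ ^ 6⌋₊, (d k : ℂ) *
        ((((k : ℝ) ^ (-(1 : ℝ) / 6) : ℝ) : ℂ) * ee (3 / 2 * (ω ^ 3 * k) ^ ((2 : ℝ) / 3))) -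
      2 * starRingEnd ℂ (∑ a ∈ Finset.Icc 1 L, ∑ m ∈ Finset.Icc 1 L, stationaryTerm ω ρ a m)‖ ≤
    C * (ρ ^ 2 + ω * ρ) * Real.log ρ := by
  obtain ⟨C1, hC1, h1⟩ := exists_norm_sum_rpow_sub_le
  obtain ⟨C2, hC2, h2⟩ := exists_sum_cubic_error_le hc
  refine ⟨12 + 2 * C1 * C2, by positivity, ?_⟩
  intro ω ρ hω hρ hcω
  have hρ0 : 0 < ρ := by linarith
  filter_upwards [eventually_sum_cubic_stationaryTerm_eq hω hρ0] with L hL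
  rw [← hL]
  obtain ⟨h2l, h2u⟩ := sqrt_two_bounds
  have hlog := one_le_two_mul_log hρ
  have hl0 : 0 < Real.log ρ := by linarith
  set u : ℕ → ℂ := fun k => (((k : ℝ) ^ (-(1 : ℝ) / 6) : ℝ) : ℂ) *
    ee (3 / 2 * (ω ^ 3 * k) ^ ((2 : ℝ) / 3)) with hu
  have hA := norm_sum_mul_card_divisors_sub_le (x := ρ ^ 6) (y := 2 * √2 * ρ ^ 6) (U := 1 / ρ)
    (u := u) (by positivity) (by positivity) (by positivity) (by
      intro k hk _
      rw [hu]
      simp only [norm_mul, norm_ee, mul_one, Complex.norm_real, Real.norm_eq_abs]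
      rw [abs_of_nonneg (by positivity)]
      calc (k : ℝ) ^ (-(1 : ℝ) / 6) ≤ (ρ ^ 6) ^ (-(1 : ℝ) / 6) :=
            Real.rpow_le_rpow_of_nonpos (by positivity) hk (by norm_num)
        _ = 1 / ρ := by
            rw [← Real.rpow_natCast, ← Real.rpow_mul hρ0.le]
            norm_num [Real.rpow_neg_one])
  set K := ⌊√(2 * √2 * ρ ^ 6)⌋₊ with hK
  have hKsq : ∀ a ∈ Finset.Icc 1 K, (1 : ℝ) ≤ a ∧ (a : ℝ) ^ 2 ≤ 2 * √2 * ρ ^ 6 := by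
    intro a ha
    rw [Finset.mem_Icc] at ha
    refine ⟨by exact_mod_cast ha.1, ?_⟩
    have h1 : (a : ℝ) ≤ √(2 * √2 * ρ ^ 6) := (Nat.le_floor_iff (by positivity)).1 ha.2
    have := pow_le_pow_left₀ (by positivity) h1 2
    rwa [Real.sq_sqrt (by positivity)] at this
  have hB : ‖∑ a ∈ Finset.Icc 1 K, ∑ b ∈ Finset.Ioc ⌊max (a : ℝ) (ρ ^ 6 / a)⌋₊
        ⌊2 * √2 * ρ ^ 6 / a⌋₊, u (a * b) -
      starRingEnd ℂ (∑ a ∈ Finset.Icc 1 K,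
      ∑ m ∈ Finset.Icc ⌈ω ^ 2 * a / (√2 * ρ ^ 2) / 2⌉₊ ⌊4 * (ω ^ 2 * a / (√2 * ρ ^ 2))⌋₊,
        stationaryTerm ω ρ a m)‖ ≤ C1 / ρ * (C2 * (ρ ^ 3 + ω * ρ ^ 2) * Real.log ρ) := by
    rw [map_sum, ← Finset.sum_sub_distrib]
    refine (norm_sum_le _ _).trans ?_
    refine le_trans (Finset.sum_le_sum fun a ha => ?_)
      ((Finset.mul_sum _ _ _).symm.le.trans
        (mul_le_mul_of_nonneg_left (h2 ω ρ hω hρ hcω) (by positivity)))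
    have := h1 ω ρ a hω hρ0 (hKsq a ha).1 (hKsq a ha).2
    rw [map_sum]
    simp only [hu, Nat.cast_mul]
    exact this
  have hs : √(2 * √2 * ρ ^ 6) ≤ 1.7 * ρ ^ 3 := by
    refine Real.sqrt_le_iff.2 ⟨by positivity, ?_⟩
    have : 0 < ρ ^ 6 := by positivity
    nlinarith
  have hU : 3 * (1 / ρ) * √(2 * √2 * ρ ^ 6) ≤ 12 * (ρ ^ 2 + ω * ρ) * Real.log ρ := by
    calc 3 * (1 / ρ) * √(2 * √2 * ρ ^ 6) ≤ 3 * (1 / ρ) * (1.7 * ρ ^ 3) := by gcongr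
      _ = 5.1 * ρ ^ 2 * 1 := by field_simp; norm_num
      _ ≤ 6 * (ρ ^ 2 + ω * ρ) * (2 * Real.log ρ) := by
        gcongr
        · norm_num
        · exact le_add_of_nonneg_right (by positivity)
      _ = _ := by ring
  have hB' : C1 / ρ * (C2 * (ρ ^ 3 + ω * ρ ^ 2) * Real.log ρ) =
      C1 * C2 * (ρ ^ 2 + ω * ρ) * Real.log ρ := by field_simp
  rw [hB'] at hB
  set X := ∑ k ∈ Finset.Icc ⌈ρ ^ 6⌉₊ ⌊2 * √2 * ρ ^ 6⌋₊, (d k : ℂ) * u k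
  set Y := ∑ a ∈ Finset.Icc 1 K, ∑ b ∈ Finset.Ioc ⌊max (a : ℝ) (ρ ^ 6 / a)⌋₊
        ⌊2 * √2 * ρ ^ 6 / a⌋₊, u (a * b)
  set V := starRingEnd ℂ (∑ a ∈ Finset.Icc 1 K,
      ∑ m ∈ Finset.Icc ⌈ω ^ 2 * a / (√2 * ρ ^ 2) / 2⌉₊ ⌊4 * (ω ^ 2 * a / (√2 * ρ ^ 2))⌋₊,
        stationaryTerm ω ρ a m)
  have e : X - 2 * V = (X - 2 * Y) + 2 * (Y - V) := by ring
  calc ‖X - 2 * V‖ ≤ ‖X - 2 * Y‖ + 2 * ‖Y - V‖ := by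
        rw [e]; refine (norm_add_le _ _).trans (by rw [norm_mul]; norm_num)
    _ ≤ _ := by linarith

lemma eventually_norm_sum_quadratic_sub_le : ∃ C : ℝ, 0 < C ∧ ∀ ω ρ : ℝ,
    0 < ω → 2 ≤ ρ → ∀ᶠ L : ℕ in atTop,
    ‖((√3 / ω ^ 4 : ℝ) : ℂ) * ∑ k ∈ Finset.Icc ⌈ω ^ 4 * ρ ^ 2⌉₊ ⌊√2 * (ω ^ 4 * ρ ^ 2)⌋₊,
        (d k : ℂ) * ((√k : ℂ) * ee ((k : ℝ) ^ 2 / (2 * ω ^ 6))) -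
      2 * ∑ a ∈ Finset.Icc 1 L, ∑ m ∈ Finset.Icc 1 L, stationaryTerm ω ρ a m‖ ≤
    C * (ρ ^ 2 + ω * ρ) * Real.log ρ := by
  obtain ⟨C1, hC1, h1⟩ := exists_norm_sum_sqrt_sub_le
  obtain ⟨C2, hC2, h2⟩ := exists_sum_quadratic_error_le
  refine ⟨20 + 2 * C1 * C2, by positivity, ?_⟩
  intro ω ρ hω hρ
  have hρ0 : 0 < ρ := by linarith
  filter_upwards [eventually_sum_quadratic_stationaryTerm_eq hω hρ0] with L hL
  rw [← hL]
  obtain ⟨h2l, h2u⟩ := sqrt_two_bounds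
  have hlog := one_le_two_mul_log hρ
  have hl0 : 0 < Real.log ρ := by linarith
  set u : ℕ → ℂ := fun k => (√k : ℂ) * ee ((k : ℝ) ^ 2 / (2 * ω ^ 6)) with hu
  have hA := norm_sum_mul_card_divisors_sub_le (x := ω ^ 4 * ρ ^ 2)
    (y := √2 * (ω ^ 4 * ρ ^ 2)) (U := √(√2 * (ω ^ 4 * ρ ^ 2)))
    (u := u) (by positivity) (by positivity) (by positivity) (by
      intro k _ hk
      rw [hu]
      simp only [norm_mul, norm_ee, mul_one, Complex.norm_real, Real.norm_eq_abs]
      rw [abs_of_nonneg (by positivity)]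
      exact Real.sqrt_le_sqrt hk)
  rw [mul_assoc, Real.mul_self_sqrt (by positivity)] at hA
  set K := ⌊√(√2 * (ω ^ 4 * ρ ^ 2))⌋₊ with hK
  have hKsq : ∀ m ∈ Finset.Icc 1 K, (1 : ℝ) ≤ m ∧ (m : ℝ) ^ 2 ≤ √2 * (ω ^ 4 * ρ ^ 2) := by
    intro a ha
    rw [Finset.mem_Icc] at ha
    refine ⟨by exact_mod_cast ha.1, ?_⟩
    have h1 : (a : ℝ) ≤ √(√2 * (ω ^ 4 * ρ ^ 2)) := (Nat.le_floor_iff (by positivity)).1 ha.2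
    have := pow_le_pow_left₀ (by positivity) h1 2
    rwa [Real.sq_sqrt (by positivity)] at this
  have hB : ‖((√3 / ω ^ 4 : ℝ) : ℂ) * ∑ m ∈ Finset.Icc 1 K,
        ∑ b ∈ Finset.Ioc ⌊max (m : ℝ) (ω ^ 4 * ρ ^ 2 / m)⌋₊
        ⌊√2 * (ω ^ 4 * ρ ^ 2) / m⌋₊, u (m * b) -
      ∑ m ∈ Finset.Icc 1 K,
      ∑ a ∈ Finset.Icc ⌈m * ρ ^ 2 / ω ^ 2 / 2⌉₊ ⌊4 * (m * ρ ^ 2 / ω ^ 2)⌋₊,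
        stationaryTerm ω ρ a m‖ ≤
      C1 * ρ / ω ^ 2 * (C2 * (ω ^ 2 * ρ + ω ^ 3) * Real.log ρ) := by
    rw [Finset.mul_sum, ← Finset.sum_sub_distrib]
    refine (norm_sum_le _ _).trans ?_
    refine le_trans (Finset.sum_le_sum fun m hm => ?_)
      ((Finset.mul_sum _ _ _).symm.le.trans
        (mul_le_mul_of_nonneg_left (h2 ω ρ hω hρ) (by positivity)))
    have := h1 ω ρ m hω hρ0 (hKsq m hm).1 (hKsq m hm).2
    simp only [hu, Nat.cast_mul]
    exact this
  have hU : √3 / ω ^ 4 * (3 * (√2 * (ω ^ 4 * ρ ^ 2))) ≤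
      20 * (ρ ^ 2 + ω * ρ) * Real.log ρ := by
    have h3 : √3 ≤ 2 := Real.sqrt_le_iff.2 ⟨by norm_num, by norm_num⟩
    calc √3 / ω ^ 4 * (3 * (√2 * (ω ^ 4 * ρ ^ 2))) = 3 * (√3 * √2) * ρ ^ 2 * 1 := by
          field_simp
      _ ≤ 3 * (2 * 1.6) * (ρ ^ 2 + ω * ρ) * (2 * Real.log ρ) := by
        gcongr
        · linarith
        · exact le_add_of_nonneg_right (by positivity)
      _ ≤ 10 * (ρ ^ 2 + ω * ρ) * (2 * Real.log ρ) := by gcongr; norm_num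
      _ = _ := by ring
  have hB' : C1 * ρ / ω ^ 2 * (C2 * (ω ^ 2 * ρ + ω ^ 3) * Real.log ρ) =
      C1 * C2 * (ρ ^ 2 + ω * ρ) * Real.log ρ := by field_simp
  rw [hB'] at hB
  set X := ∑ k ∈ Finset.Icc ⌈ω ^ 4 * ρ ^ 2⌉₊ ⌊√2 * (ω ^ 4 * ρ ^ 2)⌋₊, (d k : ℂ) * u k
  set Y := ∑ m ∈ Finset.Icc 1 K,
        ∑ b ∈ Finset.Ioc ⌊max (m : ℝ) (ω ^ 4 * ρ ^ 2 / m)⌋₊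
        ⌊√2 * (ω ^ 4 * ρ ^ 2) / m⌋₊, u (m * b)
  set V := ∑ m ∈ Finset.Icc 1 K,
      ∑ a ∈ Finset.Icc ⌈m * ρ ^ 2 / ω ^ 2 / 2⌉₊ ⌊4 * (m * ρ ^ 2 / ω ^ 2)⌋₊,
        stationaryTerm ω ρ a m
  have e : ((√3 / ω ^ 4 : ℝ) : ℂ) * X - 2 * V = ((√3 / ω ^ 4 : ℝ) : ℂ) * (X - 2 * Y) +
      2 * (((√3 / ω ^ 4 : ℝ) : ℂ) * Y - V) := by ring
  have hn : ‖((√3 / ω ^ 4 : ℝ) : ℂ)‖ = √3 / ω ^ 4 := by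
    rw [Complex.norm_real, Real.norm_eq_abs, abs_of_nonneg (by positivity)]
  calc ‖((√3 / ω ^ 4 : ℝ) : ℂ) * X - 2 * V‖ ≤
        √3 / ω ^ 4 * ‖X - 2 * Y‖ + 2 * ‖((√3 / ω ^ 4 : ℝ) : ℂ) * Y - V‖ := by
        rw [e]; refine (norm_add_le _ _).trans (by rw [norm_mul, norm_mul, hn]; norm_num)
    _ ≤ √3 / ω ^ 4 * (3 * (√2 * (ω ^ 4 * ρ ^ 2))) +
        2 * ‖((√3 / ω ^ 4 : ℝ) : ℂ) * Y - V‖ := by gcongr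
    _ ≤ _ := by linarith

lemma exists_norm_sum_cubic_sub_sum_quadratic_le {c : ℝ} (hc : 0 < c) : ∃ C : ℝ, 0 < C ∧
    ∀ ω ρ : ℝ, 0 < ω → 2 ≤ ρ → c ≤ ω ^ 2 * ρ →
    ‖∑ k ∈ Finset.Icc ⌈ρ ^ 6⌉₊ ⌊2 * √2 * ρ ^ 6⌋₊, (d k : ℂ) *
        ((((k : ℝ) ^ (-(1 : ℝ) / 6) : ℝ) : ℂ) * ee (3 / 2 * (ω ^ 3 * k) ^ ((2 : ℝ) / 3))) -
      ((√3 / ω ^ 4 : ℝ) : ℂ) * ∑ k ∈ Finset.Icc ⌈ω ^ 4 * ρ ^ 2⌉₊ ⌊√2 * (ω ^ 4 * ρ ^ 2)⌋₊,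
        (d k : ℂ) * ((√k : ℂ) * ee (-((k : ℝ) ^ 2 / (2 * ω ^ 6))))‖ ≤
    C * (ρ ^ 2 + ω * ρ) * Real.log ρ := by
  obtain ⟨C1, hC1, h1⟩ := eventually_norm_sum_cubic_sub_le hc
  obtain ⟨C2, hC2, h2⟩ := eventually_norm_sum_quadratic_sub_le
  refine ⟨C1 + C2, by positivity, ?_⟩
  intro ω ρ hω hρ hcω
  obtain ⟨L, hL1, hL2⟩ := ((h1 ω ρ hω hρ hcω).and (h2 ω ρ hω hρ)).exists
  rw [← Complex.norm_conj] at hL2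
  simp only [map_sub, map_mul, map_sum, Complex.conj_ofReal, conj_ee, map_natCast,
    map_ofNat] at hL1 hL2
  rw [norm_sub_rev] at hL2
  refine (norm_sub_le_norm_sub_add_norm_sub _ _ _).trans ((add_le_add hL1 hL2).trans ?_)
  exact (by ring : _ = (C1 + C2) * (ρ ^ 2 + ω * ρ) * Real.log ρ).le

noncomputable def cubicSum (ω ρ : ℝ) : ℂ :=
  ∑ k ∈ Finset.Icc ⌈ρ ^ 6⌉₊ ⌊2 * √2 * ρ ^ 6⌋₊, (d k : ℂ) *
    ((((k : ℝ) ^ (-(1 : ℝ) / 6) : ℝ) : ℂ) * ee (3 / 2 * (ω ^ 3 * k) ^ ((2 : ℝ) / 3)))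

noncomputable def quadraticSum (ω ρ : ℝ) : ℂ :=
  ((√3 / ω ^ 4 : ℝ) : ℂ) * ∑ k ∈ Finset.Icc ⌈ω ^ 4 * ρ ^ 2⌉₊ ⌊√2 * (ω ^ 4 * ρ ^ 2)⌋₊,
    (d k : ℂ) * ((√k : ℂ) * ee (-((k : ℝ) ^ 2 / (2 * ω ^ 6))))

lemma sum_card_divisors_le (n : ℕ) :
    ∑ k ∈ Finset.Icc 1 n, (d k : ℝ) ≤ n * (1 + Real.log n) := by
  rcases Nat.eq_zero_or_pos n with rfl | hn
  · simp
  have h1 : ∑ k ∈ Finset.Icc 1 n, d k = ∑ a ∈ Finset.Icc 1 n, n / a := by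
    have h := ArithmeticFunction.sum_Ioc_sigma0_eq_sum_div n
    simp only [ArithmeticFunction.sigma_zero_apply] at h
    exact h
  have h2 := sum_Icc_one_div_nat_le le_rfl hn
  simp only [Nat.cast_one, div_one] at h2
  calc ∑ k ∈ Finset.Icc 1 n, (d k : ℝ) = ∑ a ∈ Finset.Icc 1 n, ((n / a : ℕ) : ℝ) := by
        exact_mod_cast h1
    _ ≤ ∑ a ∈ Finset.Icc 1 n, (n : ℝ) * (1 / a) := Finset.sum_le_sum fun a _ =>
        Nat.cast_div_le.trans (by rw [mul_one_div])
    _ = n * ∑ a ∈ Finset.Icc 1 n, 1 / (a : ℝ) := by rw [Finset.mul_sum]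
    _ ≤ _ := by gcongr

lemma norm_sum_card_divisors_mul_le {x y U B : ℝ} {u : ℕ → ℂ} (hx : 0 < x) (hy : 0 ≤ y)
    (hU0 : 0 ≤ U) (hB : 1 + Real.log y ≤ B) (hB0 : 0 ≤ B)
    (hU : ∀ k : ℕ, x ≤ k → k ≤ y → ‖u k‖ ≤ U) :
    ‖∑ k ∈ Finset.Icc ⌈x⌉₊ ⌊y⌋₊, (d k : ℂ) * u k‖ ≤ U * (y * B) := by
  have hn : (⌊y⌋₊ : ℝ) ≤ y := Nat.floor_le hy
  calc ‖∑ k ∈ Finset.Icc ⌈x⌉₊ ⌊y⌋₊, (d k : ℂ) * u k‖ ≤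
        ∑ k ∈ Finset.Icc ⌈x⌉₊ ⌊y⌋₊, U * (d k : ℝ) := by
        refine (norm_sum_le _ _).trans (Finset.sum_le_sum fun k hk => ?_)
        obtain ⟨h1, h2⟩ := Finset.mem_Icc.1 hk
        rw [norm_mul, Complex.norm_natCast, mul_comm]
        gcongr
        exact hU k (Nat.ceil_le.1 h1) ((Nat.le_floor_iff hy).1 h2)
    _ ≤ ∑ k ∈ Finset.Icc 1 ⌊y⌋₊, U * (d k : ℝ) :=
        Finset.sum_le_sum_of_subset_of_nonneg
          (Finset.Icc_subset_Icc (Nat.one_le_ceil_iff.2 hx) le_rfl) fun _ _ _ => by positivity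
    _ = U * ∑ k ∈ Finset.Icc 1 ⌊y⌋₊, (d k : ℝ) := by rw [Finset.mul_sum]
    _ ≤ U * (⌊y⌋₊ * (1 + Real.log ⌊y⌋₊)) := by gcongr; exact sum_card_divisors_le _
    _ ≤ U * (y * B) := by
        refine mul_le_mul_of_nonneg_left ?_ hU0
        rcases Nat.eq_zero_or_pos ⌊y⌋₊ with h0 | h0
        · rw [h0]; simp only [Nat.cast_zero, zero_mul]; positivity
        · have h1 : (0 : ℝ) < ⌊y⌋₊ := by exact_mod_cast h0
          have h2 := Real.log_le_log h1 hn
          calc (⌊y⌋₊ : ℝ) * (1 + Real.log ⌊y⌋₊) ≤ ⌊y⌋₊ * B := by gcongr; linarith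
            _ ≤ _ := by gcongr

lemma norm_cubicSum_le (ω : ℝ) {ρ : ℝ} (hρ : 2 ≤ ρ) :
    ‖cubicSum ω ρ‖ ≤ 30 * ρ ^ 5 * Real.log ρ := by
  have hρ0 : 0 < ρ := by linarith
  obtain ⟨h2l, h2u⟩ := sqrt_two_bounds
  have hlog := one_le_two_mul_log hρ
  have hρ2 : 4 ≤ ρ ^ 2 := by nlinarith
  have hy : 2 * √2 * ρ ^ 6 ≤ 3 * ρ ^ 6 := by gcongr; linarith
  have hB := log_le_mul_log_of_le (ρ := ρ) (x := 2 * √2 * ρ ^ 6) 8 (by positivity) (hy.trans (by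
    rw [show ρ ^ 8 = ρ ^ 2 * ρ ^ 6 by ring]; gcongr; linarith))
  push_cast at hB
  refine (norm_sum_card_divisors_mul_le (x := ρ ^ 6) (y := 2 * √2 * ρ ^ 6) (U := 1 / ρ)
    (B := 10 * Real.log ρ) (by positivity) (by positivity) (by positivity) (by linarith)
    (by linarith) ?_).trans ?_
  · intro k hk _
    simp only [norm_mul, norm_ee, mul_one, Complex.norm_real, Real.norm_eq_abs]
    rw [abs_of_nonneg (by positivity)]
    calc (k : ℝ) ^ (-(1 : ℝ) / 6) ≤ (ρ ^ 6) ^ (-(1 : ℝ) / 6) :=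
          Real.rpow_le_rpow_of_nonpos (by positivity) hk (by norm_num)
      _ = 1 / ρ := by
          rw [← Real.rpow_natCast, ← Real.rpow_mul hρ0.le]
          norm_num [Real.rpow_neg_one]
  · calc 1 / ρ * (2 * √2 * ρ ^ 6 * (10 * Real.log ρ)) ≤
          1 / ρ * (3 * ρ ^ 6 * (10 * Real.log ρ)) := by gcongr; linarith
      _ = _ := by field_simp; norm_num; ring

lemma norm_quadraticSum_le {ω ρ : ℝ} (hω : 0 < ω) (hρ : 2 ≤ ρ) (hωρ : ω ≤ ρ) :
    ‖quadraticSum ω ρ‖ ≤ 30 * (ω ^ 2 * ρ ^ 3) * Real.log ρ := by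
  have hρ0 : 0 < ρ := by linarith
  obtain ⟨h2l, h2u⟩ := sqrt_two_bounds
  have hlog := one_le_two_mul_log hρ
  have hB := log_le_mul_log_of_le (ρ := ρ) (x := √2 * (ω ^ 4 * ρ ^ 2)) 7 (by positivity) (by
    calc √2 * (ω ^ 4 * ρ ^ 2) ≤ ρ * (ρ ^ 4 * ρ ^ 2) := by gcongr; linarith
      _ = _ := by ring)
  push_cast at hB
  have hs : √(√2 * (ω ^ 4 * ρ ^ 2)) ≤ 1.2 * (ω ^ 2 * ρ) := by
    refine Real.sqrt_le_iff.2 ⟨by positivity, ?_⟩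
    have : 0 < ω ^ 4 * ρ ^ 2 := by positivity
    nlinarith
  have h3 : √3 ≤ 1.8 := Real.sqrt_le_iff.2 ⟨by norm_num, by norm_num⟩
  have h := norm_sum_card_divisors_mul_le (x := ω ^ 4 * ρ ^ 2) (y := √2 * (ω ^ 4 * ρ ^ 2))
    (U := 1.2 * (ω ^ 2 * ρ)) (B := 9 * Real.log ρ)
    (u := fun k => (√k : ℂ) * ee (-((k : ℝ) ^ 2 / (2 * ω ^ 6)))) (by positivity) (by positivity)
    (by positivity) (by linarith) (by linarith) (by
      intro k _ hk
      simp only [norm_mul, norm_ee, mul_one, Complex.norm_real, Real.norm_eq_abs]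
      rw [abs_of_nonneg (by positivity)]
      exact (Real.sqrt_le_sqrt hk).trans hs)
  have hn : ‖((√3 / ω ^ 4 : ℝ) : ℂ)‖ = √3 / ω ^ 4 := by
    rw [Complex.norm_real, Real.norm_eq_abs, abs_of_nonneg (by positivity)]
  rw [quadraticSum, norm_mul, hn]
  calc _ ≤ √3 / ω ^ 4 * (1.2 * (ω ^ 2 * ρ) * (√2 * (ω ^ 4 * ρ ^ 2) * (9 * Real.log ρ))) := by
        gcongr
    _ = √3 * √2 * 10.8 * ((ω ^ 2 * ρ ^ 3) * Real.log ρ) := by field_simp; norm_num; ring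
    _ ≤ 1.8 * 1.415 * 10.8 * ((ω ^ 2 * ρ ^ 3) * Real.log ρ) := by
        have : 0 ≤ Real.log ρ := by linarith
        gcongr
    _ ≤ 30 * ((ω ^ 2 * ρ ^ 3) * Real.log ρ) := by
        have : 0 ≤ Real.log ρ := by linarith
        gcongr; norm_num
    _ = _ := by ring

lemma exists_norm_cubicSum_le {c : ℝ} (hc : 0 < c) : ∃ C : ℝ, 0 < C ∧ ∀ ω ρ : ℝ,
    0 < ω → 2 ≤ ρ → c ≤ ω ^ 2 * ρ → ‖cubicSum ω ρ‖ ≤ C * (ω ^ 2 * ρ ^ 3) * Real.log ρ := by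
  obtain ⟨C, hC, h⟩ := exists_norm_sum_cubic_sub_sum_quadratic_le hc
  refine ⟨30 + 2 * C / c, by positivity, ?_⟩
  intro ω ρ hω hρ hcω
  have hρ0 : 0 < ρ := by linarith
  have hlog := one_le_two_mul_log hρ
  have hl : 0 ≤ Real.log ρ := by linarith
  have hC' : 0 ≤ 2 * C / c * (ω ^ 2 * ρ ^ 3) * Real.log ρ := by positivity
  rcases le_total ω ρ with hωρ | hωρ
  · have h1 : ‖cubicSum ω ρ - quadraticSum ω ρ‖ ≤ C * (ρ ^ 2 + ω * ρ) * Real.log ρ :=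
      h ω ρ hω hρ hcω
    have h2 := norm_quadraticSum_le hω hρ hωρ
    have h3 : C * (ρ ^ 2 + ω * ρ) * Real.log ρ ≤
        2 * C / c * (ω ^ 2 * ρ ^ 3) * Real.log ρ := by
      refine mul_le_mul_of_nonneg_right ?_ hl
      calc C * (ρ ^ 2 + ω * ρ) ≤ C * (ρ ^ 2 + ρ * ρ) := by gcongr
        _ = 2 * C / c * (c * ρ ^ 2) := by field_simp; norm_num
        _ ≤ 2 * C / c * (ω ^ 2 * ρ * ρ ^ 2) := by gcongr
        _ = _ := by ring
    have h4 := norm_sub_norm_le (cubicSum ω ρ) (quadraticSum ω ρ)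
    linarith
  · have h1 := norm_cubicSum_le ω hρ
    have h2 : 30 * ρ ^ 5 * Real.log ρ ≤ 30 * (ω ^ 2 * ρ ^ 3) * Real.log ρ := by
      gcongr
      calc ρ ^ 5 = ρ ^ 2 * ρ ^ 3 := by ring
        _ ≤ _ := by gcongr
    linarith

lemma cubicSum_eq {A N : ℝ} (hA : 0 < A) (hN : 0 < N) :
    cubicSum (A ^ ((1 : ℝ) / 3)) (N ^ ((1 : ℝ) / 6)) =
    ∑ k ∈ Finset.Icc ⌈N⌉₊ ⌊2 * √2 * N⌋₊, (d k : ℂ) * (((k : ℝ) ^ (-(1 : ℝ) / 6) : ℝ) : ℂ) *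
      Complex.exp (3 * π * I * (((A * k) ^ ((2 : ℝ) / 3) : ℝ) : ℂ)) := by
  have e1 : (N ^ ((1 : ℝ) / 6)) ^ 6 = N := by
    rw [← Real.rpow_natCast, ← Real.rpow_mul hN.le]; norm_num
  rw [cubicSum, e1, rpow_third_pow hA.le]
  refine Finset.sum_congr rfl fun k _ => ?_
  rw [mul_assoc, ee]
  congr 3
  push_cast
  ring

lemma rpow_third_pow_four {A : ℝ} (hA : 0 < A) :
    (A ^ ((1 : ℝ) / 3)) ^ 4 = A ^ ((4 : ℝ) / 3) := by
  rw [← Real.rpow_natCast, ← Real.rpow_mul hA.le]; norm_num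

lemma rpow_sixth_sq {N : ℝ} (hN : 0 < N) : (N ^ ((1 : ℝ) / 6)) ^ 2 = N ^ ((1 : ℝ) / 3) := by
  rw [← Real.rpow_natCast, ← Real.rpow_mul hN.le]; norm_num

lemma quadraticSum_eq {A N : ℝ} (hA : 0 < A) (hN : 0 < N) :
    quadraticSum (A ^ ((1 : ℝ) / 3)) (N ^ ((1 : ℝ) / 6)) =
    ((√3 * A ^ (-(4 : ℝ) / 3) : ℝ) : ℂ) *
      ∑ k ∈ Finset.Icc ⌈A ^ ((4 : ℝ) / 3) * N ^ ((1 : ℝ) / 3)⌉₊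
          ⌊√2 * A ^ ((4 : ℝ) / 3) * N ^ ((1 : ℝ) / 3)⌋₊,
        (d k : ℂ) * (((k : ℝ) ^ ((1 : ℝ) / 2) : ℝ) : ℂ) *
          Complex.exp (-(π * I) * ((((k : ℝ) / A) ^ 2 : ℝ) : ℂ)) := by
  have e6 : (A ^ ((1 : ℝ) / 3)) ^ 6 = A ^ 2 := by
    rw [← Real.rpow_natCast, ← Real.rpow_natCast, ← Real.rpow_mul hA.le]; norm_num
  rw [quadraticSum, rpow_third_pow_four hA, rpow_sixth_sq hN, e6, neg_div,
    Real.rpow_neg hA.le, div_eq_mul_inv, mul_assoc √2]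
  congr 1
  refine Finset.sum_congr rfl fun k _ => ?_
  rw [mul_assoc, ee, ← Real.sqrt_eq_rpow]
  congr 3
  push_cast
  field_simp

theorem stmt1 (ε : ℝ) (hε : 0 < ε) (A : ℕ → ℝ) (hApos : ∀ N, 0 < A N)
    (hA : (fun N : ℕ => (N : ℝ) ^ (-(1:ℝ)/4)) =O[atTop] A) :
    ((fun N : ℕ =>
        (∑ k ∈ Finset.Icc N ⌊2 * Real.sqrt 2 * (N : ℝ)⌋₊,
          (d k : ℂ) * (((k : ℝ) ^ (-(1:ℝ)/6) : ℝ) : ℂ) *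
            Complex.exp (3 * π * I * (((A N * k) ^ ((2:ℝ)/3) : ℝ) : ℂ))) -
          ((Real.sqrt 3 * (A N) ^ (-(4:ℝ)/3) : ℝ) : ℂ) *
            ∑ k ∈ Finset.Icc ⌈(A N) ^ ((4:ℝ)/3) * (N : ℝ) ^ ((1:ℝ)/3)⌉₊
                ⌊Real.sqrt 2 * (A N) ^ ((4:ℝ)/3) * (N : ℝ) ^ ((1:ℝ)/3)⌋₊,
              (d k : ℂ) * (((k : ℝ) ^ ((1:ℝ)/2) : ℝ) : ℂ) *
                Complex.exp (-(π * I) * ((((k : ℝ) / A N) ^ 2 : ℝ) : ℂ)))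
      =O[atTop] fun N : ℕ =>
        (A N) ^ (-(1:ℝ)/3) * (N : ℝ) ^ ((1:ℝ)/2 + ε) +
          (A N) ^ ((1:ℝ)/3) * (N : ℝ) ^ ((1:ℝ)/6) * Real.log N +
          (A N) ^ (-(1:ℝ)/9) * (N : ℝ) ^ ((2:ℝ)/9 + ε)) ∧
    ((fun N : ℕ =>
        ∑ k ∈ Finset.Icc N ⌊2 * Real.sqrt 2 * (N : ℝ)⌋₊,
          (d k : ℂ) * (((k : ℝ) ^ (-(1:ℝ)/6) : ℝ) : ℂ) *
            Complex.exp (3 * π * I * (((A N * k) ^ ((2:ℝ)/3) : ℝ) : ℂ)))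
      =O[atTop] fun N : ℕ => (A N) ^ ((2:ℝ)/3) * (N : ℝ) ^ ((1:ℝ)/2) * Real.log N) := by
  obtain ⟨K, hK, hKA⟩ := hA.exists_pos
  rw [Asymptotics.isBigOWith_iff] at hKA
  set c : ℝ := K⁻¹ ^ ((2 : ℝ) / 3) with hc
  have hc0 : 0 < c := by positivity
  have hrange : ∀ᶠ N : ℕ in atTop, 2 ≤ (N : ℝ) ^ ((1 : ℝ) / 6) ∧
      c ≤ (A N ^ ((1 : ℝ) / 3)) ^ 2 * (N : ℝ) ^ ((1 : ℝ) / 6) := by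
    filter_upwards [hKA, eventually_ge_atTop 64] with N hN h64
    have h64' : (64 : ℝ) ≤ N := by exact_mod_cast h64
    have hN0 : (0 : ℝ) < N := by linarith
    have hAN := hApos N
    constructor
    · calc (2 : ℝ) = ((2 : ℝ) ^ (6 : ℝ)) ^ ((1 : ℝ) / 6) := by
            rw [← Real.rpow_mul (by norm_num)]; norm_num
        _ ≤ _ := by gcongr; norm_num; linarith
    · rw [Real.norm_of_nonneg (by positivity), Real.norm_of_nonneg hAN.le] at hN
      have h1 : K⁻¹ * (N : ℝ) ^ (-(1 : ℝ) / 4) ≤ A N := by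
        rw [inv_mul_le_iff₀ hK]; exact hN
      have h2 := Real.rpow_le_rpow (by positivity) h1 (show (0 : ℝ) ≤ 2 / 3 by norm_num)
      rw [Real.mul_rpow (by positivity) (by positivity), ← Real.rpow_mul hN0.le] at h2
      have e : (A N ^ ((1 : ℝ) / 3)) ^ 2 = A N ^ ((2 : ℝ) / 3) := by
        rw [← Real.rpow_natCast, ← Real.rpow_mul hAN.le]; norm_num
      rw [e]
      calc c = c * (N : ℝ) ^ (-(1 : ℝ) / 4 * (2 / 3)) * (N : ℝ) ^ ((1 : ℝ) / 6) := by
            rw [mul_assoc, ← Real.rpow_add hN0]; norm_num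
        _ ≤ _ := by gcongr
  have hlogN : ∀ N : ℕ, 1 ≤ N → Real.log ((N : ℝ) ^ ((1 : ℝ) / 6)) ≤ Real.log N := by
    intro N hN
    have hN1 : (1 : ℝ) ≤ N := by exact_mod_cast hN
    rw [Real.log_rpow (by linarith)]
    have := Real.log_nonneg hN1
    linarith
  constructor
  · obtain ⟨C, hC, h⟩ := exists_norm_sum_cubic_sub_sum_quadratic_le hc0
    refine Asymptotics.IsBigO.of_bound (C * (1 / ε + 2)) ?_
    filter_upwards [hrange, eventually_ge_atTop 1] with N hN hN1
    have hN0 : (0 : ℝ) < N := by exact_mod_cast hN1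
    have hAN := hApos N
    have hbound : ‖cubicSum (A N ^ ((1 : ℝ) / 3)) ((N : ℝ) ^ ((1 : ℝ) / 6)) -
        quadraticSum (A N ^ ((1 : ℝ) / 3)) ((N : ℝ) ^ ((1 : ℝ) / 6))‖ ≤ _ :=
      h _ _ (by positivity) hN.1 hN.2
    rw [cubicSum_eq hAN hN0, quadraticSum_eq hAN hN0, Nat.ceil_natCast] at hbound
    refine hbound.trans ?_
    have hT3 : 0 ≤ A N ^ (-(1 : ℝ) / 9) * (N : ℝ) ^ ((2 : ℝ) / 9 + ε) := by positivity
    have hl := Real.log_nonneg (show (1 : ℝ) ≤ N by exact_mod_cast hN1)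
    rw [Real.norm_of_nonneg (by positivity)]
    have hle := Real.log_le_rpow_div hN0.le hε
    have e1 : A N ^ (-(1 : ℝ) / 3) * (N : ℝ) ^ ((1 : ℝ) / 2 + ε) =
        ((N : ℝ) ^ ((1 : ℝ) / 6)) ^ 3 / A N ^ ((1 : ℝ) / 3) * (N : ℝ) ^ ε := by
      rw [neg_div, Real.rpow_neg hAN.le, Real.rpow_add hN0, ← Real.rpow_natCast,
        ← Real.rpow_mul hN0.le]
      norm_num
      ring
    rw [e1]
    set ω := A N ^ ((1 : ℝ) / 3) with hω
    set ρ := (N : ℝ) ^ ((1 : ℝ) / 6) with hρ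
    have hω0 : 0 < ω := by positivity
    have hρ0 : 0 < ρ := by positivity
    have hamgm : ρ ^ 2 ≤ ρ ^ 3 / ω + ω * ρ := by
      rw [div_add' _ _ _ hω0.ne', le_div_iff₀ hω0]
      nlinarith [mul_nonneg hρ0.le (sq_nonneg (ρ - ω)), mul_pos hρ0 (mul_pos hρ0 hω0)]
    calc C * (ρ ^ 2 + ω * ρ) * Real.log ρ ≤ C * (ρ ^ 3 / ω + ω * ρ + ω * ρ) * Real.log N := by
          have := hlogN N hN1
          have : 0 ≤ Real.log ρ := Real.log_nonneg (by linarith [hN.1])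
          gcongr
      _ = C * (ρ ^ 3 / ω * Real.log N + 2 * (ω * ρ * Real.log N)) := by ring
      _ ≤ C * (ρ ^ 3 / ω * ((N : ℝ) ^ ε / ε) + 2 * (ω * ρ * Real.log N)) := by gcongr
      _ = C * (1 / ε * (ρ ^ 3 / ω * (N : ℝ) ^ ε) + 2 * (ω * ρ * Real.log N)) := by ring
      _ ≤ C * ((1 / ε + 2) * (ρ ^ 3 / ω * (N : ℝ) ^ ε + ω * ρ * Real.log N +
          A N ^ (-(1 : ℝ) / 9) * (N : ℝ) ^ ((2 : ℝ) / 9 + ε))) := by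
          have hT1 : 0 ≤ ρ ^ 3 / ω * (N : ℝ) ^ ε := by positivity
          have hT2 : 0 ≤ ω * ρ * Real.log N := by positivity
          have hε1 : 0 ≤ 1 / ε := by positivity
          gcongr
          nlinarith [mul_nonneg hε1 hT2, mul_nonneg hε1 hT3]
      _ = _ := by ring
  · obtain ⟨C, hC, h⟩ := exists_norm_cubicSum_le hc0
    refine Asymptotics.IsBigO.of_bound C ?_
    filter_upwards [hrange, eventually_ge_atTop 1] with N hN hN1
    have hN0 : (0 : ℝ) < N := by exact_mod_cast hN1
    have hAN := hApos N
    have hbound := h _ _ (by positivity) hN.1 hN.2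
    rw [cubicSum_eq hAN hN0, Nat.ceil_natCast] at hbound
    refine hbound.trans ?_
    have hl := Real.log_nonneg (show (1 : ℝ) ≤ N by exact_mod_cast hN1)
    have e1 : (A N ^ ((1 : ℝ) / 3)) ^ 2 = A N ^ ((2 : ℝ) / 3) := by
      rw [← Real.rpow_natCast, ← Real.rpow_mul hAN.le]; norm_num
    have e2 : ((N : ℝ) ^ ((1 : ℝ) / 6)) ^ 3 = (N : ℝ) ^ ((1 : ℝ) / 2) := by
      rw [← Real.rpow_natCast, ← Real.rpow_mul hN0.le]; norm_num
    rw [Real.norm_of_nonneg (by positivity), e1, e2, mul_assoc C]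
    have := hlogN N hN1
    gcongr
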